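/- arXiv:1506.01685 — 4 statements merged into one kernel-verified Lean document; each statement's English description precedes it below -/
import Mathlib

section
/- Let F be an aperiodic countable measure-preserving equivalence relation on a standard probability space (X,μ), L a Borel forest of lines for F, and ε > 0. Then there exists θ ∈ [F] such that ν(L Δ L(θ)) < ε, where L(θ) = graph(θ) ∪ graph(θ^{-1}) and ν is the counting measure on F. -/
open MeasureTheory
open scoped ENNReal

/-- The counting measure of a Borel subset `C` of an equivalence relation on `(X,μ)`:
`ν(C) = ∫ Card (C ∩ ({x} × X)) dμ(x)`. -/
noncomputable def countingMeasure {X : Type*} [MeasurableSpace X] (μ : Measure X)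
    (C : Set (X × X)) : ℝ≥0∞ :=
  ∫⁻ x, ({y | (x, y) ∈ C}.encard : ℝ≥0∞) ∂μ


section core
variable {X : Type*}

/-- `walkRel f g S k x y`: there is a path of length at most `k` from `x` to `y` outside `S`. -/
def walkRel (f g : X → X) (S : Set X) : ℕ → X → X → Prop
  | 0, x, y => x = y ∧ y ∉ S
  | k+1, x, y => y ∉ S ∧ (walkRel f g S k x y ∨ walkRel f g S k x (f y) ∨ walkRel f g S k x (g y))

/-- adjacency -/
def adjRel (f g : X → X) (x y : X) : Prop := y = f x ∨ y = g x

variable {f g : X → X} {S : Set X}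

theorem walkRel_right {k : ℕ} {x y : X} (h : walkRel f g S k x y) : y ∉ S := by
  cases k with
  | zero => exact h.2
  | succ k => exact h.1

theorem walkRel_succ {k : ℕ} {x y : X} (h : walkRel f g S k x y) : walkRel f g S (k+1) x y :=
  ⟨walkRel_right h, Or.inl h⟩

theorem walkRel_mono {k j : ℕ} (hkj : k ≤ j) {x y : X} (h : walkRel f g S k x y) :
    walkRel f g S j x y := by
  induction hkj with
  | refl => exact h
  | step _ ih => exact walkRel_succ ih

theorem walkRel_refl {x : X} (hx : x ∉ S) (k : ℕ) : walkRel f g S k x x :=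
  walkRel_mono (Nat.zero_le k) ⟨rfl, hx⟩

theorem walkRel_step (hs : ∀ x y, adjRel f g x y → adjRel f g y x) {k : ℕ} {x z y : X}
    (h : walkRel f g S k x z) (ha : adjRel f g z y) (hy : y ∉ S) : walkRel f g S (k+1) x y := by
  refine ⟨hy, Or.inr ?_⟩
  rcases hs _ _ ha with h1 | h1
  · left; rwa [← h1]
  · right; rwa [← h1]

theorem walkRel_cases (hs : ∀ x y, adjRel f g x y → adjRel f g y x) {k : ℕ} {x y : X}
    (h : walkRel f g S (k+1) x y) :
    walkRel f g S k x y ∨ ∃ z, walkRel f g S k x z ∧ adjRel f g z y := by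
  rcases h.2 with h1 | h1 | h1
  · exact Or.inl h1
  · exact Or.inr ⟨_, h1, hs _ _ (Or.inl rfl)⟩
  · exact Or.inr ⟨_, h1, hs _ _ (Or.inr rfl)⟩

theorem walkRel_left (hs : ∀ x y, adjRel f g x y → adjRel f g y x) {x x' : X}
    (ha : adjRel f g x x') (hx' : x' ∉ S) {k : ℕ} : ∀ {y : X},
    walkRel f g S k x y → walkRel f g S (k+1) x' y := by
  induction k with
  | zero =>
    rintro y ⟨rfl, hy⟩
    exact walkRel_step hs (walkRel_refl hx' 0) (hs _ _ ha) hy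
  | succ k ih =>
    intro y h
    rcases walkRel_cases hs h with h1 | ⟨z, h1, h2⟩
    · exact walkRel_succ (ih h1)
    · exact walkRel_step hs (ih h1) h2 (walkRel_right h)

theorem walkRel_symm (hs : ∀ x y, adjRel f g x y → adjRel f g y x) {x : X} {k : ℕ} :
    ∀ {y : X}, walkRel f g S k x y → walkRel f g S k y x := by
  induction k with
  | zero => rintro y ⟨rfl, hy⟩; exact ⟨rfl, hy⟩
  | succ k ih =>
    intro y h
    rcases walkRel_cases hs h with h1 | ⟨z, h1, h2⟩
    · exact walkRel_succ (ih h1)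
    · exact walkRel_left hs h2 (walkRel_right h) (ih h1)

theorem walkRel_trans (hs : ∀ x y, adjRel f g x y → adjRel f g y x) {x y : X} {j k : ℕ}
    (h : walkRel f g S j x y) : ∀ {z : X}, walkRel f g S k y z → walkRel f g S (j+k) x z := by
  induction k with
  | zero => rintro z ⟨rfl, hy⟩; exact h
  | succ k ih =>
    intro z h'
    rcases walkRel_cases hs h' with h1 | ⟨w, h1, h2⟩
    · exact walkRel_succ (ih h1)
    · exact walkRel_step hs (ih h1) h2 (walkRel_right h')

theorem walkRel_empty {x : X} {k : ℕ} : ∀ {y : X}, walkRel f g S k x y → walkRel f g ∅ k x y := by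
  induction k with
  | zero => rintro y ⟨rfl, _⟩; exact ⟨rfl, id⟩
  | succ k ih =>
    rintro y ⟨_, h⟩
    exact ⟨id, h.imp ih (Or.imp ih ih)⟩

/-- The list of words of length at most `k` in `f` and `g`. -/
def wordFam (f g : X → X) : ℕ → List (X → X)
  | 0 => [id]
  | k+1 => wordFam f g k ++ ((wordFam f g k).map (fun q => f ∘ q) ++
      (wordFam f g k).map (fun q => g ∘ q))

theorem walkRel_iff_word (hs : ∀ x y, adjRel f g x y → adjRel f g y x) {x : X} {k : ℕ} :
    ∀ {y : X}, walkRel f g ∅ k x y ↔ ∃ q ∈ wordFam f g k, y = q x := by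
  induction k with
  | zero =>
    intro y
    simp [walkRel, wordFam, eq_comm]
  | succ k ih =>
    intro y
    constructor
    · intro h
      rcases walkRel_cases hs h with h1 | ⟨z, h1, h2⟩
      · obtain ⟨q, hq, e⟩ := ih.1 h1
        exact ⟨q, by simp [wordFam, hq], e⟩
      · obtain ⟨q, hq, rfl⟩ := ih.1 h1
        rcases h2 with h2 | h2
        · exact ⟨f ∘ q, by simp only [wordFam, List.mem_append, List.mem_map]; exact Or.inr (Or.inl ⟨q, hq, rfl⟩), h2⟩
        · exact ⟨g ∘ q, by simp only [wordFam, List.mem_append, List.mem_map]; exact Or.inr (Or.inr ⟨q, hq, rfl⟩), h2⟩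
    · rintro ⟨q, hq, rfl⟩
      simp only [wordFam, List.mem_append, List.mem_map] at hq
      rcases hq with hq | ⟨q, hq, rfl⟩ | ⟨q, hq, rfl⟩
      · exact walkRel_succ (ih.2 ⟨q, hq, rfl⟩)
      · exact walkRel_step hs (ih.2 ⟨q, hq, rfl⟩) (Or.inl rfl) id
      · exact walkRel_step hs (ih.2 ⟨q, hq, rfl⟩) (Or.inr rfl) id

open Classical in
theorem word_card (hs : ∀ x y, adjRel f g x y → adjRel f g y x)
    (hinf : ∀ x (T : Set X), T.Finite → x ∈ T → (∀ y ∈ T, f y ∈ T ∧ g y ∈ T) → False)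
    (x : X) (k : ℕ) : k + 1 ≤ ((wordFam f g k).map (fun q => q x)).toFinset.card := by
  have hmem : ∀ k y, y ∈ ((wordFam f g k).map (fun q => q x)).toFinset ↔ walkRel f g ∅ k x y := by
    intro k y
    rw [walkRel_iff_word hs]
    simp [eq_comm]
  induction k with
  | zero => simp [wordFam]
  | succ k ih =>
    refine Nat.succ_le_of_lt (lt_of_le_of_lt ih (Finset.card_lt_card ?_))
    refine ⟨fun y hy => (hmem _ _).2 (walkRel_succ ((hmem _ _).1 hy)), fun hsub => ?_⟩
    refine hinf x ↑((wordFam f g k).map (fun q => q x)).toFinset (Finset.finite_toSet _) ?_ ?_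
    · exact Finset.mem_coe.2 ((hmem _ _).2 (walkRel_refl id k))
    · intro y hy
      have := (hmem _ _).1 (Finset.mem_coe.1 hy)
      exact ⟨Finset.mem_coe.2 (hsub ((hmem _ _).2 (walkRel_step hs this (Or.inl rfl) id))),
        Finset.mem_coe.2 (hsub ((hmem _ _).2 (walkRel_step hs this (Or.inr rfl) id)))⟩

/-- level sets of the distance to `s` -/
def levRel (f g : X → X) (S : Set X) (s : X) (k : ℕ) (y : X) : Prop :=
  walkRel f g S k s y ∧ ∀ j < k, ¬ walkRel f g S j s y

theorem levRel_exists {s y : X} {k : ℕ} (h : walkRel f g S k s y) :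
    ∃ j ≤ k, levRel f g S s j y := by
  classical
  have hex : ∃ k, walkRel f g S k s y := ⟨k, h⟩
  exact ⟨Nat.find hex, Nat.find_min' hex h, Nat.find_spec hex, fun j hj => Nat.find_min hex hj⟩

theorem levRel_le {s y : X} {k j : ℕ} (h : levRel f g S s j y) (h' : walkRel f g S k s y) :
    j ≤ k := by
  by_contra hc
  exact h.2 k (by omega) h'

theorem levRel_unique {s y : X} {k j : ℕ} (h : levRel f g S s j y) (h' : levRel f g S s k y) :
    j = k := le_antisymm (levRel_le h h'.1) (levRel_le h' h.1)

theorem levRel_parent (hs : ∀ x y, adjRel f g x y → adjRel f g y x) {s y : X} {k : ℕ}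
    (h : levRel f g S s (k+1) y) : ∃ z, levRel f g S s k z ∧ adjRel f g z y := by
  rcases walkRel_cases hs h.1 with h1 | ⟨z, h1, h2⟩
  · exact absurd h1 (h.2 k (by omega))
  · refine ⟨z, ⟨h1, fun j hj hjz => ?_⟩, h2⟩
    exact h.2 (j+1) (by omega) (walkRel_step hs hjz h2 (walkRel_right h.1))

theorem adj_three {z a b c : X} (h1 : adjRel f g z a) (h2 : adjRel f g z b) (h3 : adjRel f g z c)
    (hac : a ≠ c) (hbc : b ≠ c) : a = b := by
  unfold adjRel at *
  grind

theorem levRel_inj (hs : ∀ x y, adjRel f g x y → adjRel f g y x) {s : X}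
    (hE : f s ∈ S ∨ g s ∈ S) {k : ℕ} :
    ∀ {y y' : X}, levRel f g S s k y → levRel f g S s k y' → y = y' := by
  induction k with
  | zero => intro y y' h h'; exact h.1.1.symm.trans h'.1.1
  | succ k ih =>
    intro y y' h h'
    obtain ⟨z, hz, hzy⟩ := levRel_parent hs h
    obtain ⟨z', hz', hzy'⟩ := levRel_parent hs h'
    obtain rfl := ih hz hz'
    cases k with
    | zero =>
      obtain rfl := hz.1.1
      have h1 := walkRel_right h.1
      have h2 := walkRel_right h'.1
      rcases hE with hE | hE
      · exact adj_three hzy hzy' (Or.inl rfl) (fun e => h1 (e ▸ hE)) (fun e => h2 (e ▸ hE))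
      · exact adj_three hzy hzy' (Or.inr rfl) (fun e => h1 (e ▸ hE)) (fun e => h2 (e ▸ hE))
    | succ k =>
      obtain ⟨w, hw, hwz⟩ := levRel_parent hs hz
      refine adj_three hzy hzy' (hs _ _ hwz) ?_ ?_
      · rintro rfl; have := levRel_unique h hw; omega
      · rintro rfl; have := levRel_unique h' hw; omega

theorem levRel_down (hs : ∀ x y, adjRel f g x y → adjRel f g y x) {s y : X} {k j : ℕ}
    (hjk : j ≤ k) (h : levRel f g S s k y) : ∃ z, levRel f g S s j z := by
  induction k generalizing y with
  | zero => obtain rfl : j = 0 := by omega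
            exact ⟨y, h⟩
  | succ k ih =>
    rcases Nat.lt_or_ge k j with h1 | h1
    · obtain rfl : j = k + 1 := by omega
      exact ⟨y, h⟩
    · obtain ⟨z, hz, _⟩ := levRel_parent hs h
      exact ih h1 hz

theorem levRel_bound (hs : ∀ x y, adjRel f g x y → adjRel f g y x) {r : ℕ}
    (hmax : ∀ x, ∃ y ∈ S, walkRel f g ∅ r x y) {s : X}
    (hE : f s ∈ S ∨ g s ∈ S) {k : ℕ} {y : X} (h : levRel f g S s k y) : k ≤ 2 * r + 1 := by
  by_contra hc
  obtain ⟨c, hcl⟩ := levRel_down hs (j := r + 1) (by omega) h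
  have key : ∀ j ≤ r, ∀ y, walkRel f g ∅ j c y →
      ∃ i, r + 1 ≤ i + j ∧ i ≤ r + 1 + j ∧ levRel f g S s i y := by
    intro j
    induction j with
    | zero => rintro - y ⟨rfl, -⟩; exact ⟨r+1, by omega, by omega, hcl⟩
    | succ j ih =>
      intro hj y hy
      rcases walkRel_cases hs hy with h1 | ⟨z, h1, h2⟩
      · obtain ⟨i, h3, h4, h5⟩ := ih (by omega) y h1
        exact ⟨i, by omega, by omega, h5⟩
      · obtain ⟨i, h3, h4, h5⟩ := ih (by omega) z h1
        obtain ⟨i, rfl⟩ : ∃ i', i = i' + 1 := ⟨i - 1, by omega⟩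
        obtain ⟨w, hw, hwz⟩ := levRel_parent hs h5
        obtain ⟨u, hu⟩ := levRel_down hs (j := i + 1 + 1) (by omega) h
        obtain ⟨z', hz', hzu⟩ := levRel_parent hs hu
        obtain rfl := levRel_inj hs hE h5 hz'
        by_cases hyw : y = w
        · subst hyw; exact ⟨i, by omega, by omega, hw⟩
        · have hyu : y = u := adj_three h2 hzu (hs _ _ hwz) hyw (by
            rintro rfl; have := levRel_unique hu hw; omega)
          subst hyu
          exact ⟨i+1+1, by omega, by omega, hu⟩
  obtain ⟨y, hyS, hy⟩ := hmax c
  obtain ⟨i, -, -, h5⟩ := key r le_rfl y hy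
  exact walkRel_right h5.1 hyS

theorem exists_start (hs : ∀ x y, adjRel f g x y → adjRel f g y x) {r : ℕ}
    (hmax : ∀ x, ∃ y ∈ S, walkRel f g ∅ r x y) {x : X} (hx : x ∉ S) :
    ∃ k s, walkRel f g S k x s ∧ (f s ∈ S ∨ g s ∈ S) := by
  by_contra hc
  push Not at hc
  have key : ∀ j y, walkRel f g ∅ j x y → walkRel f g S j x y := by
    intro j
    induction j with
    | zero => rintro y ⟨rfl, -⟩; exact ⟨rfl, hx⟩
    | succ j ih =>
      intro y hy
      rcases walkRel_cases hs hy with h1 | ⟨z, h1, h2⟩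
      · exact walkRel_succ (ih _ h1)
      · have h3 := hc j z (ih _ h1)
        refine walkRel_step hs (ih _ h1) h2 ?_
        rcases h2 with rfl | rfl
        · exact h3.1
        · exact h3.2
  obtain ⟨y, hyS, hy⟩ := hmax x
  exact walkRel_right (key _ _ hy) hyS

/-- Cyclic permutations of finite classes along a level function. -/
theorem exists_cyc (R : X → X → Prop) (hR : Equivalence R) (lam : X → ℕ)
    (hinj : ∀ x y, R x y → lam x = lam y → x = y)
    (hdown : ∀ x k, lam x = k + 1 → ∃ z, R x z ∧ lam z = k)
    (M : ℕ) (hM : ∀ x, lam x ≤ M) :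
    ∃ θ : X ≃ X, ∀ x y, θ x = y ↔
      (R x y ∧ (lam y = lam x + 1 ∨ (lam y = 0 ∧ ∀ z, R x z → lam z ≠ lam x + 1))) := by
  have hdown' : ∀ n x k, lam x = k + n → ∃ z, R x z ∧ lam z = k := by
    intro n
    induction n with
    | zero => intro x k h; exact ⟨x, hR.refl x, h⟩
    | succ n ih =>
      intro x k h
      obtain ⟨z, hz, hz'⟩ := hdown x (k + n) (by omega)
      obtain ⟨w, hw, hw'⟩ := ih z k hz'
      exact ⟨w, hR.trans hz hw, hw'⟩
  have hex : ∀ x, ∃ y, (R x y ∧ (lam y = lam x + 1 ∨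
      (lam y = 0 ∧ ∀ z, R x z → lam z ≠ lam x + 1))) := by
    intro x
    by_cases h : ∃ z, R x z ∧ lam z = lam x + 1
    · obtain ⟨z, h1, h2⟩ := h; exact ⟨z, h1, Or.inl h2⟩
    · push Not at h
      obtain ⟨z, h1, h2⟩ := hdown' (lam x) x 0 (by omega)
      exact ⟨z, h1, Or.inr ⟨h2, h⟩⟩
  choose th hth using hex
  have huniq : ∀ x y, (R x y ∧ (lam y = lam x + 1 ∨
      (lam y = 0 ∧ ∀ z, R x z → lam z ≠ lam x + 1))) → th x = y := by
    rintro x y ⟨h1, h2⟩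
    obtain ⟨h3, h4⟩ := hth x
    refine hinj _ _ (hR.trans (hR.symm h3) h1) ?_
    rcases h2 with h2 | ⟨h2, h2'⟩ <;> rcases h4 with h4 | ⟨h4, h4'⟩
    · omega
    · exact absurd h2 (h4' _ h1)
    · exact absurd h4 (h2' _ h3)
    · omega
  have hb : Function.Bijective th := by
    constructor
    · intro x x' e
      obtain ⟨h3, h4⟩ := hth x
      obtain ⟨h5, h6⟩ := hth x'
      rw [← e] at h5 h6
      have hxx : R x x' := hR.trans h3 (hR.symm h5)
      refine hinj _ _ hxx ?_
      rcases h4 with h4 | ⟨h4, h4'⟩ <;> rcases h6 with h6 | ⟨h6, h6'⟩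
      · omega
      · omega
      · omega
      · rcases lt_trichotomy (lam x) (lam x') with hl | hl | hl
        · obtain ⟨z, h7, h8⟩ := hdown' (lam x' - (lam x + 1)) x' (lam x + 1) (by omega)
          exact absurd h8 (h4' _ (hR.trans hxx h7))
        · exact hl
        · obtain ⟨z, h7, h8⟩ := hdown' (lam x - (lam x' + 1)) x (lam x' + 1) (by omega)
          exact absurd h8 (h6' _ (hR.trans (hR.symm hxx) h7))
    · intro y
      rcases Nat.eq_zero_or_pos (lam y) with h0 | h0
      · by_contra hc
        push Not at hc
        have : ∀ n, ∃ z, R y z ∧ n ≤ lam z := by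
          intro n
          induction n with
          | zero => exact ⟨y, hR.refl y, by omega⟩
          | succ n ih =>
            obtain ⟨z, h1, h2⟩ := ih
            by_contra hc'
            push Not at hc'
            refine hc z (huniq z y ⟨hR.symm h1, Or.inr ⟨h0, fun w hw => ?_⟩⟩)
            have := hc' w (hR.trans h1 hw)
            omega
        obtain ⟨z, -, h2⟩ := this (M + 1)
        have := hM z
        omega
      · obtain ⟨z, h1, h2⟩ := hdown y (lam y - 1) (by omega)
        exact ⟨z, huniq z y ⟨hR.symm h1, Or.inl (by omega)⟩⟩
  refine ⟨Equiv.ofBijective th hb, fun x y => ⟨?_, huniq x y⟩⟩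
  rintro rfl
  exact hth x

end core


section meas
variable {X : Type*} [MeasurableSpace X] {f g : X → X} {S : Set X}

theorem wordFam_measurable (hf : Measurable f) (hg : Measurable g) (k : ℕ) :
    ∀ q ∈ wordFam f g k, Measurable q := by
  induction k with
  | zero => intro q hq; simp [wordFam] at hq; subst hq; exact measurable_id
  | succ k ih =>
    intro q hq
    simp only [wordFam, List.mem_append, List.mem_map] at hq
    rcases hq with hq | ⟨q, hq, rfl⟩ | ⟨q, hq, rfl⟩
    · exact ih q hq
    · exact hf.comp (ih q hq)
    · exact hg.comp (ih q hq)

theorem measurableSet_forall_list {α β : Type*} [MeasurableSpace α] (l : List β)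
    (P : β → α → Prop) (h : ∀ q ∈ l, MeasurableSet {x | P q x}) :
    MeasurableSet {x | ∀ q ∈ l, P q x} := by
  have : {x | ∀ q ∈ l, P q x} = ⋂ q ∈ {q | q ∈ l}, {x | P q x} := by
    ext x; simp
  rw [this]
  exact MeasurableSet.biInter (List.finite_toSet l).countable h

theorem measurableSet_exists_list {α β : Type*} [MeasurableSpace α] (l : List β)
    (P : β → α → Prop) (h : ∀ q ∈ l, MeasurableSet {x | P q x}) :
    MeasurableSet {x | ∃ q ∈ l, P q x} := by
  have : {x | ∃ q ∈ l, P q x} = ⋃ q ∈ {q | q ∈ l}, {x | P q x} := by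
    ext x; simp
  rw [this]
  exact MeasurableSet.biUnion (List.finite_toSet l).countable h

theorem walkRel_measurable [MeasurableSingletonClass X] [MeasurableEq X]
    (hf : Measurable f) (hg : Measurable g) (hS : MeasurableSet S)
    (k : ℕ) : MeasurableSet {p : X × X | walkRel f g S k p.1 p.2} := by
  induction k with
  | zero =>
    exact (measurableSet_eq_fun measurable_fst measurable_snd).inter (measurable_snd hS).compl
  | succ k ih =>
    have e1 : Measurable (fun p : X × X => (p.1, f p.2)) :=
      measurable_fst.prodMk (hf.comp measurable_snd)
    have e2 : Measurable (fun p : X × X => (p.1, g p.2)) :=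
      measurable_fst.prodMk (hg.comp measurable_snd)
    exact (measurable_snd hS).compl.inter (ih.union ((e1 ih).union (e2 ih)))

end meas

theorem exists_nat_basis (X : Type*) [TopologicalSpace X] [SecondCountableTopology X] :
    ∃ c : ℕ → Set X, (∀ n, IsOpen (c n)) ∧
      ∀ x U, IsOpen U → x ∈ U → ∃ n, x ∈ c n ∧ c n ⊆ U := by
  obtain ⟨c, hc⟩ := ((TopologicalSpace.countable_countableBasis X).insert ∅).exists_eq_range
    (Set.insert_nonempty _ _)
  refine ⟨c, fun n => ?_, fun x U hU hx => ?_⟩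
  · have : c n ∈ insert ∅ (TopologicalSpace.countableBasis X) := hc ▸ Set.mem_range_self n
    rcases this with h | h
    · rw [h]; exact isOpen_empty
    · exact TopologicalSpace.isOpen_of_mem_countableBasis h
  · obtain ⟨v, hv, hxv, hsub⟩ :=
      (TopologicalSpace.isBasis_countableBasis X).exists_subset_of_mem_open hx hU
    have : v ∈ Set.range c := hc ▸ Set.mem_insert_of_mem _ hv
    obtain ⟨n, rfl⟩ := this
    exact ⟨n, hxv, hsub⟩

section massgen
variable {X : Type*} [MeasurableSpace X] [StandardBorelSpace X]

open Classical in
theorem mass_list (μ : Measure X) (S : Set X) (hS : MeasurableSet S) (Q : List (X → X))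
    (hQ : ∀ q ∈ Q, Measurable q)
    (hμ : ∀ q ∈ Q, ∀ A ⊆ S, MeasurableSet A → Set.InjOn q A → μ (q '' A) = μ A)
    (hd : ∀ q ∈ Q, ∀ q' ∈ Q, ∀ x ∈ S, ∀ y ∈ S, q x = q' y → x = y) :
    MeasurableSet (⋃ q ∈ {q | q ∈ Q}, q '' S) ∧
    ∫⁻ x in S, ((Q.map (fun q => q x)).toFinset.card : ℝ≥0∞) ∂μ ≤
      μ (⋃ q ∈ {q | q ∈ Q}, q '' S) := by
  induction Q with
  | nil => simp
  | cons q Q ih =>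
    obtain ⟨ih1, ih2⟩ := ih (fun q' h => hQ q' (List.mem_cons_of_mem _ h))
      (fun q' h => hμ q' (List.mem_cons_of_mem _ h))
      (fun q' h q'' h' => hd q' (List.mem_cons_of_mem _ h) q'' (List.mem_cons_of_mem _ h'))
    have hqm : Measurable q := hQ q (List.mem_cons_self)
    have hinj : Set.InjOn q S := fun x hx y hy e =>
      hd q List.mem_cons_self q List.mem_cons_self x hx y hy e
    have hU : (⋃ q' ∈ {q' | q' ∈ q :: Q}, q' '' S) = q '' S ∪ ⋃ q' ∈ {q' | q' ∈ Q}, q' '' S := by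
      ext y; simp
    set U := ⋃ q' ∈ {q' | q' ∈ Q}, q' '' S with hUdef
    set N : Set X := {x | ∀ q' ∈ Q, q x ≠ q' x} with hN
    have hNm : MeasurableSet N := measurableSet_forall_list Q _ (fun q' hq' =>
      (measurableSet_eq_fun hqm (hQ q' (List.mem_cons_of_mem _ hq'))).compl)
    refine ⟨?_, ?_⟩
    · rw [hU]
      exact (hS.image_of_measurable_injOn hqm hinj).union ih1
    · have hcard : ∀ x, ((((q :: Q).map (fun q => q x)).toFinset.card : ℕ) : ℝ≥0∞) =
          N.indicator (fun _ => 1) x + (((Q.map (fun q => q x)).toFinset.card : ℕ) : ℝ≥0∞) := by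
        intro x
        rw [List.map_cons, List.toFinset_cons]
        by_cases hx : x ∈ N
        · rw [Finset.card_insert_of_notMem, Set.indicator_of_mem hx]
          · push_cast; rw [add_comm]
          · simp only [List.mem_toFinset, List.mem_map, not_exists, not_and]
            exact fun q' hq' e => hx q' hq' e.symm
        · rw [Finset.card_insert_of_mem, Set.indicator_of_notMem hx, zero_add]
          simp only [hN, Set.mem_ofPred_eq, not_forall, not_not] at hx
          obtain ⟨q', hq', e⟩ := hx
          simp only [List.mem_toFinset, List.mem_map]
          exact ⟨q', hq', e.symm⟩
      simp_rw [hcard]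
      rw [lintegral_add_left (measurable_const.indicator hNm), lintegral_indicator hNm]
      have h1 : ∫⁻ x in N, (1 : ℝ≥0∞) ∂(μ.restrict S) = μ (N ∩ S) := by
        simp [Measure.restrict_apply, hNm]
      rw [h1]
      have h2 : μ (q '' (N ∩ S)) = μ (N ∩ S) :=
        hμ q List.mem_cons_self _ Set.inter_subset_right (hNm.inter hS)
          (hinj.mono Set.inter_subset_right)
      have hdisj : Disjoint (q '' (N ∩ S)) U := by
        rw [Set.disjoint_left]
        rintro _ ⟨x, ⟨hxN, hxS⟩, rfl⟩ hxU
        simp only [hUdef, Set.mem_iUnion, Set.mem_ofPred_eq] at hxU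
        obtain ⟨q', hq', y, hy, e⟩ := hxU
        obtain rfl := hd q List.mem_cons_self q' (List.mem_cons_of_mem _ hq') x hxS y hy e.symm
        exact hxN q' hq' e.symm
      rw [hU]
      calc μ (N ∩ S) + _ ≤ μ (q '' (N ∩ S)) + μ U := by rw [h2]; gcongr
        _ = μ (q '' (N ∩ S) ∪ U) := (measure_union hdisj ih1).symm
        _ ≤ _ := measure_mono (Set.union_subset_union_left _
            (Set.image_mono Set.inter_subset_right))

theorem exists_maximal_discrete {f g : X → X} (hf : Measurable f) (hg : Measurable g)
    (hs : ∀ x y, adjRel f g x y → adjRel f g y x) (r : ℕ) :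
    ∃ S : Set X, MeasurableSet S ∧ (∀ x ∈ S, ∀ y ∈ S, walkRel f g ∅ r x y → x = y) ∧
      ∀ x, ∃ y ∈ S, walkRel f g ∅ r x y := by
  let _ := upgradeStandardBorel X
  obtain ⟨c, hco, hc⟩ := exists_nat_basis X
  have hcm : ∀ n, MeasurableSet (c n) := fun n => (hco n).measurableSet
  let C : ℕ → Set X := fun n => {x | x ∈ c n ∧ ∀ q ∈ wordFam f g r, q x ≠ x → q x ∉ c n}
  have hCm : ∀ n, MeasurableSet (C n) := by
    intro n
    refine (hcm n).inter (measurableSet_forall_list _ (fun (q : X → X) (x : X) => q x ≠ x → q x ∉ c n) ?_)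
    intro q hq
    have hqm := wordFam_measurable hf hg r q hq
    exact (measurableSet_eq_fun hqm measurable_id).compl.imp (hqm (hcm n)).compl
  have hcov : ∀ x, ∃ n, x ∈ C n := by
    intro x
    have hfin : ({y : X | ∃ q : X → X, q ∈ wordFam f g r ∧ q x = y} \ {x}).Finite := by
      refine Set.Finite.subset (((List.finite_toSet (wordFam f g r)).image (fun q => q x))) ?_
      rintro y ⟨⟨q, hq, rfl⟩, -⟩
      exact ⟨q, hq, rfl⟩
    obtain ⟨n, hxv, hsub⟩ := hc x _ hfin.isClosed.isOpen_compl (fun h => h.2 rfl)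
    exact ⟨n, hxv, fun q hq hne hmem => hsub hmem ⟨⟨q, hq, rfl⟩, hne⟩⟩
  let A : ℕ → Set X := fun n => Nat.rec ∅
    (fun n A => A ∪ {x | x ∈ C n ∧ ∀ q ∈ wordFam f g r, q x ∉ A}) n
  have hA : ∀ n, A (n+1) = A n ∪ {x | x ∈ C n ∧ ∀ q ∈ wordFam f g r, q x ∉ A n} := fun n => rfl
  have hAm : ∀ n, MeasurableSet (A n) := by
    intro n
    induction n with
    | zero => exact MeasurableSet.empty
    | succ n ih =>
      rw [hA]
      exact ih.union ((hCm n).inter (measurableSet_forall_list _ _ fun q hq =>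
        (wordFam_measurable hf hg r q hq ih).compl))
  have hmono : Monotone A := monotone_nat_of_le_succ fun n => by
    rw [hA]; exact Set.subset_union_left
  have hdisc : ∀ n, ∀ x ∈ A n, ∀ y ∈ A n, walkRel f g ∅ r x y → x = y := by
    intro n
    induction n with
    | zero => intro x hx; exact absurd hx (Set.notMem_empty x)
    | succ n ih =>
      intro x hx y hy hxy
      rw [hA] at hx hy
      obtain ⟨q, hq, e⟩ := (walkRel_iff_word hs).1 hxy
      obtain ⟨q', hq', e'⟩ := (walkRel_iff_word hs).1 (walkRel_symm hs hxy)
      rcases hx with hx | hx <;> rcases hy with hy | hy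
      · exact ih x hx y hy hxy
      · exact absurd (e' ▸ hx) (hy.2 q' hq')
      · exact absurd (e ▸ hy) (hx.2 q hq)
      · by_contra hne
        exact hx.1.2 q hq (by rw [← e]; exact fun e => hne e.symm) (e ▸ hy.1.1)
  refine ⟨⋃ n, A n, MeasurableSet.iUnion hAm, ?_, ?_⟩
  · intro x hx y hy
    obtain ⟨n, hn⟩ := Set.mem_iUnion.1 hx
    obtain ⟨m, hm⟩ := Set.mem_iUnion.1 hy
    exact hdisc (max n m) x (hmono (le_max_left _ _) hn) y (hmono (le_max_right _ _) hm)
  · intro x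
    obtain ⟨n, hn⟩ := hcov x
    rcases Classical.em (∃ q : X → X, q ∈ wordFam f g r ∧ q x ∈ A n) with h | h
    · obtain ⟨q, hq, hx⟩ := h
      exact ⟨q x, Set.mem_iUnion.2 ⟨n, hx⟩, (walkRel_iff_word hs).2 ⟨q, hq, rfl⟩⟩
    · push Not at h
      exact ⟨x, Set.mem_iUnion.2 ⟨n+1, by rw [hA]; exact Or.inr ⟨hn, h⟩⟩, walkRel_refl id r⟩

end massgen


section perm
variable {X : Type*}

/-- connected by a path outside `S` -/
def compRel (f g : X → X) (S : Set X) (x y : X) : Prop := ∃ k, walkRel f g S k x y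

/-- points outside `S` adjacent to `S` -/
def bdrySet (f g : X → X) (S : Set X) : Set X := {x | x ∉ S ∧ (f x ∈ S ∨ g x ∈ S)}

/-- `s` is the starting point of the component of `x` -/
def startRel (f g : X → X) (S : Set X) (h : X → ℝ) (x s : X) : Prop :=
  compRel f g S x s ∧ s ∈ bdrySet f g S ∧ ∀ t, compRel f g S x t → t ∈ bdrySet f g S → h s ≤ h t

/-- `x` has level `k` in its component -/
def levOf (f g : X → X) (S : Set X) (h : X → ℝ) (k : ℕ) (x : X) : Prop :=
  ∃ s, startRel f g S h x s ∧ levRel f g S s k x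

open Classical in
/-- the level function -/
noncomputable def lamOf (f g : X → X) (S : Set X) (h : X → ℝ) (x : X) : ℕ :=
  if H : ∃ k, levOf f g S h k x then H.choose else 0

variable {f g : X → X} {S : Set X} {h : X → ℝ}

theorem compRel_symm (hs : ∀ x y, adjRel f g x y → adjRel f g y x) {x y : X}
    (h1 : compRel f g S x y) : compRel f g S y x := h1.imp fun _ => walkRel_symm hs

theorem compRel_trans (hs : ∀ x y, adjRel f g x y → adjRel f g y x) {x y z : X}
    (h1 : compRel f g S x y) (h2 : compRel f g S y z) : compRel f g S x z := by
  obtain ⟨j, h1⟩ := h1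
  obtain ⟨k, h2⟩ := h2
  exact ⟨j + k, walkRel_trans hs h1 h2⟩

theorem compRel_right {x y : X} (h1 : compRel f g S x y) : y ∉ S := by
  obtain ⟨j, h1⟩ := h1
  exact walkRel_right h1

theorem compRel_finite (hs : ∀ x y, adjRel f g x y → adjRel f g y x) {r : ℕ}
    (hmax : ∀ x, ∃ y ∈ S, walkRel f g ∅ r x y) (x : X) : {y | compRel f g S x y}.Finite := by
  by_cases hx : x ∈ S
  · convert Set.finite_empty
    ext y
    simp only [Set.mem_ofPred_eq, Set.mem_empty_iff_false, iff_false]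
    exact fun h1 => compRel_right (compRel_symm hs h1) hx
  obtain ⟨k, s, h1, h2⟩ := exists_start hs hmax hx
  refine Set.Finite.subset ((List.finite_toSet (wordFam f g (2 * r + 1))).image (fun q => q s)) ?_
  intro y hy
  obtain ⟨j, hj⟩ := compRel_trans hs (compRel_symm hs ⟨k, h1⟩) hy
  obtain ⟨i, -, hi⟩ := levRel_exists hj
  have := levRel_bound hs hmax h2 hi
  obtain ⟨q, hq, rfl⟩ := (walkRel_iff_word hs).1 (walkRel_empty (walkRel_mono this hi.1))
  exact ⟨q, hq, rfl⟩

theorem startRel_exists (hs : ∀ x y, adjRel f g x y → adjRel f g y x) {r : ℕ}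
    (hmax : ∀ x, ∃ y ∈ S, walkRel f g ∅ r x y) {x : X} (hx : x ∉ S) :
    ∃ s, startRel f g S h x s := by
  obtain ⟨k, s, h1, h2⟩ := exists_start hs hmax hx
  obtain ⟨s', h3, h4⟩ := Set.exists_min_image ({y | compRel f g S x y} ∩ bdrySet f g S) h
    ((compRel_finite hs hmax x).inter_of_left _) ⟨s, ⟨k, h1⟩, walkRel_right h1, h2⟩
  exact ⟨s', h3.1, h3.2, fun t ht ht' => h4 t ⟨ht, ht'⟩⟩

theorem startRel_unique (hh : Function.Injective h) {x s s' : X}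
    (h1 : startRel f g S h x s) (h2 : startRel f g S h x s') : s = s' :=
  hh (le_antisymm (h1.2.2 _ h2.1 h2.2.1) (h2.2.2 _ h1.1 h1.2.1))

theorem startRel_congr (hs : ∀ x y, adjRel f g x y → adjRel f g y x) {x y s : X}
    (hxy : compRel f g S x y) (h1 : startRel f g S h x s) : startRel f g S h y s :=
  ⟨compRel_trans hs (compRel_symm hs hxy) h1.1, h1.2.1,
    fun t ht => h1.2.2 t (compRel_trans hs hxy ht)⟩

theorem levOf_exists (hs : ∀ x y, adjRel f g x y → adjRel f g y x) {r : ℕ}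
    (hmax : ∀ x, ∃ y ∈ S, walkRel f g ∅ r x y) {x : X} (hx : x ∉ S) :
    ∃ k, levOf f g S h k x := by
  obtain ⟨s, h1⟩ := startRel_exists (h := h) hs hmax hx
  obtain ⟨k, h2⟩ := compRel_symm hs h1.1
  obtain ⟨j, -, h3⟩ := levRel_exists h2
  exact ⟨j, s, h1, h3⟩

theorem levOf_unique (hh : Function.Injective h) {x : X} {j k : ℕ}
    (h1 : levOf f g S h j x) (h2 : levOf f g S h k x) : j = k := by
  obtain ⟨s, h1, h1'⟩ := h1
  obtain ⟨s', h2, h2'⟩ := h2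
  obtain rfl := startRel_unique hh h1 h2
  exact levRel_unique h1' h2'

theorem lamOf_eq (hh : Function.Injective h) {x : X} {k : ℕ}
    (h1 : levOf f g S h k x) : lamOf f g S h x = k := by
  have H : ∃ k, levOf f g S h k x := ⟨k, h1⟩
  rw [lamOf, dif_pos H]
  exact levOf_unique hh H.choose_spec h1

theorem levOf_lamOf (hs : ∀ x y, adjRel f g x y → adjRel f g y x) {r : ℕ}
    (hmax : ∀ x, ∃ y ∈ S, walkRel f g ∅ r x y) {x : X} (hx : x ∉ S) :
    levOf f g S h (lamOf f g S h x) x := by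
  have H := levOf_exists (h := h) hs hmax hx
  rw [lamOf, dif_pos H]
  exact H.choose_spec

theorem lamOf_mem (hs : ∀ x y, adjRel f g x y → adjRel f g y x) {x : X} (hx : x ∈ S) :
    lamOf f g S h x = 0 := by
  rw [lamOf, dif_neg]
  rintro ⟨k, s, h1, h2⟩
  exact compRel_right (compRel_symm hs h1.1) hx

/-- All points of a component see the same start, and levels are distances. -/
theorem levRel_of_comp (hs : ∀ x y, adjRel f g x y → adjRel f g y x)
    (hh : Function.Injective h) {r : ℕ}
    (hmax : ∀ x, ∃ y ∈ S, walkRel f g ∅ r x y) {x y s : X} (h1 : startRel f g S h x s)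
    (hxy : compRel f g S x y) : levRel f g S s (lamOf f g S h y) y := by
  obtain ⟨s', h2, h3⟩ := levOf_lamOf (h := h) hs hmax (compRel_right hxy)
  obtain rfl := startRel_unique hh h2 (startRel_congr hs hxy h1)
  exact h3

theorem lamOf_of_levRel (hs : ∀ x y, adjRel f g x y → adjRel f g y x)
    (hh : Function.Injective h) {x y s : X} {k : ℕ} (h1 : startRel f g S h x s)
    (hk : levRel f g S s k y) : compRel f g S x y ∧ lamOf f g S h y = k := by
  have : compRel f g S x y := compRel_trans hs h1.1 ⟨k, hk.1⟩
  exact ⟨this, lamOf_eq hh ⟨s, startRel_congr hs this h1, hk⟩⟩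

/-- component or equality -/
def compEq (f g : X → X) (S : Set X) (x y : X) : Prop := x = y ∨ compRel f g S x y

/-- the graph of the permutation -/
def cycRel (f g : X → X) (S : Set X) (h : X → ℝ) (x y : X) : Prop :=
  compEq f g S x y ∧ (lamOf f g S h y = lamOf f g S h x + 1 ∨
    (lamOf f g S h y = 0 ∧ ∀ z, compEq f g S x z → lamOf f g S h z ≠ lamOf f g S h x + 1))

theorem lamOf_parent (hs : ∀ x y, adjRel f g x y → adjRel f g y x)
    (hh : Function.Injective h) {r : ℕ}
    (hmax : ∀ x, ∃ y ∈ S, walkRel f g ∅ r x y) {x : X} {k : ℕ}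
    (hx : lamOf f g S h x = k + 1) :
    ∃ z, compRel f g S x z ∧ lamOf f g S h z = k ∧ adjRel f g z x := by
  by_cases hxS : x ∈ S
  · rw [lamOf_mem hs hxS] at hx; omega
  obtain ⟨s, h1, h2⟩ := levOf_lamOf (h := h) hs hmax hxS
  rw [hx] at h2
  obtain ⟨z, hz, hzx⟩ := levRel_parent hs h2
  obtain ⟨h3, h4⟩ := lamOf_of_levRel hs hh h1 hz
  exact ⟨z, h3, h4, hzx⟩

theorem lamOf_inj (hs : ∀ x y, adjRel f g x y → adjRel f g y x)
    (hh : Function.Injective h) {r : ℕ}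
    (hmax : ∀ x, ∃ y ∈ S, walkRel f g ∅ r x y) {x y : X} (hxy : compRel f g S x y)
    (e : lamOf f g S h x = lamOf f g S h y) : x = y := by
  obtain ⟨s, h1, h2⟩ := levOf_lamOf (h := h) hs hmax (compRel_right (compRel_symm hs hxy))
  have h3 := levRel_of_comp hs hh hmax h1 hxy
  rw [← e] at h3
  exact levRel_inj hs h1.2.1.2 h2 h3

theorem lamOf_adj (hs : ∀ x y, adjRel f g x y → adjRel f g y x)
    (hh : Function.Injective h) {r : ℕ}
    (hmax : ∀ x, ∃ y ∈ S, walkRel f g ∅ r x y) {x y : X} (hxy : compRel f g S x y)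
    (ha : adjRel f g x y) : lamOf f g S h y ≤ lamOf f g S h x + 1 := by
  obtain ⟨s, h1, h2⟩ := levOf_lamOf (h := h) hs hmax (compRel_right (compRel_symm hs hxy))
  have h3 := levRel_of_comp hs hh hmax h1 hxy
  exact levRel_le h3 (walkRel_step hs h2.1 ha (compRel_right hxy))

theorem lamOf_zero (hs : ∀ x y, adjRel f g x y → adjRel f g y x) {r : ℕ}
    (hmax : ∀ x, ∃ y ∈ S, walkRel f g ∅ r x y) {x : X} (hx : x ∉ S)
    (e : lamOf f g S h x = 0) : x ∈ bdrySet f g S := by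
  obtain ⟨s, h1, h2⟩ := levOf_lamOf (h := h) hs hmax hx
  rw [e] at h2
  obtain rfl := h2.1.1
  exact h1.2.1

theorem compEq_equiv (hs : ∀ x y, adjRel f g x y → adjRel f g y x) :
    Equivalence (compEq f g S) := by
  refine ⟨fun x => Or.inl rfl, ?_, ?_⟩
  · rintro x y (rfl | h1)
    · exact Or.inl rfl
    · exact Or.inr (compRel_symm hs h1)
  · rintro x y z (rfl | h1) (rfl | h2)
    · exact Or.inl rfl
    · exact Or.inr h2
    · exact Or.inr h1
    · exact Or.inr (compRel_trans hs h1 h2)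

theorem exists_perm (hs : ∀ x y, adjRel f g x y → adjRel f g y x)
    (hh : Function.Injective h) {r : ℕ}
    (hmax : ∀ x, ∃ y ∈ S, walkRel f g ∅ r x y) :
    ∃ θ : X ≃ X, ∀ x y, θ x = y ↔ cycRel f g S h x y := by
  refine exists_cyc (compEq f g S) (compEq_equiv hs) (lamOf f g S h) ?_ ?_ (2 * r + 1) ?_
  · rintro x y (rfl | h1) e
    · rfl
    · exact lamOf_inj hs hh hmax h1 e
  · intro x k hx
    obtain ⟨z, h1, h2, -⟩ := lamOf_parent hs hh hmax hx
    exact ⟨z, Or.inr h1, h2⟩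
  · intro x
    by_cases hxS : x ∈ S
    · rw [lamOf_mem hs hxS]; omega
    · obtain ⟨s, h1, h2⟩ := levOf_lamOf (h := h) hs hmax hxS
      exact levRel_bound hs hmax h1.2.1.2 h2

theorem perm_good (hs : ∀ x y, adjRel f g x y → adjRel f g y x) (hne : ∀ x, f x ≠ g x)
    (hh : Function.Injective h) {r : ℕ}
    (hmax : ∀ x, ∃ y ∈ S, walkRel f g ∅ r x y) (θ : X ≃ X)
    (hθ : ∀ x y, θ x = y ↔ cycRel f g S h x y) {x : X} (hx : x ∉ S) (hxb : x ∉ bdrySet f g S)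
    (hxf : f x ≠ x) (hxg : g x ≠ x) (y : X) :
    (y = θ x ∨ x = θ y) ↔ (y = f x ∨ y = g x) := by
  have hfg : f x ∉ S ∧ g x ∉ S := by
    constructor
    · exact fun hc => hxb ⟨hx, Or.inl hc⟩
    · exact fun hc => hxb ⟨hx, Or.inr hc⟩
  have af : adjRel f g x (f x) := Or.inl rfl
  have ag : adjRel f g x (g x) := Or.inr rfl
  have cf : compRel f g S x (f x) := ⟨1, walkRel_step hs (walkRel_refl hx 0) af hfg.1⟩
  have cg : compRel f g S x (g x) := ⟨1, walkRel_step hs (walkRel_refl hx 0) ag hfg.2⟩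
  have l0 : lamOf f g S h x ≠ 0 := fun e => hxb (lamOf_zero hs hmax hx e)
  have f1 := lamOf_adj hs hh hmax cf af
  have f2 := lamOf_adj hs hh hmax (compRel_symm hs cf) (hs _ _ af)
  have g1 := lamOf_adj hs hh hmax cg ag
  have g2 := lamOf_adj hs hh hmax (compRel_symm hs cg) (hs _ _ ag)
  have f3 : lamOf f g S h x ≠ lamOf f g S h (f x) := fun e => hxf (lamOf_inj hs hh hmax cf e).symm
  have g3 : lamOf f g S h x ≠ lamOf f g S h (g x) := fun e => hxg (lamOf_inj hs hh hmax cg e).symm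
  have fg3 : lamOf f g S h (f x) ≠ lamOf f g S h (g x) := fun e =>
    hne x (lamOf_inj hs hh hmax (compRel_trans hs (compRel_symm hs cf) cg) e)
  rcases lt_or_gt_of_ne f3 with hlt | hlt
  · have e1 : θ x = f x := (hθ _ _).2 ⟨Or.inr cf, Or.inl (by omega)⟩
    have e2 : θ (g x) = x := (hθ _ _).2 ⟨Or.inr (compRel_symm hs cg), Or.inl (by omega)⟩
    have e3 : x = θ y ↔ y = g x := by
      constructor
      · intro e; exact θ.injective (by rw [e2, ← e])
      · rintro rfl; exact e2.symm
    rw [e1, e3]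
  · have e1 : θ x = g x := (hθ _ _).2 ⟨Or.inr cg, Or.inl (by omega)⟩
    have e2 : θ (f x) = x := (hθ _ _).2 ⟨Or.inr (compRel_symm hs cf), Or.inl (by omega)⟩
    have e3 : x = θ y ↔ y = f x := by
      constructor
      · intro e; exact θ.injective (by rw [e2, ← e])
      · rintro rfl; exact e2.symm
    rw [e1, e3, or_comm]

theorem perm_loop (hs : ∀ x y, adjRel f g x y → adjRel f g y x)
    (hh : Function.Injective h) {r : ℕ}
    (hmax : ∀ x, ∃ y ∈ S, walkRel f g ∅ r x y) (θ : X ≃ X)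
    (hθ : ∀ x y, θ x = y ↔ cycRel f g S h x y) {x : X} (hx : x ∉ S) (hxb : x ∉ bdrySet f g S)
    (hxl : f x = x ∨ g x = x) : θ x ∈ bdrySet f g S := by
  obtain ⟨h1, h2⟩ := (hθ x _).1 rfl
  have hC : compRel f g S x (θ x) := by
    rcases h1 with h1 | h1
    · rw [← h1]; exact ⟨0, walkRel_refl hx 0⟩
    · exact h1
  have l0 : lamOf f g S h x ≠ 0 := fun e => hxb (lamOf_zero hs hmax hx e)
  rcases h2 with h2 | h2
  · exfalso
    obtain ⟨z, h3, h4, h5⟩ := lamOf_parent hs hh hmax h2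
    obtain rfl := lamOf_inj hs hh hmax (compRel_trans hs hC h3) h4.symm
    obtain ⟨w, h6, h7, h8⟩ := lamOf_parent hs hh hmax
      (show lamOf f g S h x = (lamOf f g S h x - 1) + 1 by omega)
    have hxx : adjRel f g x x := hxl.imp Eq.symm Eq.symm
    have : θ x = w := by
      refine adj_three h5 (hs _ _ h8) hxx ?_ ?_
      · intro e; rw [e] at h2; omega
      · rintro rfl; omega
    rw [this] at h2; omega
  · exact lamOf_zero hs hmax (compRel_right hC) h2.1

end perm

section permmeas
variable {X : Type*} [MeasurableSpace X] [StandardBorelSpace X] {f g : X → X} {S : Set X} {h : X → ℝ}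

theorem compRel_measurable (hf : Measurable f) (hg : Measurable g) (hS : MeasurableSet S) :
    MeasurableSet {p : X × X | compRel f g S p.1 p.2} := by
  have : {p : X × X | compRel f g S p.1 p.2} = ⋃ k, {p : X × X | walkRel f g S k p.1 p.2} := by
    ext p; simp [compRel]
  rw [this]
  exact MeasurableSet.iUnion fun k => walkRel_measurable hf hg hS k

theorem compEq_measurable (hf : Measurable f) (hg : Measurable g) (hS : MeasurableSet S) :
    MeasurableSet {p : X × X | compEq f g S p.1 p.2} :=
  (measurableSet_eq_fun measurable_fst measurable_snd).union (compRel_measurable hf hg hS)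

theorem bdrySet_measurable (hf : Measurable f) (hg : Measurable g) (hS : MeasurableSet S) :
    MeasurableSet (bdrySet f g S) := hS.compl.inter ((hf hS).union (hg hS))

theorem compRel_word (hs : ∀ x y, adjRel f g x y → adjRel f g y x) {x y : X}
    (h1 : compRel f g S x y) : ∃ k, ∃ q ∈ wordFam f g k, y = q x := by
  obtain ⟨k, h1⟩ := h1
  exact ⟨k, (walkRel_iff_word hs).1 (walkRel_empty h1)⟩

theorem startRel_measurable (hs : ∀ x y, adjRel f g x y → adjRel f g y x)
    (hf : Measurable f) (hg : Measurable g) (hS : MeasurableSet S)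
    (hhm : Measurable h) : MeasurableSet {p : X × X | startRel f g S h p.1 p.2} := by
  have hC := compRel_measurable hf hg hS
  have hB := bdrySet_measurable hf hg hS
  have : {p : X × X | startRel f g S h p.1 p.2} = {p : X × X | compRel f g S p.1 p.2} ∩
      ((Prod.snd ⁻¹' bdrySet f g S) ∩ ⋂ k, {p : X × X | ∀ q ∈ wordFam f g k,
        compRel f g S p.1 (q p.1) → q p.1 ∈ bdrySet f g S → h p.2 ≤ h (q p.1)}) := by
    ext p
    simp only [startRel, Set.mem_ofPred_eq, Set.mem_inter_iff, Set.mem_preimage, Set.mem_iInter]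
    refine and_congr_right fun _ => and_congr_right fun _ => ⟨fun H k q _ => H _, ?_⟩
    intro H t ht
    obtain ⟨k, q, hq, rfl⟩ := compRel_word hs ht
    exact H k q hq ht
  rw [this]
  refine hC.inter ((measurable_snd hB).inter (MeasurableSet.iInter fun k =>
    measurableSet_forall_list _ _ fun q hq => ?_))
  have hq := wordFam_measurable hf hg k q hq
  have e1 : Measurable (fun p : X × X => (p.1, q p.1)) :=
    measurable_fst.prodMk (hq.comp measurable_fst)
  exact (e1 hC).imp (((hq.comp measurable_fst) hB).imp
    (measurableSet_le (hhm.comp measurable_snd) (hhm.comp (hq.comp measurable_fst))))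

theorem levOf_measurable (hs : ∀ x y, adjRel f g x y → adjRel f g y x)
    (hf : Measurable f) (hg : Measurable g) (hS : MeasurableSet S)
    (hhm : Measurable h) (k : ℕ) : MeasurableSet {x : X | levOf f g S h k x} := by
  have : {x : X | levOf f g S h k x} = ⋃ j, {x | ∃ q ∈ wordFam f g j,
      startRel f g S h x (q x) ∧ levRel f g S (q x) k x} := by
    ext x
    simp only [levOf, Set.mem_ofPred_eq, Set.mem_iUnion]
    constructor
    · rintro ⟨s, h1, h2⟩
      obtain ⟨j, q, hq, rfl⟩ := compRel_word hs h1.1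
      exact ⟨j, q, hq, h1, h2⟩
    · rintro ⟨j, q, hq, h1⟩
      exact ⟨_, h1⟩
  rw [this]
  refine MeasurableSet.iUnion fun j => measurableSet_exists_list _ _ fun q hq => ?_
  have hq := wordFam_measurable hf hg j q hq
  have e1 : Measurable (fun x : X => (x, q x)) := measurable_id.prodMk hq
  have e2 : Measurable (fun x : X => (q x, x)) := hq.prodMk measurable_id
  refine (e1 (startRel_measurable hs hf hg hS hhm)).inter
    ((e2 (walkRel_measurable hf hg hS k)).inter ?_)
  have : {x : X | ∀ j < k, ¬ walkRel f g S j (q x) x} =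
      ⋂ j, {x : X | j < k → ¬ walkRel f g S j (q x) x} := by
    ext x; simp
  change MeasurableSet {x : X | ∀ j < k, ¬ walkRel f g S j (q x) x}
  rw [this]
  exact MeasurableSet.iInter fun i =>
    (MeasurableSet.const _).imp (e2 (walkRel_measurable hf hg hS i)).compl

theorem lamOf_measurable (hs : ∀ x y, adjRel f g x y → adjRel f g y x) {r : ℕ}
    (hmax : ∀ x, ∃ y ∈ S, walkRel f g ∅ r x y) (hh : Function.Injective h)
    (hf : Measurable f) (hg : Measurable g) (hS : MeasurableSet S)
    (hhm : Measurable h) : Measurable (lamOf f g S h) := by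
  refine measurable_to_countable' fun k => ?_
  have : lamOf f g S h ⁻¹' {k} = {x | levOf f g S h k x} ∪ (S ∩ {_x | k = 0}) := by
    ext x
    simp only [Set.mem_preimage, Set.mem_singleton_iff, Set.mem_union, Set.mem_inter_iff,
      Set.mem_ofPred_eq]
    constructor
    · intro e
      by_cases hx : x ∈ S
      · rw [lamOf_mem hs hx] at e; exact Or.inr ⟨hx, e.symm⟩
      · left; rw [← e]; exact levOf_lamOf hs hmax hx
    · rintro (h1 | ⟨h1, rfl⟩)
      · exact lamOf_eq hh h1
      · exact lamOf_mem hs h1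
  rw [this]
  exact (levOf_measurable hs hf hg hS hhm k).union (hS.inter (MeasurableSet.const _))

theorem perm_measurable (hs : ∀ x y, adjRel f g x y → adjRel f g y x) {r : ℕ}
    (hmax : ∀ x, ∃ y ∈ S, walkRel f g ∅ r x y) (hh : Function.Injective h)
    (hf : Measurable f) (hg : Measurable g) (hS : MeasurableSet S)
    (hhm : Measurable h) (θ : X ≃ X) (hθ : ∀ x y, θ x = y ↔ cycRel f g S h x y) :
    Measurable θ := by
  have hl := lamOf_measurable hs hmax hh hf hg hS hhm
  have hE := compEq_measurable hf hg hS
  have hword : ∀ x y, compEq f g S x y → ∃ k, ∃ q ∈ wordFam f g k, y = q x := by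
    rintro x y (rfl | h1)
    · exact ⟨0, id, by simp [wordFam], rfl⟩
    · exact compRel_word hs h1
  have key : ∀ k, ∀ q ∈ wordFam f g k, MeasurableSet {x | θ x = q x} := by
    intro k q hq
    have hq := wordFam_measurable hf hg k q hq
    have e1 : Measurable (fun x : X => (x, q x)) := measurable_id.prodMk hq
    have : {x | θ x = q x} = {x | compEq f g S x (q x) ∧ (lamOf f g S h (q x) = lamOf f g S h x + 1 ∨
        (lamOf f g S h (q x) = 0 ∧ x ∈ ⋂ j, {x | ∀ p ∈ wordFam f g j,
          compEq f g S x (p x) → lamOf f g S h (p x) ≠ lamOf f g S h x + 1}))} := by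
      ext x
      simp only [Set.mem_ofPred_eq, hθ, cycRel, Set.mem_iInter]
      refine and_congr_right fun _ => or_congr_right (and_congr_right fun _ =>
        ⟨fun H k q _ => H _, ?_⟩)
      intro H t ht
      obtain ⟨k, q, hq, rfl⟩ := hword _ _ ht
      exact H k q hq ht
    rw [this]
    refine (e1 hE).inter ((measurableSet_eq_fun (hl.comp hq) (hl.add_const 1)).union
      ((measurableSet_eq_fun (hl.comp hq) measurable_const).inter (MeasurableSet.iInter fun j =>
        measurableSet_forall_list _ _ fun p hp => ?_)))
    have hp := wordFam_measurable hf hg j p hp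
    have e2 : Measurable (fun x : X => (x, p x)) := measurable_id.prodMk hp
    exact (e2 hE).imp (measurableSet_eq_fun (hl.comp hp) (hl.add_const 1)).compl
  intro B hB
  have : θ ⁻¹' B = ⋃ k, {x | ∃ q ∈ wordFam f g k, θ x = q x ∧ q x ∈ B} := by
    ext x
    simp only [Set.mem_preimage, Set.mem_iUnion, Set.mem_ofPred_eq]
    constructor
    · intro hx
      obtain ⟨k, q, hq, e⟩ := hword x (θ x) ((hθ x _).1 rfl).1
      exact ⟨k, q, hq, e, e ▸ hx⟩
    · rintro ⟨k, q, hq, e, hx⟩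
      rwa [e]
  rw [this]
  exact MeasurableSet.iUnion fun k => measurableSet_exists_list _ _ fun q hq =>
    (key k q hq).inter (wordFam_measurable hf hg k q hq hB)

end permmeas


theorem core_perm {X : Type*} [MeasurableSpace X] [StandardBorelSpace X]
    (μ : Measure X) (hμ1 : μ Set.univ ≤ 1) {f g : X → X} (hf : Measurable f) (hg : Measurable g)
    (hs : ∀ x y, adjRel f g x y → adjRel f g y x) (hne : ∀ x, f x ≠ g x)
    (hinf : ∀ x (T : Set X), T.Finite → x ∈ T → (∀ y ∈ T, f y ∈ T ∧ g y ∈ T) → False)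
    (hmp : ∀ (q : X → X) (A : Set X), MeasurableSet A → Measurable q → Set.InjOn q A →
      (∀ x ∈ A, ∃ k, walkRel f g ∅ k x (q x)) → μ (q '' A) = μ A) (m : ℕ) (hm : 1 ≤ m) :
    ∃ θ : X ≃ X, Measurable θ ∧ Measurable θ.symm ∧ (∀ x, ∃ k, walkRel f g ∅ k x (θ x)) ∧
      ∃ B : Set X, MeasurableSet B ∧ ((m : ℝ≥0∞) + 1) * μ B ≤ 5 ∧
        ∀ x ∉ B, ∀ y, (y = θ x ∨ x = θ y) ↔ (y = f x ∨ y = g x) := by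
  classical
  obtain ⟨h, hemb⟩ := exists_measurableEmbedding_real X
  obtain ⟨S, hS, hdisc, hmax⟩ := exists_maximal_discrete hf hg hs (2 * m)
  obtain ⟨θ, hθ⟩ := exists_perm (h := h) hs hemb.injective hmax
  have hθm := perm_measurable hs hmax hemb.injective hf hg hS hemb.measurable θ hθ
  have hθe : MeasurableEmbedding θ := hθm.measurableEmbedding θ.injective
  have hθs : Measurable θ.symm := by
    intro B hB
    rw [← Equiv.image_eq_preimage_symm]
    exact hθe.measurableSet_image' hB
  have hθF : ∀ x, ∃ k, walkRel f g ∅ k x (θ x) := by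
    intro x
    rcases ((hθ x _).1 rfl).1 with e | ⟨k, hk⟩
    · exact ⟨0, e, id⟩
    · exact ⟨k, walkRel_empty hk⟩
  have hb := bdrySet_measurable hf hg hS
  -- the measure of `S`
  have hmass : ((m : ℝ≥0∞) + 1) * μ S ≤ 1 := by
    obtain ⟨-, h2⟩ := mass_list μ S hS (wordFam f g m) (wordFam_measurable hf hg m)
      (fun q hq A _ hA hqA => hmp q A hA (wordFam_measurable hf hg m q hq) hqA
        fun x _ => ⟨m, (walkRel_iff_word hs).2 ⟨q, hq, rfl⟩⟩)
      (by
        intro q hq q' hq' x hx y hy e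
        refine hdisc x hx y hy ?_
        have h1 : walkRel f g ∅ m x (q x) := (walkRel_iff_word hs).2 ⟨q, hq, rfl⟩
        have h2 : walkRel f g ∅ m y (q x) := (walkRel_iff_word hs).2 ⟨q', hq', e⟩
        have := walkRel_trans hs h1 (walkRel_symm hs h2)
        rwa [← two_mul] at this)
    calc ((m : ℝ≥0∞) + 1) * μ S = ∫⁻ _x in S, ((m : ℝ≥0∞) + 1) ∂μ := by simp
      _ ≤ ∫⁻ x in S, (((wordFam f g m).map (fun q => q x)).toFinset.card : ℝ≥0∞) ∂μ := by
          refine lintegral_mono fun x => ?_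
          have := word_card hs hinf x m
          have h3 : ((m + 1 : ℕ) : ℝ≥0∞) ≤
              (((wordFam f g m).map (fun q => q x)).toFinset.card : ℝ≥0∞) := Nat.cast_le.2 (by
                convert this)
          rwa [Nat.cast_add, Nat.cast_one] at h3
      _ ≤ _ := h2
      _ ≤ 1 := (measure_mono (Set.subset_univ _)).trans hμ1
  have hstep : ∀ q : X → X, Measurable q → (∀ x, adjRel f g x (q x)) → μ (q '' S) = μ S := by
    intro q hq hqa
    refine hmp q S hS hq ?_ fun x _ => ⟨1, walkRel_step hs (walkRel_refl id 0) (hqa x) id⟩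
    intro x hx y hy e
    refine hdisc x hx y hy (walkRel_mono (k := 2) (by omega) ?_)
    have h1 : walkRel f g ∅ 1 x (q x) := walkRel_step hs (walkRel_refl id 0) (hqa x) id
    refine walkRel_step hs h1 (hs _ _ ?_) id
    rw [e]; exact hqa y
  have hbm : μ (bdrySet f g S) ≤ 2 * μ S := by
    calc μ (bdrySet f g S) ≤ μ (f '' S ∪ g '' S) := by
          refine measure_mono ?_
          rintro x ⟨-, hx⟩
          have key : ∀ z ∈ S, adjRel f g x z → x ∈ f '' S ∪ g '' S := by
            intro z hz ha
            rcases hs _ _ ha with e | e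
            · exact Or.inl ⟨z, hz, e.symm⟩
            · exact Or.inr ⟨z, hz, e.symm⟩
          rcases hx with hx | hx
          · exact key _ hx (Or.inl rfl)
          · exact key _ hx (Or.inr rfl)
      _ ≤ μ (f '' S) + μ (g '' S) := measure_union_le _ _
      _ = 2 * μ S := by
          rw [hstep f hf fun x => Or.inl rfl, hstep g hg fun x => Or.inr rfl, two_mul]
  set Λ : Set X := {x | (x ∉ S ∧ x ∉ bdrySet f g S) ∧ (f x = x ∨ g x = x)} with hΛ
  have hΛm : MeasurableSet Λ := (hS.compl.inter hb.compl).inter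
    ((measurableSet_eq_fun hf measurable_id).union (measurableSet_eq_fun hg measurable_id))
  have hΛμ : μ Λ ≤ 2 * μ S := by
    rw [← hmp θ Λ hΛm hθm θ.injective.injOn fun x _ => hθF x]
    refine (measure_mono ?_).trans hbm
    rintro _ ⟨x, ⟨⟨h1, h2⟩, h3⟩, rfl⟩
    exact perm_loop hs hemb.injective hmax θ hθ h1 h2 h3
  refine ⟨θ, hθm, hθs, hθF, S ∪ (bdrySet f g S ∪ Λ), hS.union (hb.union hΛm), ?_, ?_⟩
  · have : μ (S ∪ (bdrySet f g S ∪ Λ)) ≤ 5 * μ S := by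
      calc μ (S ∪ (bdrySet f g S ∪ Λ)) ≤ μ S + (μ (bdrySet f g S) + μ Λ) :=
            (measure_union_le _ _).trans (add_le_add_right (measure_union_le _ _) _)
        _ ≤ μ S + (2 * μ S + 2 * μ S) := by gcongr
        _ = 5 * μ S := by ring
    calc ((m : ℝ≥0∞) + 1) * μ (S ∪ (bdrySet f g S ∪ Λ)) ≤ ((m : ℝ≥0∞) + 1) * (5 * μ S) := by gcongr
      _ = 5 * (((m : ℝ≥0∞) + 1) * μ S) := by ring
      _ ≤ 5 * 1 := by gcongr
      _ = 5 := by simp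
  · intro x hx y
    simp only [Set.mem_union, not_or] at hx
    obtain ⟨h1, h2, h3⟩ := hx
    have h4 : ¬ (f x = x ∨ g x = x) := fun h4 => h3 ⟨⟨h1, h2⟩, h4⟩
    push Not at h4
    exact perm_good hs hne hemb.injective hmax θ hθ h1 h2 h4.1 h4.2 y

/-- Measure-theoretic Lusin-Novikov: a countable-to-one Borel map on a set of positive
measure is injective on a Borel subset of positive measure. -/
theorem null_of_injOn_null {X : Type*} [MeasurableSpace X] [StandardBorelSpace X]
    (μ : Measure X) [IsFiniteMeasure μ] {f : X → X} (hf : Measurable f) {A : Set X}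
    (hA : MeasurableSet A) (hc : ∀ y, {x | x ∈ A ∧ f x = y}.Countable)
    (hB : ∀ B ⊆ A, MeasurableSet B → Set.InjOn f B → μ B = 0) : μ A = 0 := by
  rcases A.eq_empty_or_nonempty with rfl | ⟨x0, -⟩
  · simp
  have : Nonempty X := ⟨x0⟩
  let _ := upgradeStandardBorel X
  obtain ⟨c, hco, hcb⟩ := exists_nat_basis X
  have hpm : Measurable (fun x : X => (f x, x)) := hf.prodMk measurable_id
  set ρ : Measure (X × X) := (μ.restrict A).map (fun x => (f x, x)) with hρ
  set κ := ρ.condKernel with hκ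
  have hdis : ρ.fst.compProd κ = ρ := ρ.disintegrate κ
  have hatm : Measurable (fun p : X × X => κ p.1 {p.2}) := by
    have : Measurable (fun p : X × X => (κ.comap Prod.fst measurable_fst) p
        (Prod.mk p ⁻¹' {z : (X × X) × X | z.2 = z.1.2})) :=
      ProbabilityTheory.Kernel.measurable_kernel_prodMk_left
        (measurableSet_eq_fun measurable_snd (measurable_snd.comp measurable_fst))
    convert this using 2 with p
    rw [ProbabilityTheory.Kernel.comap_apply]
    congr 1
  have hB0 : ∀ n, μ {x | x ∈ A ∧ x ∈ c n ∧ κ (f x) (c n) < 2 * κ (f x) {x}} = 0 := by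
    intro n
    refine hB _ (fun x hx => hx.1) ?_ ?_
    · have e1 : Measurable (fun x => κ (f x) (c n)) :=
        (κ.measurable_coe (hco n).measurableSet).comp hf
      have e2 : Measurable (fun x => 2 * κ (f x) {x}) := (hatm.comp hpm).const_mul 2
      have e3 : MeasurableSet {x | κ (f x) (c n) < 2 * κ (f x) {x}} := measurableSet_lt e1 e2
      exact hA.inter ((hco n).measurableSet.inter e3)
    · rintro x ⟨-, hx, hx'⟩ y ⟨-, hy, hy'⟩ e
      by_contra hxy
      rw [← e] at hy'
      have h1 : κ (f x) {x} + κ (f x) {y} ≤ κ (f x) (c n) := by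
        rw [← measure_union (by simpa using hxy) (measurableSet_singleton y)]
        refine measure_mono ?_
        rintro z (rfl | rfl)
        · exact hx
        · exact hy
      have h2 := ENNReal.add_lt_add hx' hy'
      rw [← mul_add, ← two_mul] at h2
      exact absurd (h2.trans_le (mul_le_mul_right h1 2)) (lt_irrefl _)
  have ham : MeasurableSet {p : X × X | κ p.1 {p.2} ≠ 0} :=
    (hatm (measurableSet_singleton 0)).compl
  have hae0 : ρ {p | κ p.1 {p.2} ≠ 0} = 0 := by
    rw [hρ, Measure.map_apply hpm ham, Measure.restrict_apply (hpm ham)]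
    refine measure_mono_null ?_ (measure_iUnion_null hB0)
    rintro x ⟨hx, hxA⟩
    have hx : κ (f x) {x} ≠ 0 := hx
    have hlt : κ (f x) {x} < 2 * κ (f x) {x} := by
      rw [two_mul]
      exact ENNReal.lt_add_right (measure_ne_top _ _) hx
    obtain ⟨U, hxU, hU, hUlt⟩ := Set.exists_isOpen_lt_of_lt {x} _ hlt
    obtain ⟨n, hn, hsub⟩ := hcb x U hU (hxU rfl)
    exact Set.mem_iUnion.2 ⟨n, hxA, hn, (measure_mono hsub).trans_lt hUlt⟩
  have hgm : MeasurableSet {p : X × X | p.2 ∈ A ∧ f p.2 = p.1} :=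
    (measurable_snd hA).inter (measurableSet_eq_fun (hf.comp measurable_snd) measurable_fst)
  have hae1 : ρ {p : X × X | p.2 ∈ A ∧ f p.2 = p.1}ᶜ = 0 := by
    rw [hρ, Measure.map_apply hpm hgm.compl, Measure.restrict_apply (hpm hgm.compl)]
    convert measure_empty (μ := μ)
    ext x
    simp
  rw [← hdis, Measure.compProd_apply ham, lintegral_eq_zero_iff
    (ProbabilityTheory.Kernel.measurable_kernel_prodMk_left ham)] at hae0
  rw [← hdis, Measure.compProd_apply hgm.compl, lintegral_eq_zero_iff
    (ProbabilityTheory.Kernel.measurable_kernel_prodMk_left hgm.compl)] at hae1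
  have hfalse : ∀ᵐ y ∂ρ.fst, False := by
    filter_upwards [hae0, hae1] with y h0 h1
    have h2 : κ y {x | x ∈ A ∧ f x = y ∧ κ y {x} = 0} = 0 := by
      have hcc : {x | x ∈ A ∧ f x = y ∧ κ y {x} = 0}.Countable :=
        Set.Countable.mono (s₂ := {x | x ∈ A ∧ f x = y}) (fun x hx => ⟨hx.1, hx.2.1⟩) (hc y)
      rw [← Set.biUnion_of_singleton {x | x ∈ A ∧ f x = y ∧ κ y {x} = 0},
        measure_biUnion_null_iff hcc]
      exact fun x hx => hx.2.2
    have h3 : κ y Set.univ = 0 := by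
      refine measure_mono_null ?_ (measure_union_null h2 (measure_union_null h0 h1))
      intro x _
      by_cases h4 : x ∈ A ∧ f x = y
      · by_cases h5 : κ y {x} = 0
        · exact Or.inl ⟨h4.1, h4.2, h5⟩
        · exact Or.inr (Or.inl h5)
      · exact Or.inr (Or.inr h4)
    simp at h3
  have h4 : ρ.fst Set.univ = 0 := by
    rw [ae_iff] at hfalse
    simpa using hfalse
  rw [Measure.fst_univ, hρ, Measure.map_apply hpm MeasurableSet.univ] at h4
  simpa using h4

/-- A Borel set with two-point sections over `G` is the union of two Borel graphs over `G`. -/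
theorem exists_two_sections {X : Type*} [MeasurableSpace X] [StandardBorelSpace X]
    (L : Set (X × X)) (hL : MeasurableSet L) (G : Set X) (hG : MeasurableSet G)
    (hdeg : ∀ x ∈ G, ({y | (x, y) ∈ L}).encard = 2) :
    ∃ f g : X → X, Measurable f ∧ Measurable g ∧ ∀ x ∈ G, f x ≠ g x ∧
      ∀ y, (x, y) ∈ L ↔ (y = f x ∨ y = g x) := by
  classical
  obtain ⟨h, hemb⟩ := exists_measurableEmbedding_real X
  have hex : ∀ x, ∃ p : X × X, x ∈ G → (h p.1 < h p.2 ∧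
      ∀ y, (x, y) ∈ L ↔ (y = p.1 ∨ y = p.2)) := by
    intro x
    by_cases hx : x ∈ G
    · obtain ⟨a, b, hab, e⟩ := Set.encard_eq_two.1 (hdeg x hx)
      have e' : ∀ y, (x, y) ∈ L ↔ (y = a ∨ y = b) := fun y => by
        have : y ∈ {y | (x, y) ∈ L} ↔ y ∈ ({a, b} : Set X) := by rw [e]
        simpa using this
      rcases lt_or_gt_of_ne (fun e => hab (hemb.injective e)) with hlt | hlt
      · exact ⟨(a, b), fun _ => ⟨hlt, e'⟩⟩
      · exact ⟨(b, a), fun _ => ⟨hlt, fun y => by rw [e', or_comm]⟩⟩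
    · exact ⟨(x, x), fun h => absurd h hx⟩
  choose p hp using hex
  set Tr : Set (X × X × X) := {t | t.1 ∈ G ∧ (t.1, t.2.1) ∈ L ∧ (t.1, t.2.2) ∈ L ∧
    h t.2.1 < h t.2.2} with hTr
  have m1 : Measurable (fun t : X × X × X => t.2.1) := measurable_fst.comp measurable_snd
  have m2 : Measurable (fun t : X × X × X => t.2.2) := measurable_snd.comp measurable_snd
  have hTrm : MeasurableSet Tr := by
    have e3 : MeasurableSet {t : X × X × X | h t.2.1 < h t.2.2} :=
      measurableSet_lt (hemb.measurable.comp m1) (hemb.measurable.comp m2)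
    exact (measurable_fst hG).inter (((measurable_fst.prodMk m1) hL).inter
      (((measurable_fst.prodMk m2) hL).inter e3))
  have hTrp : ∀ t ∈ Tr, t.2 = p t.1 := by
    rintro ⟨x, y, z⟩ ⟨h1, h2, h3, h4⟩
    obtain ⟨h5, h6⟩ := hp x h1
    simp only at h1 h2 h3 h4
    rw [h6] at h2 h3
    rcases h2 with rfl | rfl <;> rcases h3 with rfl | rfl
    · exact absurd h4 (lt_irrefl _)
    · rfl
    · exact absurd h4 (lt_asymm h5)
    · exact absurd h4 (lt_irrefl _)
  have hpT : ∀ x ∈ G, (x, p x) ∈ Tr := by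
    intro x hx
    obtain ⟨h5, h6⟩ := hp x hx
    exact ⟨hx, (h6 _).2 (Or.inl rfl), (h6 _).2 (Or.inr rfl), h5⟩
  have hinj : Set.InjOn Prod.fst Tr := by
    intro t ht t' ht' e
    refine Prod.ext e ?_
    rw [hTrp t ht, hTrp t' ht', e]
  have hpre : ∀ B : Set (X × X), MeasurableSet B → MeasurableSet (G ∩ p ⁻¹' B) := by
    intro B hB
    have : G ∩ p ⁻¹' B = Prod.fst '' (Tr ∩ Prod.snd ⁻¹' B) := by
      ext x
      constructor
      · rintro ⟨hx, hxB⟩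
        exact ⟨(x, p x), ⟨hpT x hx, hxB⟩, rfl⟩
      · rintro ⟨t, ⟨ht, htB⟩, rfl⟩
        refine ⟨ht.1, ?_⟩
        change p t.1 ∈ B
        rw [← hTrp t ht]; exact htB
    rw [this]
    exact (hTrm.inter (measurable_snd hB)).image_of_measurable_injOn measurable_fst
      (hinj.mono Set.inter_subset_left)
  have hmeas : ∀ π : X × X → X, Measurable π → Measurable (fun x => if x ∈ G then π (p x) else x) := by
    intro π hπ B hB
    have : (fun x => if x ∈ G then π (p x) else x) ⁻¹' B = (G ∩ p ⁻¹' (π ⁻¹' B)) ∪ (Gᶜ ∩ B) := by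
      ext x
      by_cases hx : x ∈ G <;> simp [hx]
    rw [this]
    exact (hpre _ (hπ hB)).union (hG.compl.inter hB)
  refine ⟨_, _, hmeas Prod.fst measurable_fst, hmeas Prod.snd measurable_snd, fun x hx => ?_⟩
  obtain ⟨h5, h6⟩ := hp x hx
  simp only [hx, if_true]
  exact ⟨fun e => by rw [e] at h5; exact lt_irrefl _ h5, h6⟩

theorem forest_of_lines_almost_generated
    {X : Type*} [MeasurableSpace X] [StandardBorelSpace X]
    (μ : Measure X) [IsProbabilityMeasure μ]
    (F : Set (X × X)) (hF : Equivalence fun x y => (x, y) ∈ F)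
    (hcnt : ∀ x, {y | (x, y) ∈ F}.Countable)
    (haper : ∀ᵐ x ∂μ, {y | (x, y) ∈ F}.Infinite)
    -- `F` is measure preserving: every partial Borel isomorphism with graph in `F`
    -- preserves `μ`:
    (hmp : ∀ (g : X → X) (A : Set X), MeasurableSet A → Measurable g →
      Set.InjOn g A → (∀ x ∈ A, (x, g x) ∈ F) → μ (g '' A) = μ A)
    (L : Set (X × X)) (hLF : L ⊆ F) (hLBorel : MeasurableSet L)
    (hsym : ∀ p : X × X, p ∈ L → (p.2, p.1) ∈ L)
    (hgen : ∀ x y : X, (x, y) ∈ F ↔ Relation.EqvGen (fun a b => (a, b) ∈ L) x y)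
    (hdeg : ∀ᵐ x ∂μ, ({y | (x, y) ∈ L}).encard = 2)
    (ε : ℝ≥0∞) (hε : 0 < ε) :
    ∃ θ θinv : X → X,
      Measurable θ ∧ Measurable θinv ∧
      (∀ x, θinv (θ x) = x ∧ θ (θinv x) = x) ∧
      MeasurePreserving θ μ μ ∧
      (∀ᵐ x ∂μ, (x, θ x) ∈ F) ∧
      countingMeasure μ
        (symmDiff L {p : X × X | p.2 = θ p.1 ∨ p.1 = θ p.2}) < ε := by
  classical
  -- the bad null set
  set N0 : Set X := toMeasurable μ {x | ¬ ({y | (x, y) ∈ F}.Infinite ∧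
    ({y | (x, y) ∈ L}).encard = 2)} with hN0
  have hN0m : MeasurableSet N0 := measurableSet_toMeasurable _ _
  have hN0μ : μ N0 = 0 := by
    rw [hN0, measure_toMeasurable]
    exact haper.and hdeg
  have hN0c : ∀ x ∉ N0, {y | (x, y) ∈ F}.Infinite ∧ ({y | (x, y) ∈ L}).encard = 2 := by
    intro x hx
    by_contra hc
    exact hx (subset_toMeasurable μ _ hc)
  obtain ⟨f, g, hf, hg, hfg⟩ := exists_two_sections L hLBorel N0ᶜ hN0m.compl
    fun x hx => (hN0c x hx).2
  have hpre : ∀ q : X → X, Measurable q → (∀ x ∉ N0, (x, q x) ∈ L) → ∀ M : Set X,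
      MeasurableSet M → μ M = 0 → μ (N0ᶜ ∩ q ⁻¹' M) = 0 := by
    intro q hq hqL M hM hM0
    refine null_of_injOn_null μ hq (hN0m.compl.inter (hq hM)) ?_ ?_
    · intro y
      refine Set.Countable.mono ?_ (hcnt y)
      rintro x ⟨⟨hx, -⟩, rfl⟩
      exact hF.symm (hLF (hqL x hx))
    · intro B hB hBm hinj
      rw [← hmp q B hBm hq hinj fun x hx => hLF (hqL x (hB hx).1)]
      refine measure_mono_null ?_ hM0
      rintro _ ⟨x, hx, rfl⟩
      exact (hB hx).2
  let N : ℕ → Set X := fun n => Nat.rec N0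
    (fun _ M => M ∪ ((N0ᶜ ∩ f ⁻¹' M) ∪ (N0ᶜ ∩ g ⁻¹' M))) n
  have hNs : ∀ n, N (n+1) = N n ∪ ((N0ᶜ ∩ f ⁻¹' (N n)) ∪ (N0ᶜ ∩ g ⁻¹' (N n))) := fun n => rfl
  have hN : ∀ n, MeasurableSet (N n) ∧ μ (N n) = 0 := by
    intro n
    induction n with
    | zero => exact ⟨hN0m, hN0μ⟩
    | succ n ih =>
      rw [hNs]
      refine ⟨ih.1.union ((hN0m.compl.inter (hf ih.1)).union (hN0m.compl.inter (hg ih.1))), ?_⟩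
      refine measure_union_null ih.2 (measure_union_null ?_ ?_)
      · exact hpre f hf (fun x hx => ((hfg x hx).2 _).2 (Or.inl rfl)) _ ih.1 ih.2
      · exact hpre g hg (fun x hx => ((hfg x hx).2 _).2 (Or.inr rfl)) _ ih.1 ih.2
  set Y : Set X := (⋃ n, N n)ᶜ with hY
  have hYm : MeasurableSet Y := (MeasurableSet.iUnion fun n => (hN n).1).compl
  have hYμ : μ Yᶜ = 0 := by
    rw [hY, compl_compl]; exact measure_iUnion_null fun n => (hN n).2
  have hY0 : ∀ x ∈ Y, x ∉ N0 := fun x hx hc => hx (Set.mem_iUnion.2 ⟨0, hc⟩)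
  have hYf : ∀ x ∈ Y, f x ∈ Y := by
    intro x hx hc
    obtain ⟨n, hn⟩ := Set.mem_iUnion.1 hc
    exact hx (Set.mem_iUnion.2 ⟨n+1, by rw [hNs]; exact Or.inr (Or.inl ⟨hY0 x hx, hn⟩)⟩)
  have hYg : ∀ x ∈ Y, g x ∈ Y := by
    intro x hx hc
    obtain ⟨n, hn⟩ := Set.mem_iUnion.1 hc
    exact hx (Set.mem_iUnion.2 ⟨n+1, by rw [hNs]; exact Or.inr (Or.inr ⟨hY0 x hx, hn⟩)⟩)
  have hYL : ∀ x ∈ Y, ∀ y, (x, y) ∈ L ↔ (y = f x ∨ y = g x) := fun x hx => (hfg x (hY0 x hx)).2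
  -- pass to the subtype
  have : StandardBorelSpace Y := hYm.standardBorel
  have hval : MeasurableEmbedding (Subtype.val : Y → X) := MeasurableEmbedding.subtype_coe hYm
  let ft : Y → Y := fun x => ⟨f x, hYf x x.2⟩
  let gt : Y → Y := fun x => ⟨g x, hYg x x.2⟩
  have hft : Measurable ft := (hf.comp measurable_subtype_coe).subtype_mk
  have hgt : Measurable gt := (hg.comp measurable_subtype_coe).subtype_mk
  have hadj : ∀ x y : Y, adjRel ft gt x y ↔ ((x : X), (y : X)) ∈ L := by
    intro x y
    rw [hYL x x.2]
    simp only [adjRel, ft, gt, Subtype.ext_iff]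
  have hs : ∀ x y, adjRel ft gt x y → adjRel ft gt y x := by
    intro x y hxy
    rw [hadj] at hxy ⊢
    exact hsym _ hxy
  have hne : ∀ x, ft x ≠ gt x := by
    intro x e
    exact (hfg x (hY0 x x.2)).1 (congrArg Subtype.val e)
  have hwF : ∀ k, ∀ x y : Y, walkRel ft gt ∅ k x y → ((x : X), (y : X)) ∈ F := by
    intro k
    induction k with
    | zero => rintro x y ⟨rfl, -⟩; exact hF.refl _
    | succ k ih =>
      intro x y hxy
      rcases walkRel_cases hs hxy with h1 | ⟨z, h1, h2⟩
      · exact ih _ _ h1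
      · exact hF.trans (ih _ _ h1) (hLF ((hadj _ _).1 h2))
  have hinf : ∀ x (T : Set Y), T.Finite → x ∈ T → (∀ y ∈ T, ft y ∈ T ∧ gt y ∈ T) → False := by
    intro x T hT hx hcl
    have hstep : ∀ a b, (a, b) ∈ L → a ∈ Subtype.val '' T → b ∈ Subtype.val '' T := by
      rintro _ b hab ⟨a, ha, rfl⟩
      rcases (hYL a a.2 b).1 hab with rfl | rfl
      · exact ⟨ft a, (hcl a ha).1, rfl⟩
      · exact ⟨gt a, (hcl a ha).2, rfl⟩
    have hgn : ∀ a b, Relation.EqvGen (fun a b => (a, b) ∈ L) a b →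
        (a ∈ Subtype.val '' T ↔ b ∈ Subtype.val '' T) := by
      intro a b hab
      induction hab with
      | rel a b h => exact ⟨hstep a b h, hstep b a (hsym _ h)⟩
      | refl a => exact Iff.rfl
      | symm a b _ ih => exact ih.symm
      | trans a b c _ _ ih1 ih2 => exact ih1.trans ih2
    refine (hN0c x (hY0 x x.2)).1 ((hT.image Subtype.val).subset ?_)
    intro y hy
    exact (hgn _ _ ((hgen _ _).1 hy)).1 ⟨x, hx, rfl⟩
  have hext : ∀ q : Y → Y, Measurable q →
      Measurable (fun x : X => if h : x ∈ Y then (q ⟨x, h⟩ : X) else x) := by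
    intro q hq
    exact Measurable.dite (measurable_subtype_coe.comp hq) measurable_subtype_coe hYm
  have hmpY : ∀ (q : Y → Y) (A : Set Y), MeasurableSet A → Measurable q → Set.InjOn q A →
      (∀ x ∈ A, ∃ k, walkRel ft gt ∅ k x (q x)) →
      (μ.comap Subtype.val) (q '' A) = (μ.comap Subtype.val) A := by
    intro q A hA hq hinj hqF
    rw [hval.comap_apply, hval.comap_apply]
    rw [← hmp (fun x : X => if h : x ∈ Y then (q ⟨x, h⟩ : X) else x) (Subtype.val '' A)
      (hval.measurableSet_image' hA) (hext q hq) ?_ ?_]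
    · congr 1
      ext y
      simp only [Set.image_image, Subtype.coe_prop, dif_pos]
    · rintro _ ⟨a, ha, rfl⟩ _ ⟨b, hb, rfl⟩ e
      simp only [Subtype.coe_prop, dif_pos] at e
      rw [hinj ha hb (Subtype.ext e)]
    · rintro _ ⟨a, ha, rfl⟩
      simp only [Subtype.coe_prop, dif_pos]
      obtain ⟨k, hk⟩ := hqF a ha
      exact hwF k _ _ hk
  have hμ1 : (μ.comap (Subtype.val : Y → X)) Set.univ ≤ 1 := by
    rw [hval.comap_apply]; exact prob_le_one
  obtain ⟨m, hm⟩ := ENNReal.exists_nat_mul_gt hε.ne' (show (20 : ℝ≥0∞) ≠ ⊤ by simp)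
  obtain ⟨θ, hθm, hθs, hθF, B, hB, hBμ, hBg⟩ := core_perm (μ.comap (Subtype.val : Y → X)) hμ1
    hft hgt hs hne hinf hmpY (m + 1) (by omega)
  rw [hval.comap_apply] at hBμ
  set Θ : X → X := fun x : X => if h : x ∈ Y then (θ ⟨x, h⟩ : X) else x with hΘ
  set Θi : X → X := fun x : X => if h : x ∈ Y then (θ.symm ⟨x, h⟩ : X) else x with hΘi
  have e1 : ∀ x : Y, Θ x = θ x := fun x => by simp [hΘ]
  have e2 : ∀ x : Y, Θi x = θ.symm x := fun x => by simp [hΘi]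
  have e3 : ∀ x ∉ Y, Θ x = x := fun x hx => by simp [hΘ, hx]
  have e4 : ∀ x ∉ Y, Θi x = x := fun x hx => by simp [hΘi, hx]
  have hΘm : Measurable Θ := hext θ hθm
  have hΘim : Measurable Θi := hext θ.symm hθs
  have hinv : ∀ x, Θi (Θ x) = x ∧ Θ (Θi x) = x := by
    intro x
    by_cases hx : x ∈ Y
    · lift x to Y using hx
      rw [e1, e2, e2, e1]; simp
    · rw [e3 x hx, e4 x hx, e3 x hx]; simp
  have hΘF : ∀ x, (x, Θ x) ∈ F := by
    intro x
    by_cases hx : x ∈ Y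
    · lift x to Y using hx
      rw [e1]
      obtain ⟨k, hk⟩ := hθF x
      exact hwF _ _ _ hk
    · rw [e3 x hx]; exact hF.refl x
  refine ⟨Θ, Θi, hΘm, hΘim, hinv, ⟨hΘm, ?_⟩, Filter.Eventually.of_forall hΘF, ?_⟩
  · ext A hA
    rw [Measure.map_apply hΘm hA]
    rw [← hmp Θ (Θ ⁻¹' A) (hΘm hA) hΘm ?_ fun x _ => hΘF x]
    · congr 1
      exact Set.image_preimage_eq A fun x => ⟨Θi x, (hinv x).2⟩
    · intro x _ y _ e
      rw [← (hinv x).1, e, (hinv y).1]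
  · have hBm : MeasurableSet (Subtype.val '' B) := hval.measurableSet_image' hB
    have hbound : countingMeasure μ (symmDiff L {p : X × X | p.2 = Θ p.1 ∨ p.1 = Θ p.2}) ≤
        4 * μ (Subtype.val '' B) := by
      unfold countingMeasure
      rw [← lintegral_indicator_const hBm]
      refine lintegral_mono_ae ?_
      have hYae : ∀ᵐ x ∂μ, x ∈ Y := by rw [ae_iff]; exact hYμ
      filter_upwards [hYae] with x hx
      lift x to Y using hx
      by_cases hxB : x ∈ B
      · rw [Set.indicator_of_mem (Set.mem_image_of_mem _ hxB)]
        have hsub : {y | ((x : X), y) ∈ symmDiff L {p : X × X | p.2 = Θ p.1 ∨ p.1 = Θ p.2}} ⊆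
            {f x, g x, Θ x, Θi x} := by
          intro y hy
          rcases hy with ⟨hy, -⟩ | ⟨hy, -⟩
          · rcases (hYL x x.2 y).1 hy with rfl | rfl <;> simp
          · rcases hy with hy | hy
            · have hy : y = Θ x := hy
              simp [hy]
            · have hy : (x : X) = Θ y := hy
              have : y = Θi x := by rw [hy, (hinv y).1]
              simp [this]
        have h4 : ({f x, g x, Θ x, Θi x} : Set X).encard ≤ 4 := by
          have h1 := Set.encard_insert_le ({g x, Θ x, Θi x} : Set X) (f x)
          have h2 := Set.encard_insert_le ({Θ x, Θi x} : Set X) (g x)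
          have h3 := Set.encard_insert_le ({Θi x} : Set X) (Θ x)
          rw [Set.encard_singleton] at h3
          calc _ ≤ _ := h1
            _ ≤ ((1 + 1) + 1) + 1 := by gcongr; exact h2.trans (by gcongr)
            _ = 4 := by norm_num
        have h5 := (Set.encard_le_encard hsub).trans h4
        calc _ ≤ ((4 : ℕ∞) : ℝ≥0∞) := ENat.toENNReal_le.2 h5
          _ = 4 := by simp
      · have : {y | ((x : X), y) ∈ symmDiff L {p : X × X | p.2 = Θ p.1 ∨ p.1 = Θ p.2}} = ∅ := by
          rw [Set.eq_empty_iff_forall_notMem]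
          have hiff : ∀ y, ((x : X), y) ∈ L ↔ (y = Θ x ∨ (x : X) = Θ y) := by
            intro y
            by_cases hy : y ∈ Y
            · lift y to Y using hy
              rw [hYL x x.2, e1, e1]
              have := hBg x hxB y
              simp only [Subtype.ext_iff] at this
              exact this.symm
            · rw [hYL x x.2]
              constructor
              · rintro (rfl | rfl)
                · exact absurd (hYf x x.2) hy
                · exact absurd (hYg x x.2) hy
              · rintro (rfl | h1)
                · rw [e1] at hy; exact absurd (θ x).2 hy
                · rw [e3 y hy] at h1; exact absurd (h1 ▸ x.2) hy
          rintro y (⟨h1, h2⟩ | ⟨h1, h2⟩)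
          · exact h2 ((hiff y).1 h1)
          · exact h2 ((hiff y).2 h1)
        rw [this]
        simp
    refine hbound.trans_lt ?_
    have hM0 : (m : ℝ≥0∞) ≠ 0 := by
      rintro h0
      rw [h0, zero_mul] at hm
      exact absurd hm (by simp)
    have h6 : (m : ℝ≥0∞) * (4 * μ (Subtype.val '' B)) ≤ 20 := by
      calc (m : ℝ≥0∞) * (4 * μ (Subtype.val '' B)) = 4 * (m * μ (Subtype.val '' B)) := by ring
        _ ≤ 4 * ((((m + 1 : ℕ) : ℝ≥0∞) + 1) * μ (Subtype.val '' B)) := by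
            gcongr
            push_cast
            exact le_self_add.trans le_self_add
        _ ≤ 4 * 5 := by gcongr
        _ = 20 := by norm_num
    by_contra hc
    push Not at hc
    have := hm.trans_le ((mul_le_mul_right hc (m : ℝ≥0∞)).trans h6)
    exact lt_irrefl _ this
end

section
/- Let Φ be a DSE of multiplicity n and θ : A → B a piece of Φ. Then there exists a piece θ_1 : C → D with μ(C) ≥ μ(A) + (μ(A^c)/(7n + μ(A^c)))². -/
open MeasureTheory
open scoped ENNReal

/-- A measure-preserving partial isomorphism with domain `A`, given by the restriction of
`f` to `A`, whose graph is contained in the equivalence relation `E` (an element of `[[E]]`). -/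
def IsPartialIso {X : Type*} [MeasurableSpace X] (μ : Measure X) (E : Set (X × X))
    (A : Set X) (f : X → X) : Prop :=
  MeasurableSet A ∧ Measurable f ∧ Set.InjOn f A ∧ MeasurableSet (f '' A) ∧
    (∀ x ∈ A, (x, f x) ∈ E) ∧
    ∀ s ⊆ A, MeasurableSet s → μ (f '' s) = μ s

namespace PieceAux

variable {X : Type*} [MeasurableSpace X]

/-- A state of the auction algorithm: a piece together with prices bounded by `K`. -/
structure IsState (μ : Measure X) (E : Set (X × X)) {m : ℕ} (Adom : Fin m → Set X)
    (f : Fin m → X → X) (K : ℕ) (A : Set X) (θ : X → X) (p : X → ℕ) : Prop where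
  iso : IsPartialIso μ E A θ
  sub : ∀ x ∈ A, ∃ i, x ∈ Adom i ∧ f i x = θ x
  meas : Measurable p
  le : ∀ y, p y ≤ K
  zero : ∀ y, y ∉ θ '' A → p y = 0
  cs : ∀ x ∈ A, ∀ i, x ∈ Adom i → p (θ x) ≤ p (f i x) + 1

/-- The bidders for index `i`. -/
def bid {m : ℕ} (Adom : Fin m → Set X) (f : Fin m → X → X) (K : ℕ) (A : Set X) (p : X → ℕ)
    (i : Fin m) : Set X :=
  {x | x ∉ A ∧ x ∈ Adom i ∧ p (f i x) < K ∧ ∀ j, x ∈ Adom j → p (f i x) ≤ p (f j x)}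

theorem measurableSet_bid {m : ℕ} {Adom : Fin m → Set X} {f : Fin m → X → X} {K : ℕ} {A : Set X}
    {p : X → ℕ} (hA : MeasurableSet A) (hAd : ∀ i, MeasurableSet (Adom i))
    (hf : ∀ i, Measurable (f i)) (hp : Measurable p) (i : Fin m) :
    MeasurableSet (bid Adom f K A p i) := by
  have h1 : ∀ j, MeasurableSet {x | x ∈ Adom j → p (f i x) ≤ p (f j x)} := by
    intro j
    have : {x | x ∈ Adom j → p (f i x) ≤ p (f j x)} =
        (Adom j)ᶜ ∪ {x | p (f i x) ≤ p (f j x)} := by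
      ext x; simp [imp_iff_not_or]
    rw [this]
    exact (hAd j).compl.union (measurableSet_le (hp.comp (hf i)) (hp.comp (hf j)))
  have : bid Adom f K A p i = Aᶜ ∩ (Adom i ∩ ({x | p (f i x) < K} ∩
      ⋂ j, {x | x ∈ Adom j → p (f i x) ≤ p (f j x)})) := by
    ext x; simp [bid]
  rw [this]
  exact hA.compl.inter ((hAd i).inter
    ((measurableSet_lt (hp.comp (hf i)) measurable_const).inter (MeasurableSet.iInter h1)))

theorem lintegral_iso {μ : Measure X} {E : Set (X × X)} {A : Set X} {θ : X → X}
    (h : IsPartialIso μ E A θ) {g : X → ℝ≥0∞} (hg : Measurable g) :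
    ∫⁻ x in A, g (θ x) ∂μ = ∫⁻ y in θ '' A, g y ∂μ := by
  obtain ⟨hA, hm, hinj, himg, -, hpres⟩ := h
  have : (μ.restrict A).map θ = μ.restrict (θ '' A) := by
    ext t ht
    rw [Measure.map_apply hm ht, Measure.restrict_apply (hm ht), Measure.restrict_apply ht,
      ← hpres _ Set.inter_subset_right ((hm ht).inter hA)]
    congr 1
    ext y
    constructor
    · rintro ⟨x, ⟨hx, hxA⟩, rfl⟩
      exact ⟨hx, x, hxA, rfl⟩
    · rintro ⟨hy, x, hxA, rfl⟩
      exact ⟨x, ⟨hy, hxA⟩, rfl⟩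
  rw [← this, lintegral_map hg hm]

theorem step [StandardBorelSpace X] {μ : Measure X} {E : Set (X × X)} {m : ℕ}
    {Adom : Fin m → Set X} {f : Fin m → X → X} (hiso : ∀ i, IsPartialIso μ E (Adom i) (f i))
    {K : ℕ} {A : Set X} {θ : X → X} {p : X → ℕ} (h : IsState μ E Adom f K A θ p) (i : Fin m) :
    ∃ A' θ' p', IsState μ E Adom f K A' θ' p' ∧
      ∫⁻ y, (p' y : ℝ≥0∞) ∂μ = ∫⁻ y, (p y : ℝ≥0∞) ∂μ + μ (bid Adom f K A p i) := by
  classical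
  set P := bid Adom f K A p i with hP
  have hPm : MeasurableSet P := measurableSet_bid h.iso.1 (fun i => (hiso i).1)
    (fun i => (hiso i).2.1) h.meas i
  have hPA : P ⊆ Adom i := fun x hx => hx.2.1
  have hPinj : Set.InjOn (f i) P := (hiso i).2.2.1.mono hPA
  have hQm : MeasurableSet (f i '' P) := hPm.image_of_measurable_injOn (hiso i).2.1 hPinj
  set Q := f i '' P with hQ
  have hmem : ∀ x ∈ P, f i x ∈ Q := fun x hx => ⟨x, hx, rfl⟩
  set A' := (A \ θ ⁻¹' Q) ∪ P with hA'
  set θ' := P.piecewise (f i) θ with hθ'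
  have e1 : ∀ x ∈ P, θ' x = f i x := fun x hx => Set.piecewise_eq_of_mem _ _ _ hx
  have e2 : ∀ x ∉ P, θ' x = θ x := fun x hx => Set.piecewise_eq_of_notMem _ _ _ hx
  have hA'm : MeasurableSet A' := (h.iso.1.diff (h.iso.2.1 hQm)).union hPm
  have hθ'm : Measurable θ' := Measurable.piecewise hPm (hiso i).2.1 h.iso.2.1
  have hrest : ∀ x ∈ A', x ∉ P → x ∈ A ∧ θ x ∉ Q := by
    intro x hx hxP
    rcases hx with hx | hx
    · exact hx
    · exact absurd hx hxP
  have hinj : Set.InjOn θ' A' := by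
    intro x hx y hy hxy
    by_cases hxP : x ∈ P <;> by_cases hyP : y ∈ P
    · rw [e1 x hxP, e1 y hyP] at hxy
      exact hPinj hxP hyP hxy
    · rw [e1 x hxP, e2 y hyP] at hxy
      exact absurd (hxy ▸ hmem x hxP) (hrest y hy hyP).2
    · rw [e2 x hxP, e1 y hyP] at hxy
      exact absurd (hxy ▸ hmem y hyP) (hrest x hx hxP).2
    · rw [e2 x hxP, e2 y hyP] at hxy
      exact h.iso.2.2.1 (hrest x hx hxP).1 (hrest y hy hyP).1 hxy
  refine ⟨A', θ', fun y => p y + Q.indicator (fun _ => 1) y, ⟨⟨hA'm, hθ'm, hinj,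
    hA'm.image_of_measurable_injOn hθ'm hinj, ?_, ?_⟩, ?_, ?_, ?_, ?_, ?_⟩, ?_⟩
  · intro x hx
    by_cases hxP : x ∈ P
    · rw [e1 x hxP]; exact (hiso i).2.2.2.2.1 x (hPA hxP)
    · rw [e2 x hxP]; exact h.iso.2.2.2.2.1 x (hrest x hx hxP).1
  · intro s hs hsm
    have hs1 : θ' '' (s ∩ P) = f i '' (s ∩ P) :=
      Set.image_congr fun x hx => e1 x hx.2
    have hs2 : θ' '' (s \ P) = θ '' (s \ P) :=
      Set.image_congr fun x hx => e2 x hx.2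
    have hs3 : θ' '' s = θ' '' (s ∩ P) ∪ θ' '' (s \ P) := by
      rw [← Set.image_union, Set.inter_union_sdiff]
    rw [hs3, measure_union, hs1, hs2,
      (hiso i).2.2.2.2.2 _ (fun x hx => hPA hx.2) (hsm.inter hPm),
      h.iso.2.2.2.2.2 _ (fun x hx => (hrest x (hs hx.1) hx.2).1) (hsm.diff hPm),
      measure_inter_add_sdiff _ hPm]
    · rw [Set.disjoint_left]
      rintro _ ⟨x, hx, rfl⟩ ⟨y, hy, hxy⟩
      exact hy.2 (hinj (hs hy.1) (hs hx.1) hxy ▸ hx.2)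
    · exact (hsm.diff hPm).image_of_measurable_injOn hθ'm (hinj.mono fun x hx => hs hx.1)
  · intro x hx
    by_cases hxP : x ∈ P
    · exact ⟨i, hPA hxP, (e1 x hxP).symm⟩
    · rw [e2 x hxP]; exact h.sub x (hrest x hx hxP).1
  · exact h.meas.add (measurable_const.indicator hQm)
  · intro y
    by_cases hy : y ∈ Q
    · obtain ⟨x, hx, rfl⟩ := hy
      have := hx.2.2.1
      simp only [Set.indicator_of_mem (hmem x hx)]
      omega
    · simpa [hy] using h.le y
  · intro y hy
    have hyQ : y ∉ Q := by
      rintro ⟨x, hx, rfl⟩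
      exact hy ⟨x, Or.inr hx, e1 x hx⟩
    have : p y = 0 := by
      apply h.zero
      rintro ⟨x, hx, rfl⟩
      have hxP : x ∉ P := fun hh => hh.1 hx
      exact hy ⟨x, Or.inl ⟨hx, hyQ⟩, e2 x hxP⟩
    simp [hyQ, this]
  · intro x hx j hj
    by_cases hxP : x ∈ P
    · have := hxP.2.2.2 j hj
      simp only [e1 x hxP, Set.indicator_of_mem (hmem x hxP)]
      omega
    · obtain ⟨hxA, hxQ⟩ := hrest x hx hxP
      have := h.cs x hxA j hj
      simp only [e2 x hxP, Set.indicator_of_notMem hxQ]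
      omega
  · have : ∀ y, ((p y + Q.indicator (fun _ => 1) y : ℕ) : ℝ≥0∞) =
        (p y : ℝ≥0∞) + Q.indicator (fun _ => (1 : ℝ≥0∞)) y := by
      intro y
      by_cases hy : y ∈ Q <;> simp [hy]
    simp only [this]
    rw [lintegral_add_right _ (measurable_const.indicator hQm), lintegral_indicator_const hQm,
      one_mul, hQ, (hiso i).2.2.2.2.2 P hPA hPm]

theorem exists_state [StandardBorelSpace X] {μ : Measure X} [IsProbabilityMeasure μ]
    {E : Set (X × X)} {m : ℕ}
    {Adom : Fin m → Set X} {f : Fin m → X → X} (hiso : ∀ i, IsPartialIso μ E (Adom i) (f i))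
    (K : ℕ) (δ : ℝ≥0∞) (hδ : δ ≠ 0) :
    ∃ A θ p, IsState μ E Adom f K A θ p ∧ ∀ i, μ (bid Adom f K A p i) ≤ δ := by
  by_contra! hcon
  have key : ∀ N : ℕ, ∃ A θ p, IsState μ E Adom f K A θ p ∧
      (N : ℝ≥0∞) * δ ≤ ∫⁻ y, (p y : ℝ≥0∞) ∂μ := by
    intro N
    induction N with
    | zero =>
      refine ⟨∅, id, fun _ => 0, ⟨⟨MeasurableSet.empty, measurable_id, by simp, by simp, by simp,
        ?_⟩, by simp, measurable_const, by simp, by simp, by simp⟩, by simp⟩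
      intro s hs _
      simp
    | succ N ih =>
      obtain ⟨A, θ, p, hst, hN⟩ := ih
      obtain ⟨i, hi⟩ := hcon A θ p hst
      obtain ⟨A', θ', p', hst', he⟩ := step hiso hst i
      refine ⟨A', θ', p', hst', ?_⟩
      rw [he]
      push_cast
      rw [add_mul, one_mul]
      exact add_le_add hN hi.le
  obtain ⟨N, hN⟩ := ENNReal.exists_nat_mul_gt hδ (ENNReal.natCast_ne_top K)
  obtain ⟨A, θ, p, hst, hle⟩ := key N
  have : ∫⁻ y, (p y : ℝ≥0∞) ∂μ ≤ K := by
    calc ∫⁻ y, (p y : ℝ≥0∞) ∂μ ≤ ∫⁻ _, (K : ℝ≥0∞) ∂μ :=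
          lintegral_mono fun y => Nat.cast_le.2 (hst.le y)
      _ = K := by simp
  exact absurd (hN.trans_le (hle.trans this)) (lt_irrefl _)

theorem state_bound {μ : Measure X} [IsProbabilityMeasure μ]
    {E : Set (X × X)} {m n : ℕ} (hn : 1 ≤ n)
    {Adom : Fin m → Set X} {f : Fin m → X → X} (hiso : ∀ i, IsPartialIso μ E (Adom i) (f i))
    (hrow : ∀ᵐ x ∂μ, ∑ i : Fin m, (Adom i).indicator (fun _ => (1 : ℝ≥0∞)) x = (n : ℝ≥0∞))
    (hcol : ∀ᵐ y ∂μ, ∑ i : Fin m,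
      (f i '' Adom i).indicator (fun _ => (1 : ℝ≥0∞)) y = (n : ℝ≥0∞))
    {K : ℕ} {A : Set X} {θ : X → X} {p : X → ℕ} (h : IsState μ E Adom f K A θ p) :
    (K : ℝ≥0∞) * μ (Aᶜ \ ⋃ i, bid Adom f K A p i) ≤ 1 := by
  classical
  set R := Aᶜ \ ⋃ i, bid Adom f K A p i with hR
  have hRm : MeasurableSet R := h.iso.1.compl.diff (MeasurableSet.iUnion fun i =>
    measurableSet_bid h.iso.1 (fun i => (hiso i).1) (fun i => (hiso i).2.1) h.meas i)
  let g : X → ℝ≥0∞ := fun y => (p y : ℝ≥0∞)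
  have hg : Measurable g := (Measurable.of_discrete (f := fun k : ℕ => (k : ℝ≥0∞))).comp h.meas
  -- total price
  have hI : ∫⁻ y, g y ∂μ ≠ ⊤ := by
    have : ∫⁻ y, g y ∂μ ≤ K := by
      calc ∫⁻ y, g y ∂μ ≤ ∫⁻ _, (K : ℝ≥0∞) ∂μ :=
            lintegral_mono fun y => by
              show (p y : ℝ≥0∞) ≤ K
              exact_mod_cast h.le y
        _ = K := by simp
    exact ne_top_of_le_ne_top (ENNReal.natCast_ne_top K) this
  have hdeg : ∑ i, ∫⁻ x in Adom i, g (f i x) ∂μ = n * ∫⁻ y, g y ∂μ := by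
    calc ∑ i, ∫⁻ x in Adom i, g (f i x) ∂μ
        = ∑ i, ∫⁻ y, (f i '' Adom i).indicator g y ∂μ := by
          refine Finset.sum_congr rfl fun i _ => ?_
          rw [lintegral_iso (hiso i) hg, lintegral_indicator (hiso i).2.2.2.1]
      _ = ∫⁻ y, ∑ i, (f i '' Adom i).indicator g y ∂μ := by
          rw [lintegral_finsetSum _ fun i _ => hg.indicator (hiso i).2.2.2.1]
      _ = ∫⁻ y, n * g y ∂μ := by
          refine lintegral_congr_ae ?_
          filter_upwards [hcol] with y hy
          rw [← hy, Finset.sum_mul]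
          refine Finset.sum_congr rfl fun i _ => ?_
          by_cases hyi : y ∈ f i '' Adom i
          · simp only [Set.indicator_of_mem hyi, one_mul]
          · simp only [Set.indicator_of_notMem hyi, zero_mul]
      _ = n * ∫⁻ y, g y ∂μ := lintegral_const_mul _ hg
  have hmatch : ∫⁻ x in A, g (θ x) ∂μ = ∫⁻ y, g y ∂μ := by
    rw [lintegral_iso h.iso hg, ← lintegral_indicator h.iso.2.2.2.1]
    congr 1
    ext y
    by_cases hy : y ∈ θ '' A
    · rw [Set.indicator_of_mem hy]
    · rw [Set.indicator_of_notMem hy]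
      simp [g, h.zero y hy]
  have hsum : ∀ x, ∑ i, (Adom i).indicator (fun x => g (f i x)) x =
      ∑ i, (Adom i).indicator (fun _ => (1 : ℝ≥0∞)) x * g (f i x) := by
    intro x
    refine Finset.sum_congr rfl fun i _ => ?_
    by_cases hx : x ∈ Adom i
    · simp only [Set.indicator_of_mem hx, one_mul]
    · simp only [Set.indicator_of_notMem hx, zero_mul]
  have hpt : ∀ᵐ x ∂μ, n * A.indicator (fun x => g (θ x)) x + n * R.indicator (fun _ => (K : ℝ≥0∞)) x
      ≤ ∑ i, (Adom i).indicator (fun x => g (f i x)) x + (n : ℝ≥0∞) := by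
    filter_upwards [hrow] with x hx
    by_cases hxA : x ∈ A
    · have hxR : x ∉ R := fun hh => hh.1 hxA
      rw [Set.indicator_of_mem hxA, Set.indicator_of_notMem hxR, mul_zero, add_zero, hsum]
      nth_rw 1 [← hx]
      nth_rw 1 [← hx]
      rw [Finset.sum_mul, ← Finset.sum_add_distrib]
      refine Finset.sum_le_sum fun i _ => ?_
      by_cases hxi : x ∈ Adom i
      · simp only [Set.indicator_of_mem hxi, one_mul]
        show (p (θ x) : ℝ≥0∞) ≤ (p (f i x) : ℝ≥0∞) + 1
        exact_mod_cast h.cs x hxA i hxi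
      · simp only [Set.indicator_of_notMem hxi, zero_mul, zero_add, le_refl]
    · rw [Set.indicator_of_notMem hxA, mul_zero, zero_add]
      by_cases hxR : x ∈ R
      · refine le_trans ?_ le_self_add
        rw [Set.indicator_of_mem hxR, hsum, ← hx, Finset.sum_mul]
        have hK : ∀ i, x ∈ Adom i → p (f i x) = K := by
          by_contra! hc
          obtain ⟨i, hi, hpi⟩ := hc
          obtain ⟨j, hj, hjm⟩ := Finset.exists_min_image
            (Finset.univ.filter fun i => x ∈ Adom i) (fun i => p (f i x)) ⟨i, by simpa using hi⟩
          have hj' : x ∈ Adom j := by simpa using hj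
          have hji : p (f j x) ≤ p (f i x) := hjm i (by simpa using hi)
          refine hxR.2 (Set.mem_iUnion.2 ⟨j, hxA, hj', ?_, fun l hl => hjm l (by simpa using hl)⟩)
          have := h.le (f i x)
          omega
        refine Finset.sum_le_sum fun i _ => ?_
        by_cases hxi : x ∈ Adom i
        · simp [g, hK i hxi]
        · simp [hxi]
      · rw [Set.indicator_of_notMem hxR, mul_zero]
        exact zero_le
  have hint := lintegral_mono_ae hpt
  have hfi : ∀ i ∈ (Finset.univ : Finset (Fin m)),
      Measurable ((Adom i).indicator (fun x => g (f i x))) :=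
    fun i _ => (hg.comp (hiso i).2.1).indicator (hiso i).1
  have hgθ : Measurable (fun x => g (θ x)) := hg.comp h.iso.2.1
  rw [lintegral_add_left ((hgθ.indicator h.iso.1).const_mul _),
    lintegral_const_mul _ (hgθ.indicator h.iso.1), lintegral_indicator h.iso.1, hmatch,
    lintegral_const_mul _ (measurable_const.indicator hRm), lintegral_indicator_const hRm,
    lintegral_add_right _ measurable_const, lintegral_finsetSum _ hfi] at hint
  simp only [lintegral_const, measure_univ, mul_one] at hint
  have hdeg' : ∑ i, ∫⁻ x, (Adom i).indicator (fun x => g (f i x)) x ∂μ = n * ∫⁻ y, g y ∂μ := by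
    rw [← hdeg]
    exact Finset.sum_congr rfl fun i _ => lintegral_indicator (hiso i).1 _
  rw [hdeg', ENNReal.add_le_add_iff_left (ENNReal.mul_ne_top (ENNReal.natCast_ne_top n) hI)] at hint
  have hn0 : (n : ℝ≥0∞) ≠ 0 := by
    simp; omega
  exact (ENNReal.mul_le_mul_iff_right hn0 (ENNReal.natCast_ne_top n)).1 (by simpa using hint)

theorem exists_large [StandardBorelSpace X] {μ : Measure X} [IsProbabilityMeasure μ]
    {E : Set (X × X)} {m n : ℕ} (hn : 1 ≤ n)
    {Adom : Fin m → Set X} {f : Fin m → X → X} (hiso : ∀ i, IsPartialIso μ E (Adom i) (f i))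
    (hrow : ∀ᵐ x ∂μ, ∑ i : Fin m, (Adom i).indicator (fun _ => (1 : ℝ≥0∞)) x = (n : ℝ≥0∞))
    (hcol : ∀ᵐ y ∂μ, ∑ i : Fin m,
      (f i '' Adom i).indicator (fun _ => (1 : ℝ≥0∞)) y = (n : ℝ≥0∞))
    (c : ℝ≥0∞) (hc : c ≠ 0) (hc' : c ≠ ⊤) :
    ∃ (C : Set X) (θ₁ : X → X), IsPartialIso μ E C θ₁ ∧
      (∀ x ∈ C, ∃ i, x ∈ Adom i ∧ f i x = θ₁ x) ∧ μ Cᶜ ≤ c := by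
  have hc2 : c / 2 ≠ 0 := by simp [hc]
  obtain ⟨K, hK⟩ := ENNReal.exists_nat_mul_gt hc2 ENNReal.one_ne_top
  have hδ : c / 2 / (m + 1 : ℕ) ≠ 0 := ENNReal.div_ne_zero.2 ⟨hc2, ENNReal.natCast_ne_top _⟩
  obtain ⟨A, θ, p, hst, hb⟩ := exists_state hiso K _ hδ
  refine ⟨A, θ, hst.iso, hst.sub, ?_⟩
  have h1 := state_bound hn hiso hrow hcol hst
  set Z := ⋃ i, bid Adom f K A p i with hZ
  have h2 : μ Z ≤ c / 2 := by
    calc μ Z ≤ ∑ i, μ (bid Adom f K A p i) := measure_iUnion_fintype_le _ _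
      _ ≤ ∑ _i : Fin m, c / 2 / (m + 1 : ℕ) := Finset.sum_le_sum fun i _ => hb i
      _ = m * (c / 2 / (m + 1 : ℕ)) := by simp
      _ ≤ (m + 1 : ℕ) * (c / 2 / (m + 1 : ℕ)) := by gcongr; omega
      _ ≤ c / 2 := ENNReal.mul_div_le
  have h3 : μ (Aᶜ \ Z) ≤ c / 2 := by
    by_contra! hlt
    have : (K : ℝ≥0∞) * (c / 2) ≤ K * μ (Aᶜ \ Z) := by gcongr
    exact absurd (hK.trans_le (this.trans h1)) (lt_irrefl _)
  calc μ Aᶜ ≤ μ ((Aᶜ \ Z) ∪ Z) := measure_mono (by intro x hx; by_cases x ∈ Z <;> simp_all)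
    _ ≤ μ (Aᶜ \ Z) + μ Z := measure_union_le _ _
    _ ≤ c / 2 + c / 2 := add_le_add h3 h2
    _ = c := ENNReal.add_halves c

end PieceAux

/-- Let `Φ` be a DSE of multiplicity `n` and `θ : A → B` a piece of `Φ`
(a partial isomorphism whose graph is contained in the support `H = ⋃_i graph φ_i`).
Then there exists a piece `θ₁ : C → D` with `μ(C) ≥ μ(A) + (μ(Aᶜ)/(7n + μ(Aᶜ)))²`. -/
theorem piece_enlargement
    {X : Type*} [MeasurableSpace X] [StandardBorelSpace X]
    (μ : Measure X) [IsProbabilityMeasure μ]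
    (E : Set (X × X)) (hE : Equivalence fun x y => (x, y) ∈ E)
    (hcnt : ∀ x, {y | (x, y) ∈ E}.Countable)
    (m n : ℕ) (hn : 1 ≤ n) (Adom : Fin m → Set X) (f : Fin m → X → X)
    (hiso : ∀ i, IsPartialIso μ E (Adom i) (f i))
    (hrow : ∀ᵐ x ∂μ, ∑ i : Fin m, (Adom i).indicator (fun _ => (1 : ℝ≥0∞)) x = (n : ℝ≥0∞))
    (hcol : ∀ᵐ y ∂μ, ∑ i : Fin m,
      (f i '' Adom i).indicator (fun _ => (1 : ℝ≥0∞)) y = (n : ℝ≥0∞))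
    (A : Set X) (θ : X → X)
    (hθ : IsPartialIso μ E A θ)
    (hθH : ∀ x ∈ A, ∃ i, x ∈ Adom i ∧ f i x = θ x) :
    ∃ (C : Set X) (θ₁ : X → X),
      IsPartialIso μ E C θ₁ ∧
      (∀ x ∈ C, ∃ i, x ∈ Adom i ∧ f i x = θ₁ x) ∧
      μ A + (μ Aᶜ / (7 * (n : ℝ≥0∞) + μ Aᶜ)) ^ 2 ≤ μ C := by
  by_cases hu : μ Aᶜ = 0
  · exact ⟨A, θ, hθ, hθH, by simp [hu]⟩
  have hut : μ Aᶜ ≠ ⊤ := measure_ne_top _ _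
  obtain ⟨C, θ₁, h1, h2, h3⟩ := PieceAux.exists_large hn hiso hrow hcol (μ Aᶜ / 2)
    (by simp [hu]) (ENNReal.div_ne_top hut (by simp))
  refine ⟨C, θ₁, h1, h2, ?_⟩
  have hn' : (1 : ℝ≥0∞) ≤ n := by exact_mod_cast hn
  have h7 : (2 : ℝ≥0∞) ≤ 7 * (n : ℝ≥0∞) + μ Aᶜ := by
    calc (2 : ℝ≥0∞) ≤ 7 * 1 := by norm_num
      _ ≤ 7 * (n : ℝ≥0∞) := by gcongr
      _ ≤ _ := le_self_add
  have hq : μ Aᶜ / (7 * (n : ℝ≥0∞) + μ Aᶜ) ≤ μ Aᶜ / 2 := ENNReal.div_le_div_left h7 _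
  have hq1 : μ Aᶜ / (7 * (n : ℝ≥0∞) + μ Aᶜ) ≤ 1 :=
    ENNReal.div_le_of_le_mul (by rw [one_mul]; exact le_add_self)
  have hsq : (μ Aᶜ / (7 * (n : ℝ≥0∞) + μ Aᶜ)) ^ 2 ≤ μ Aᶜ / 2 := by
    rw [sq]
    calc _ ≤ μ Aᶜ / 2 * 1 := mul_le_mul' hq hq1
      _ = _ := mul_one _
  have hsum : μ A + μ Aᶜ / 2 + μ Aᶜ / 2 ≤ μ C + μ Aᶜ / 2 := by
    rw [add_assoc, ENNReal.add_halves, measure_add_measure_compl hθ.1,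
      ← measure_add_measure_compl h1.1]
    gcongr
  exact (add_le_add le_rfl hsq).trans
    ((ENNReal.add_le_add_iff_right (ENNReal.div_ne_top hut (by simp))).1 hsum)
end

section
/- Every doubly stochastic element is almost decomposable: for any DSE Φ of multiplicity n and any ε > 0, there exists a DSE Ψ composed of n elements of the full group [E] (i.e., n automorphisms θ_1,…,θ_n ∈ [E]) such that d(Φ, Ψ) = ∫_E |M(Φ) − ∑_j χ(graph θ_j)| dν < ε. -/
open MeasureTheory
open scoped ENNReal Classical

/-- A proper partial `n`-edge-colouring of the bipartite graph of a family of partial isos. -/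
def GoodCol {X : Type*} [MeasurableSpace X] {m n : ℕ} (A : Fin m → Set X) (f : Fin m → X → X)
    (C : Fin m → Fin n → Set X) : Prop :=
  (∀ i j, MeasurableSet (C i j)) ∧ (∀ i j, C i j ⊆ A i) ∧
  (∀ i j j' x, x ∈ C i j → x ∈ C i j' → j = j') ∧
  (∀ i i' j x, x ∈ C i j → x ∈ C i' j → i = i') ∧
  (∀ i i' j x x', x ∈ C i j → x' ∈ C i' j → f i x = f i' x' → i = i' ∧ x = x')

/-- Uncoloured edges with index `i` with `a` missing at the source and `b` at the target. -/
def USet {X : Type*} {m n : ℕ} (A : Fin m → Set X) (f : Fin m → X → X)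
    (C : Fin m → Fin n → Set X) (i₀ : Fin m) (a b : Fin n) : Set X :=
  {x | x ∈ A i₀ ∧ (∀ j, x ∉ C i₀ j) ∧ (∀ i, x ∉ C i a) ∧ ∀ i, f i₀ x ∉ f i '' C i b}

lemma USet_meas {X : Type*} [MeasurableSpace X] [StandardBorelSpace X] {m n : ℕ}
    (A : Fin m → Set X) (f : Fin m → X → X)
    (C : Fin m → Fin n → Set X) (hA : ∀ i, MeasurableSet (A i)) (hf : ∀ i, Measurable (f i))
    (hinj : ∀ i, Set.InjOn (f i) (A i)) (hC : GoodCol A f C) (i₀ : Fin m) (a b : Fin n) :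
    MeasurableSet (USet A f C i₀ a b) := by
  obtain ⟨hm, hsub, -, -, -⟩ := hC
  have : USet A f C i₀ a b = A i₀ ∩ ((⋂ j, (C i₀ j)ᶜ) ∩ ((⋂ i, (C i a)ᶜ) ∩
      ⋂ i, (f i₀ ⁻¹' (f i '' C i b))ᶜ)) := by
    ext x; simp only [USet, Set.mem_ofPred_eq, Set.mem_inter_iff, Set.mem_iInter, Set.mem_compl_iff, Set.mem_preimage]
  rw [this]
  refine (hA i₀).inter ((MeasurableSet.iInter fun j => (hm _ _).compl).inter
    ((MeasurableSet.iInter fun j => (hm _ _).compl).inter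
      (MeasurableSet.iInter fun j => MeasurableSet.compl ?_)))
  exact hf i₀ ((hm j b).image_of_measurable_injOn (hf j) ((hinj j).mono (hsub j b)))

/-- Endpoints reached by alternating paths. -/
def QSeq {X : Type*} {m n : ℕ} (f : Fin m → X → X)
    (C : Fin m → Fin n → Set X) (a b : Fin n) (V : Set X) : ℕ → Set X
  | 0 => V
  | k + 1 => ⋃ i, f i '' (C i b ∩ ⋃ i', C i' a ∩ f i' ⁻¹' (QSeq f C a b V k))

lemma QSeq_meas {X : Type*} [MeasurableSpace X] [StandardBorelSpace X] {m n : ℕ}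
    (A : Fin m → Set X) (f : Fin m → X → X)
    (C : Fin m → Fin n → Set X) (hf : ∀ i, Measurable (f i))
    (hinj : ∀ i, Set.InjOn (f i) (A i)) (hC : GoodCol A f C) (a b : Fin n) (V : Set X)
    (hV : MeasurableSet V) (k : ℕ) : MeasurableSet (QSeq f C a b V k) := by
  obtain ⟨hm, hsub, -, -, -⟩ := hC
  induction k with
  | zero => exact hV
  | succ k ih =>
    refine MeasurableSet.iUnion fun i => ?_
    refine MeasurableSet.image_of_measurable_injOn ?_ (hf i)
      ((hinj i).mono (Set.inter_subset_left.trans (hsub i b)))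
    exact (hm i b).inter (MeasurableSet.iUnion fun i' => (hm _ _).inter (hf i' ih))

lemma exists_sat {X : Type*} [MeasurableSpace X] [StandardBorelSpace X] {m n : ℕ}
    (A : Fin m → Set X) (f : Fin m → X → X)
    (C : Fin m → Fin n → Set X) (hf : ∀ i, Measurable (f i))
    (hinj : ∀ i, Set.InjOn (f i) (A i)) (hC : GoodCol A f C) (a b : Fin n) (V : Set X)
    (hV : MeasurableSet V) (hb : ∀ i, ∀ x ∈ C i b, f i x ∉ V) :
    ∃ P Q : Set X, MeasurableSet P ∧ V ⊆ Q ∧ (∀ x ∈ P, ∃ i, x ∈ C i a) ∧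
      (∀ i, ∀ x ∈ C i a, x ∈ P ↔ f i x ∈ Q) ∧ (∀ i, ∀ x ∈ C i b, x ∈ P ↔ f i x ∈ Q) := by
  have hC' := hC
  obtain ⟨hm, hsub, hd1, hd2, hd3⟩ := hC
  set Q : Set X := ⋃ k, QSeq f C a b V k with hQ
  have hQm : MeasurableSet Q := MeasurableSet.iUnion fun k => QSeq_meas A f C hf hinj hC' a b V hV k
  refine ⟨⋃ i, C i a ∩ f i ⁻¹' Q, Q, MeasurableSet.iUnion fun i => (hm i a).inter (hf i hQm),
    Set.subset_iUnion (QSeq f C a b V) 0, ?_, ?_, ?_⟩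
  · intro x hx
    obtain ⟨i, hi⟩ := Set.mem_iUnion.1 hx
    exact ⟨i, hi.1⟩
  · intro i x hx
    constructor
    · intro h
      obtain ⟨i', hi'⟩ := Set.mem_iUnion.1 h
      obtain rfl := hd2 _ _ _ _ hx hi'.1
      exact hi'.2
    · intro h
      exact Set.mem_iUnion.2 ⟨i, hx, h⟩
  · intro i x hx
    constructor
    · intro h
      obtain ⟨i', hi'⟩ := Set.mem_iUnion.1 h
      obtain ⟨k, hk⟩ := Set.mem_iUnion.1 hi'.2
      refine Set.mem_iUnion.2 ⟨k + 1, Set.mem_iUnion.2 ⟨i, x, ⟨hx, ?_⟩, rfl⟩⟩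
      exact Set.mem_iUnion.2 ⟨i', hi'.1, hk⟩
    · intro h
      obtain ⟨k, hk⟩ := Set.mem_iUnion.1 h
      cases k with
      | zero => exact absurd hk (hb i x hx)
      | succ k =>
        obtain ⟨i', x', ⟨hx', hp⟩, he⟩ := Set.mem_iUnion.1 hk
        obtain ⟨rfl, rfl⟩ := hd3 _ _ _ _ _ hx' hx he
        obtain ⟨i'', h1, h2⟩ := Set.mem_iUnion.1 hp
        exact Set.mem_iUnion.2 ⟨i'', h1, Set.mem_iUnion.2 ⟨k, h2⟩⟩

lemma kempe {X : Type*} [MeasurableSpace X] [StandardBorelSpace X] {m n : ℕ}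
    (A : Fin m → Set X) (f : Fin m → X → X)
    (C : Fin m → Fin n → Set X) (hA : ∀ i, MeasurableSet (A i)) (hf : ∀ i, Measurable (f i))
    (hinj : ∀ i, Set.InjOn (f i) (A i)) (hC : GoodCol A f C) (i₀ : Fin m) (a b : Fin n) :
    ∃ C' : Fin m → Fin n → Set X, GoodCol A f C' ∧
      ∀ i x, (∃ j, x ∈ C' i j) ↔ ((∃ j, x ∈ C i j) ∨ (i = i₀ ∧ x ∈ USet A f C i₀ a b)) := by
  have hUm := USet_meas A f C hA hf hinj hC i₀ a b
  set U := USet A f C i₀ a b with hU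
  have hUA : U ⊆ A i₀ := fun x hx => hx.1
  obtain ⟨P, Q, hPm, hVQ, hPa, hsa, hsb⟩ := exists_sat A f C hf hinj hC a b (f i₀ '' U)
    (hUm.image_of_measurable_injOn (hf i₀) ((hinj i₀).mono hUA)) (by
      rintro i x hx ⟨u, hu, he⟩
      exact hu.2.2.2 i ⟨x, hx, he.symm⟩)
  obtain ⟨hm, hsub, hd1, hd2, hd3⟩ := hC
  set σ := Equiv.swap a b with hσ
  let τ : X → Fin n → Fin n := fun x j => if x ∈ P then σ j else j
  have hUP : ∀ x ∈ U, x ∉ P := by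
    intro x hx hp
    obtain ⟨i, hi⟩ := hPa x hp
    exact hx.2.2.1 i hi
  have hτinj : ∀ x j j', τ x j = τ x j' → j = j' := by
    intro x j j' h
    by_cases hp : x ∈ P
    · simpa [τ, hp] using h
    · simpa [τ, hp] using h
  have hττ : ∀ x j, τ x (τ x j) = j := by
    intro x j
    by_cases hp : x ∈ P
    · simp [τ, hp, hσ]
    · simp [τ, hp]
  have hab : ∀ x j, j = a ∨ j = b → τ x j = a ∨ τ x j = b := by
    intro x j h
    by_cases hp : x ∈ P
    · rcases h with rfl | rfl <;> simp [τ, hp, hσ]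
    · simpa [τ, hp] using h
  have hnab : ∀ x j, ¬ (j = a ∨ j = b) → τ x j = j := by
    intro x j h
    push Not at h
    by_cases hp : x ∈ P
    · simp [τ, hp, hσ, Equiv.swap_apply_of_ne_of_ne h.1 h.2]
    · simp [τ, hp]
  have hs : ∀ i x j, (j = a ∨ j = b) → x ∈ C i j → (x ∈ P ↔ f i x ∈ Q) := by
    rintro i x j (rfl | rfl) h
    · exact hsa i x h
    · exact hsb i x h
  -- key fact about a new edge versus an old one at the target
  have hnew : ∀ x ∈ U, ∀ i' x', x' ∈ C i' (τ x' a) → f i₀ x = f i' x' → False := by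
    intro x hx i' x' h he
    have hq : f i' x' ∈ Q := he ▸ hVQ ⟨x, hx, rfl⟩
    have hp := (hs i' x' _ (hab x' a (Or.inl rfl)) h).2 hq
    have : τ x' a = b := by simp [τ, hp, hσ]
    rw [this] at h
    exact hx.2.2.2 i' ⟨x', h, he.symm⟩
  have hnewL : ∀ x ∈ U, ∀ i', x ∈ C i' (τ x a) → False := by
    intro x hx i' h
    have : τ x a = a := by simp [τ, hUP x hx]
    rw [this] at h
    exact hx.2.2.1 i' h
  refine ⟨fun i j => {x | x ∈ C i (τ x j) ∨ (i = i₀ ∧ j = a ∧ x ∈ U)}, ⟨?_, ?_, ?_, ?_, ?_⟩, ?_⟩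
  · intro i j
    have : {x | x ∈ C i (τ x j) ∨ (i = i₀ ∧ j = a ∧ x ∈ U)} =
        ((C i (σ j) ∩ P) ∪ (C i j \ P)) ∪ {x | i = i₀ ∧ j = a ∧ x ∈ U} := by
      ext x
      by_cases hp : x ∈ P <;> simp [τ, hp]
    beta_reduce
    rw [this]
    refine (((hm _ _).inter hPm).union ((hm _ _).diff hPm)).union ?_
    by_cases h1 : i = i₀ ∧ j = a
    · simpa [h1.1, h1.2] using hUm
    · have : {x | i = i₀ ∧ j = a ∧ x ∈ U} = ∅ := by
        ext x; simp; tauto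
      rw [this]; exact MeasurableSet.empty
  · rintro i j x (h | ⟨rfl, rfl, h⟩)
    · exact hsub _ _ h
    · exact hUA h
  · rintro i j j' x (h | ⟨rfl, rfl, h⟩) (h' | ⟨h1, rfl, h'⟩)
    · exact hτinj x _ _ (hd1 _ _ _ _ h h')
    · subst h1
      exact absurd h (h'.2.1 _)
    · exact absurd h' (h.2.1 _)
    · rfl
  · rintro i i' j x (h | ⟨rfl, rfl, h⟩) (h' | ⟨rfl, h1, h'⟩)
    · exact hd2 _ _ _ _ h h'
    · subst h1
      exact (hnewL x h' _ h).elim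
    · exact (hnewL x h _ h').elim
    · rfl
  · rintro i i' j x x' (h | ⟨rfl, rfl, h⟩) (h' | ⟨rfl, h1, h'⟩) he
    · by_cases hj : j = a ∨ j = b
      · have e1 := hs _ _ _ (hab x j hj) h
        have e2 := hs _ _ _ (hab x' j hj) h'
        rw [he, ← e2] at e1
        have : τ x j = τ x' j := by simp [τ, e1]
        rw [this] at h
        exact hd3 _ _ _ _ _ h h' he
      · rw [hnab _ _ hj] at h h'
        exact hd3 _ _ _ _ _ h h' he
    · subst h1
      exact (hnew x' h' _ _ h he.symm).elim
    · exact (hnew x h _ _ h' he).elim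
    · exact ⟨rfl, hinj _ (hUA h) (hUA h') he⟩
  · intro i x
    constructor
    · rintro ⟨j, h | ⟨h1, h2, h3⟩⟩
      · exact Or.inl ⟨_, h⟩
      · exact Or.inr ⟨h1, h3⟩
    · rintro (⟨j, h⟩ | ⟨h1, h3⟩)
      · exact ⟨τ x j, Or.inl (by rwa [hττ])⟩
      · exact ⟨a, Or.inr ⟨h1, rfl, h3⟩⟩

/-- Total measure of the uncoloured edges. -/
noncomputable def uncov {X : Type*} [MeasurableSpace X] (μ : Measure X) {m n : ℕ}
    (A : Fin m → Set X) (C : Fin m → Fin n → Set X) : ℝ≥0∞ :=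
  ∑ i, μ (A i \ ⋃ j, C i j)

lemma card_of_ind {m n : ℕ} {X : Type*} (S : Fin m → Set X) (x : X)
    (h : ∑ i : Fin m, (S i).indicator (fun _ => (1 : ℝ≥0∞)) x = (n : ℝ≥0∞)) :
    (Finset.univ.filter fun i => x ∈ S i).card = n := by
  have : ∑ i : Fin m, (S i).indicator (fun _ => (1 : ℝ≥0∞)) x =
      ((Finset.univ.filter fun i => x ∈ S i).card : ℝ≥0∞) := by
    simp only [Set.indicator_apply, Finset.sum_boole]
  rw [this] at h
  exact_mod_cast h

/-- If `i₀` is among at most `n` indices and every colour appears at another index, contradiction. -/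
lemma exists_missing {m n : ℕ} (p : Fin m → Prop) (hp : (Finset.univ.filter p).card = n)
    (r : Fin m → Fin n → Prop) (hr : ∀ i j, r i j → p i)
    (hu : ∀ i j j', r i j → r i j' → j = j') (i₀ : Fin m) (h₀ : p i₀) (h₁ : ∀ j, ¬ r i₀ j) :
    ∃ a, ∀ i, ¬ r i a := by
  by_contra hcon
  push Not at hcon
  choose F hF using hcon
  have hinj : Function.Injective F := by
    intro j j' h
    have h1 := hF j
    rw [h] at h1
    exact hu _ _ _ h1 (hF j')
  have hsub : insert i₀ (Finset.univ.image F) ⊆ Finset.univ.filter p := by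
    intro i hi
    rcases Finset.mem_insert.1 hi with rfl | hi
    · simpa using h₀
    · obtain ⟨j, -, rfl⟩ := Finset.mem_image.1 hi
      simpa using hr _ _ (hF j)
  have hnot : i₀ ∉ Finset.univ.image F := by
    intro hi
    obtain ⟨j, -, hj⟩ := Finset.mem_image.1 hi
    exact h₁ j (hj ▸ hF j)
  have := Finset.card_le_card hsub
  rw [Finset.card_insert_of_notMem hnot, Finset.card_image_of_injective _ hinj, hp] at this
  simp at this

lemma ae_USet {X : Type*} [MeasurableSpace X] [StandardBorelSpace X]
    (μ : Measure X) {m n : ℕ} (A : Fin m → Set X) (f : Fin m → X → X)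
    (C : Fin m → Fin n → Set X) (hA : ∀ i, MeasurableSet (A i)) (hf : ∀ i, Measurable (f i))
    (hinj : ∀ i, Set.InjOn (f i) (A i))
    (hpres : ∀ i, ∀ s ⊆ A i, MeasurableSet s → μ (f i '' s) = μ s)
    (hrow : ∀ᵐ x ∂μ, ∑ i : Fin m, (A i).indicator (fun _ => (1 : ℝ≥0∞)) x = (n : ℝ≥0∞))
    (hcol : ∀ᵐ y ∂μ, ∑ i : Fin m,
      (f i '' A i).indicator (fun _ => (1 : ℝ≥0∞)) y = (n : ℝ≥0∞))
    (hC : GoodCol A f C) (i : Fin m) :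
    ∀ᵐ x ∂μ, x ∈ A i \ ⋃ j, C i j → x ∈ ⋃ a, ⋃ b, USet A f C i a b := by
  obtain ⟨hm, hsub, hd1, hd2, hd3⟩ := hC
  have hcol' : ∀ᵐ x ∂μ, x ∈ A i → ∑ i' : Fin m,
      (f i' '' A i').indicator (fun _ => (1 : ℝ≥0∞)) (f i x) = (n : ℝ≥0∞) := by
    obtain ⟨N, hN, hNm, hN0⟩ := exists_measurable_superset_of_null (ae_iff.1 hcol)
    have h1 : μ (A i ∩ f i ⁻¹' N) = 0 := by
      rw [← hpres i _ Set.inter_subset_left ((hA i).inter (hf i hNm))]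
      refine measure_mono_null ?_ hN0
      rintro _ ⟨x, hx, rfl⟩
      exact hx.2
    rw [ae_iff]
    refine measure_mono_null ?_ h1
    intro x hx
    simp only [Set.mem_ofPred_eq, Classical.not_imp] at hx
    exact ⟨hx.1, hN hx.2⟩
  filter_upwards [hrow, hcol'] with x h1 h2 hx
  have h2 := h2 hx.1
  have hxn : ∀ j, x ∉ C i j := fun j hj => hx.2 (Set.mem_iUnion.2 ⟨j, hj⟩)
  obtain ⟨a, ha⟩ := exists_missing (fun i' => x ∈ A i') (card_of_ind A x h1)
    (fun i' j => x ∈ C i' j) (fun i' j h => hsub i' j h) (fun i' j j' h h' => hd1 _ _ _ _ h h')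
    i hx.1 hxn
  obtain ⟨b, hb⟩ := exists_missing (fun i' => f i x ∈ f i' '' A i')
    (card_of_ind (fun i' => f i' '' A i') (f i x) h2)
    (fun i' j => f i x ∈ f i' '' C i' j) (fun i' j h => Set.image_mono (hsub i' j) h)
    (by
      rintro i' j j' ⟨u, hu, hu'⟩ ⟨v, hv, hv'⟩
      have := hinj i' (hsub _ _ hu) (hsub _ _ hv) (hu'.trans hv'.symm)
      subst this
      exact hd1 _ _ _ _ hu hv)
    i ⟨x, hx.1, rfl⟩ (by
      rintro j ⟨u, hu, hu'⟩
      have := hinj i (hsub _ _ hu) hx.1 hu'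
      subst this
      exact hxn _ hu)
  exact Set.mem_iUnion.2 ⟨a, Set.mem_iUnion.2 ⟨b, hx.1, hxn, ha, hb⟩⟩

lemma step {X : Type*} [MeasurableSpace X] [StandardBorelSpace X]
    (μ : Measure X) {m n : ℕ} (A : Fin m → Set X) (f : Fin m → X → X)
    (C : Fin m → Fin n → Set X) (hA : ∀ i, MeasurableSet (A i)) (hf : ∀ i, Measurable (f i))
    (hinj : ∀ i, Set.InjOn (f i) (A i))
    (hpres : ∀ i, ∀ s ⊆ A i, MeasurableSet s → μ (f i '' s) = μ s)
    (hrow : ∀ᵐ x ∂μ, ∑ i : Fin m, (A i).indicator (fun _ => (1 : ℝ≥0∞)) x = (n : ℝ≥0∞))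
    (hcol : ∀ᵐ y ∂μ, ∑ i : Fin m,
      (f i '' A i).indicator (fun _ => (1 : ℝ≥0∞)) y = (n : ℝ≥0∞))
    (hC : GoodCol A f C) :
    ∃ C' : Fin m → Fin n → Set X, GoodCol A f C' ∧ ∃ δ : ℝ≥0∞,
      uncov μ A C' + δ ≤ uncov μ A C ∧ uncov μ A C ≤ ((m * n * n + 1 : ℕ) : ℝ≥0∞) * δ := by
  have hbound : uncov μ A C ≤ ∑ t : Fin m × Fin n × Fin n, μ (USet A f C t.1 t.2.1 t.2.2) := by
    rw [Fintype.sum_prod_type]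
    refine Finset.sum_le_sum fun i _ => ?_
    rw [Fintype.sum_prod_type]
    calc μ (A i \ ⋃ j, C i j) ≤ μ (⋃ a, ⋃ b, USet A f C i a b) :=
          measure_mono_ae (ae_USet μ A f C hA hf hinj hpres hrow hcol hC i)
      _ ≤ ∑ a, μ (⋃ b, USet A f C i a b) := measure_iUnion_fintype_le _ _
      _ ≤ _ := Finset.sum_le_sum fun a _ => measure_iUnion_fintype_le _ _
  rcases isEmpty_or_nonempty (Fin m × Fin n × Fin n) with he | hne
  · refine ⟨C, hC, 0, by simp, ?_⟩
    simpa using hbound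
  · obtain ⟨t, -, ht⟩ := Finset.exists_max_image (Finset.univ : Finset (Fin m × Fin n × Fin n))
      (fun t => μ (USet A f C t.1 t.2.1 t.2.2)) Finset.univ_nonempty
    obtain ⟨i₀, a, b⟩ := t
    obtain ⟨C', hC', hU⟩ := kempe A f C hA hf hinj hC i₀ a b
    have hUm := USet_meas A f C hA hf hinj hC i₀ a b
    refine ⟨C', hC', μ (USet A f C i₀ a b), ?_, ?_⟩
    · have h1 : ∀ i, μ (A i \ ⋃ j, C' i j) + (if i = i₀ then μ (USet A f C i₀ a b) else 0) ≤
          μ (A i \ ⋃ j, C i j) := by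
        intro i
        by_cases hi : i = i₀
        · subst hi
          rw [if_pos rfl, ← measure_union _ hUm]
          · refine measure_mono ?_
            rintro x (hx | hx)
            · refine ⟨hx.1, fun h => hx.2 ?_⟩
              rw [Set.mem_iUnion] at h ⊢
              exact (hU i x).2 (Or.inl h)
            · exact ⟨hx.1, fun h => by
                obtain ⟨j, hj⟩ := Set.mem_iUnion.1 h
                exact hx.2.1 j hj⟩
          · rw [Set.disjoint_left]
            intro x hx hx'
            exact hx.2 (Set.mem_iUnion.2 ((hU i x).2 (Or.inr ⟨rfl, hx'⟩)))
        · rw [if_neg hi, add_zero]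
          refine measure_mono ?_
          intro x hx
          refine ⟨hx.1, fun h => hx.2 ?_⟩
          rw [Set.mem_iUnion] at h ⊢
          exact (hU i x).2 (Or.inl h)
      have h2 := Finset.sum_le_sum fun i (_ : i ∈ Finset.univ) => h1 i
      rw [Finset.sum_add_distrib] at h2
      simpa [uncov] using h2
    · refine hbound.trans ((Finset.sum_le_card_nsmul _ _ _ ht).trans ?_)
      rw [nsmul_eq_mul]
      gcongr
      simp [mul_assoc]

lemma exists_coloring {X : Type*} [MeasurableSpace X] [StandardBorelSpace X]
    (μ : Measure X) [IsFiniteMeasure μ] {m n : ℕ} (A : Fin m → Set X) (f : Fin m → X → X)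
    (hA : ∀ i, MeasurableSet (A i)) (hf : ∀ i, Measurable (f i))
    (hinj : ∀ i, Set.InjOn (f i) (A i))
    (hpres : ∀ i, ∀ s ⊆ A i, MeasurableSet s → μ (f i '' s) = μ s)
    (hrow : ∀ᵐ x ∂μ, ∑ i : Fin m, (A i).indicator (fun _ => (1 : ℝ≥0∞)) x = (n : ℝ≥0∞))
    (hcol : ∀ᵐ y ∂μ, ∑ i : Fin m,
      (f i '' A i).indicator (fun _ => (1 : ℝ≥0∞)) y = (n : ℝ≥0∞))
    (ε : ℝ≥0∞) (hε : 0 < ε) :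
    ∃ C : Fin m → Fin n → Set X, GoodCol A f C ∧ uncov μ A C < ε := by
  set T : Set (Fin m → Fin n → Set X) := {C | GoodCol A f C} with hT
  set s : ℝ≥0∞ := ⨅ C ∈ T, uncov μ A C with hs
  have hle : ∀ C ∈ T, s ≤ uncov μ A C := fun C hC => iInf₂_le C hC
  have h0 : (fun _ _ => ∅ : Fin m → Fin n → Set X) ∈ T := by
    refine ⟨?_, ?_, ?_, ?_, ?_⟩ <;> simp
  have hbi : ∀ r, s < r → ∃ C, C ∈ T ∧ uncov μ A C < r := by
    intro r hr
    by_contra hcon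
    push Not at hcon
    exact absurd hr (not_lt.2 (le_iInf₂ hcon))
  have hsfin : s ≠ ⊤ := by
    refine ne_top_of_le_ne_top ?_ (hle _ h0)
    simp only [uncov]
    exact (ENNReal.sum_lt_top.2 fun i _ => measure_lt_top _ _).ne
  have hs0 : s = 0 := by
    by_contra hne
    set N : ℝ≥0∞ := ((m * n * n + 1 : ℕ) : ℝ≥0∞) with hN
    have hd : s / N ≠ 0 := ENNReal.div_ne_zero.2 ⟨hne, ENNReal.natCast_ne_top _⟩
    have hlt : s < s + s / N := ENNReal.lt_add_right hsfin hd
    obtain ⟨C, hC, hCs⟩ := hbi _ hlt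
    obtain ⟨C', hC', δ, h1, h2⟩ := step μ A f C hA hf hinj hpres hrow hcol hC
    have h3 : s / N ≤ δ := ENNReal.div_le_of_le_mul' ((hle C hC).trans h2)
    have h4 : s + s / N ≤ uncov μ A C := (add_le_add (hle C' hC') h3).trans h1
    exact absurd hCs (not_lt.2 h4)
  have : s < ε := hs0 ▸ hε
  obtain ⟨C, hC, hCs⟩ := hbi _ this
  exact ⟨C, hC, hCs⟩

/-- Points all of whose forward `g`-iterates stay in `D`. -/
def FI {X : Type*} (g : X → X) (D : Set X) : Set X := {x | ∀ k, g^[k] x ∈ D}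

lemma FI_ex {X : Type*} (g : X → X) (D : Set X) (x : X) :
    ∃ k, g^[k] x ∉ D ∨ x ∈ FI g D := by
  by_cases h : x ∈ FI g D
  · exact ⟨0, Or.inr h⟩
  · have h' : ¬ ∀ k, g^[k] x ∈ D := h
    push Not at h'
    obtain ⟨k, hk⟩ := h'
    exact ⟨k, Or.inl hk⟩

/-- Exit time from `D` (zero if there is none). -/
noncomputable def exitT {X : Type*} (g : X → X) (D : Set X) (x : X) : ℕ := Nat.find (FI_ex g D x)

/-- Points on half-infinite chains. -/
def Bad {X : Type*} (g h : X → X) (D R : Set X) : Set X := {x | ¬ (x ∈ FI g D ↔ x ∈ FI h R)}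

/-- Close up the finite chains of the partial injection `g : D → R` with inverse `h`. -/
noncomputable def closeUp {X : Type*} (g h : X → X) (D R : Set X) (x : X) : X :=
  if x ∈ Bad g h D R then x else if x ∈ D then g x else h^[exitT h R x] x

lemma Bad_symm {X : Type*} (g h : X → X) (D R : Set X) : Bad h g R D = Bad g h D R := by
  ext x
  show ¬ _ ↔ ¬ _
  exact not_congr iff_comm

lemma FI_meas {X : Type*} [MeasurableSpace X] (g : X → X) (D : Set X) (hg : Measurable g)
    (hD : MeasurableSet D) : MeasurableSet (FI g D) := by
  have : FI g D = ⋂ k, g^[k] ⁻¹' D := by ext x; simp [FI]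
  rw [this]
  exact MeasurableSet.iInter fun k => (hg.iterate k) hD

lemma Bad_meas {X : Type*} [MeasurableSpace X] (g h : X → X) (D R : Set X) (hg : Measurable g)
    (hh : Measurable h) (hD : MeasurableSet D) (hR : MeasurableSet R) :
    MeasurableSet (Bad g h D R) := by
  have : Bad g h D R = (FI g D \ FI h R) ∪ (FI h R \ FI g D) := by
    ext x
    show ¬ _ ↔ _
    simp only [Set.mem_union, Set.mem_sdiff]
    tauto
  rw [this]
  have h1 := FI_meas g D hg hD
  have h2 := FI_meas h R hh hR
  exact (h1.diff h2).union (h2.diff h1)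

lemma closeUp_meas {X : Type*} [MeasurableSpace X] (g h : X → X) (D R : Set X) (hg : Measurable g)
    (hh : Measurable h) (hD : MeasurableSet D) (hR : MeasurableSet R) :
    Measurable (closeUp g h D R) := by
  refine Measurable.ite (Bad_meas g h D R hg hh hD hR) measurable_id
    (Measurable.ite hD hg ?_)
  refine Measurable.find (f := fun k => h^[k]) (p := fun k x => h^[k] x ∉ R ∨ x ∈ FI h R)
    (fun k => hh.iterate k) (fun k => ?_) (FI_ex h R)
  exact (hh.iterate k hR).compl.union (FI_meas h R hh hR)

lemma FI_step {X : Type*} (g : X → X) (D : Set X) (x : X) (hx : x ∈ D) :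
    g x ∈ FI g D ↔ x ∈ FI g D := by
  constructor
  · intro h k
    cases k with
    | zero => exact hx
    | succ k => rw [Function.iterate_succ_apply]; exact h k
  · intro h k
    rw [← Function.iterate_succ_apply]; exact h (k + 1)

lemma Bad_step {X : Type*} (g h : X → X) (D R : Set X)
    (hg : ∀ x ∈ D, g x ∈ R ∧ h (g x) = x) (x : X) (hx : x ∈ D) :
    g x ∈ Bad g h D R ↔ x ∈ Bad g h D R := by
  show ¬ _ ↔ ¬ _
  have h1 := FI_step g D x hx
  have h2 := FI_step h R (g x) (hg x hx).1
  rw [(hg x hx).2] at h2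
  rw [h1, h2]

lemma exitT_lt {X : Type*} (h : X → X) (R : Set X) (x : X) (i : ℕ) (hi : i < exitT h R x) :
    h^[i] x ∈ R := by
  have := Nat.find_min (FI_ex h R x) hi
  push Not at this
  exact this.1

lemma exitT_spec {X : Type*} (h : X → X) (R : Set X) (x : X) (hx : x ∉ FI h R) :
    h^[exitT h R x] x ∉ R := by
  have := Nat.find_spec (FI_ex h R x)
  exact this.resolve_right hx

lemma closeUp_inv {X : Type*} (g h : X → X) (D R : Set X)
    (hg : ∀ x ∈ D, g x ∈ R ∧ h (g x) = x) (hh : ∀ x ∈ R, h x ∈ D ∧ g (h x) = x) (x : X) :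
    closeUp h g R D (closeUp g h D R x) = x := by
  by_cases hB : x ∈ Bad g h D R
  · have : closeUp g h D R x = x := by simp [closeUp, hB]
    rw [this, closeUp, Bad_symm, if_pos hB]
  by_cases hD : x ∈ D
  · have : closeUp g h D R x = g x := by simp [closeUp, hB, hD]
    rw [this, closeUp, Bad_symm, if_neg (by rwa [Bad_step g h D R hg x hD]),
      if_pos (hg x hD).1, (hg x hD).2]
  · have he : closeUp g h D R x = h^[exitT h R x] x := by simp [closeUp, hB, hD]
    rw [he]
    have hxg : x ∉ FI g D := fun h => hD (h 0)
    have hxh : x ∉ FI h R := by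
      intro hx
      exact hB fun h => hxg (h.2 hx)
    set k := exitT h R x with hk
    have hlt : ∀ i < k, h^[i] x ∈ R := fun i hi => exitT_lt h R x i hi
    have hspec : h^[k] x ∉ R := exitT_spec h R x hxh
    have hnb : ∀ i ≤ k, h^[i] x ∉ Bad g h D R := by
      intro i
      induction i with
      | zero => intro _; exact hB
      | succ i ih =>
        intro hi
        rw [Function.iterate_succ_apply', ← Bad_symm, Bad_step h g R D hh _ (hlt i hi), Bad_symm]
        exact ih (by omega)
    have hback : ∀ i ≤ k, g^[i] (h^[k] x) = h^[k - i] x := by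
      intro i
      induction i with
      | zero => intro _; rfl
      | succ i ih =>
        intro hi
        rw [Function.iterate_succ_apply', ih (by omega)]
        obtain ⟨l, hl⟩ : ∃ l, k - i = l + 1 := ⟨k - i - 1, by omega⟩
        have : k - (i + 1) = l := by omega
        rw [hl, this, Function.iterate_succ_apply', (hh _ (hlt l (by omega))).2]
    have hend : g^[k] (h^[k] x) = x := by simpa using hback k le_rfl
    have hin : ∀ i < k, g^[i] (h^[k] x) ∈ D := by
      intro i hi
      rw [hback i hi.le]
      obtain ⟨l, hl⟩ : ∃ l, k - i = l + 1 := ⟨k - i - 1, by omega⟩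
      rw [hl, Function.iterate_succ_apply']
      exact (hh _ (hlt l (by omega))).1
    have hnFI : h^[k] x ∉ FI g D := by
      intro hF
      have := hF k
      rw [hend] at this
      exact hD this
    have hexit : exitT g D (h^[k] x) = k := by
      refine (Nat.find_eq_iff _).2 ⟨Or.inl (by rwa [hend]), ?_⟩
      rintro i hi (h1 | h1)
      · exact h1 (hin i hi)
      · exact hnFI h1
    rw [closeUp, Bad_symm, if_neg (hnb k le_rfl), if_neg hspec, hexit, hend]

lemma closeUp_E {X : Type*} (E : Set (X × X)) (hE : Equivalence fun x y => (x, y) ∈ E)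
    (g h : X → X) (D R : Set X)
    (hg : ∀ x ∈ D, (x, g x) ∈ E) (hh : ∀ x ∈ R, (x, h x) ∈ E) (x : X) :
    (x, closeUp g h D R x) ∈ E := by
  unfold closeUp
  split_ifs with h1 h2
  · exact hE.refl x
  · exact hg x h2
  · have : ∀ i ≤ exitT h R x, (x, h^[i] x) ∈ E := by
      intro i
      induction i with
      | zero => intro _; exact hE.refl x
      | succ i ih =>
        intro hi
        rw [Function.iterate_succ_apply']
        exact hE.trans (ih (by omega)) (hh _ (exitT_lt h R x i hi))
    exact this _ le_rfl

lemma image_iter {X : Type*} [MeasurableSpace X] [StandardBorelSpace X] (μ : Measure X)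
    (h : X → X) (R : Set X) (hh : Measurable h) (hinj : Set.InjOn h R)
    (hp : ∀ s ⊆ R, MeasurableSet s → μ (h '' s) = μ s) (k : ℕ) (s : Set X) (hs : MeasurableSet s)
    (hk : ∀ x ∈ s, ∀ i < k, h^[i] x ∈ R) :
    MeasurableSet (h^[k] '' s) ∧ μ (h^[k] '' s) = μ s := by
  induction k with
  | zero => simpa using hs
  | succ k ih =>
    obtain ⟨h1, h2⟩ := ih fun x hx i hi => hk x hx i (by omega)
    have hsub : h^[k] '' s ⊆ R := by
      rintro _ ⟨x, hx, rfl⟩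
      exact hk x hx k (by omega)
    rw [Function.iterate_succ', Set.image_comp]
    exact ⟨h1.image_of_measurable_injOn hh (hinj.mono hsub), by rw [hp _ hsub h1, h2]⟩

lemma mp_of_pieces {X : Type*} [MeasurableSpace X] [StandardBorelSpace X] (μ : Measure X)
    (θ : X → X) (hθ : Measurable θ) (hb : Function.Bijective θ) (T : ℕ → Set X)
    (hT : ∀ k, MeasurableSet (T k)) (hTd : Pairwise (Function.onFun Disjoint T))
    (hTu : ⋃ k, T k = Set.univ)
    (hp : ∀ k, ∀ s ⊆ T k, MeasurableSet s → μ (θ '' s) = μ s) : MeasurePreserving θ μ μ := by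
  refine ⟨hθ, ?_⟩
  ext S hS
  rw [Measure.map_apply hθ hS]
  set s := θ ⁻¹' S with hs
  have hsm : MeasurableSet s := hθ hS
  have e1 : s = ⋃ k, s ∩ T k := by rw [← Set.inter_iUnion, hTu, Set.inter_univ]
  have e2 : S = ⋃ k, θ '' (s ∩ T k) := by
    rw [← Set.image_iUnion, ← e1, hs, Set.image_preimage_eq _ hb.2]
  have hd : Pairwise (Function.onFun Disjoint fun k => s ∩ T k) := fun i j hij =>
    (hTd hij).mono Set.inter_subset_right Set.inter_subset_right
  have hm : ∀ k, MeasurableSet (s ∩ T k) := fun k => hsm.inter (hT k)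
  conv_lhs => rw [e1]
  conv_rhs => rw [e2]
  rw [measure_iUnion hd hm, measure_iUnion]
  · exact tsum_congr fun k => (hp k _ Set.inter_subset_right (hm k)).symm
  · intro i j hij
    exact (Set.disjoint_image_iff hb.1).2 (hd hij)
  · exact fun k => (hm k).image_of_measurable_injOn hθ hb.1.injOn

lemma closeUp_mp {X : Type*} [MeasurableSpace X] [StandardBorelSpace X] (μ : Measure X)
    (g h : X → X) (D R : Set X) (hgm : Measurable g)
    (hhm : Measurable h) (hD : MeasurableSet D) (hR : MeasurableSet R)
    (hg : ∀ x ∈ D, g x ∈ R ∧ h (g x) = x) (hh : ∀ x ∈ R, h x ∈ D ∧ g (h x) = x)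
    (hgp : ∀ s ⊆ D, MeasurableSet s → μ (g '' s) = μ s)
    (hhp : ∀ s ⊆ R, MeasurableSet s → μ (h '' s) = μ s) :
    MeasurePreserving (closeUp g h D R) μ μ := by
  set B := Bad g h D R with hB
  have hBm : MeasurableSet B := Bad_meas g h D R hgm hhm hD hR
  -- index of the piece containing a point
  let p : X → ℕ := fun x => if x ∈ B then 0 else if x ∈ D then 1 else exitT h R x + 2
  have hhinj : Set.InjOn h R := fun x hx y hy e => by
    rw [← (hh x hx).2, ← (hh y hy).2, e]
  have hexm : Measurable (exitT h R) := by
    refine measurable_find (p := fun x k => h^[k] x ∉ R ∨ x ∈ FI h R) (FI_ex h R) fun k => ?_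
    exact (hhm.iterate k hR).compl.union (FI_meas h R hhm hR)
  have hpm : Measurable p := Measurable.ite hBm measurable_const
    (Measurable.ite hD measurable_const (hexm.add_const 2))
  refine mp_of_pieces μ _ (closeUp_meas g h D R hgm hhm hD hR)
    (Function.bijective_iff_has_inverse.2 ⟨closeUp h g R D, closeUp_inv g h D R hg hh,
      closeUp_inv h g R D hh hg⟩) (fun k => p ⁻¹' {k}) (fun k => hpm (measurableSet_singleton k))
    ?_ ?_ ?_
  · intro i j hij
    refine Set.disjoint_left.2 fun x hx hx' => hij ?_
    exact (show p x = i from hx).symm.trans hx'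
  · ext x; simp
  · intro k s hs hsm
    match k, hs with
    | 0, hs =>
      have : ∀ x ∈ s, closeUp g h D R x = x := by
        intro x hx
        have hpx : p x = 0 := hs hx
        by_cases h1 : x ∈ B
        · simp only [closeUp, ← hB, h1, if_true]
        · by_cases h2 : x ∈ D <;> simp [p, h1, h2] at hpx
      rw [Set.image_congr this, Set.image_id']
    | 1, hs =>
      have : ∀ x ∈ s, closeUp g h D R x = g x ∧ x ∈ D := by
        intro x hx
        have hpx : p x = 1 := hs hx
        by_cases h1 : x ∈ B
        · simp [p, h1] at hpx
        · by_cases h2 : x ∈ D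
          · simp [closeUp, ← hB, h1, h2]
          · simp [p, h1, h2] at hpx
      rw [Set.image_congr fun x hx => (this x hx).1]
      exact hgp s (fun x hx => (this x hx).2) hsm
    | k + 2, hs =>
      have : ∀ x ∈ s, closeUp g h D R x = h^[k] x ∧ exitT h R x = k := by
        intro x hx
        have hpx : p x = k + 2 := hs hx
        by_cases h1 : x ∈ B
        · simp [p, h1] at hpx
        · by_cases h2 : x ∈ D
          · simp [p, h1, h2] at hpx
          · have h3 : exitT h R x = k := by simpa [p, h1, h2] using hpx
            simp [closeUp, ← hB, h1, h2, h3]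
      rw [Set.image_congr fun x hx => (this x hx).1]
      refine (image_iter μ h R hhm hhinj hhp k s hsm ?_).2
      intro x hx i hi
      exact exitT_lt h R x i (by rw [(this x hx).2]; exact hi)

lemma half_null {X : Type*} [MeasurableSpace X] (μ : Measure X) [IsFiniteMeasure μ]
    (g h : X → X) (D R : Set X) (hgm : Measurable g)
    (hhm : Measurable h) (hD : MeasurableSet D) (hR : MeasurableSet R)
    (hg : ∀ x ∈ D, g x ∈ R ∧ h (g x) = x) (hh : ∀ x ∈ R, h x ∈ D ∧ g (h x) = x)
    (hgp : ∀ s ⊆ D, MeasurableSet s → μ (g '' s) = μ s) :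
    μ (FI g D \ FI h R) = 0 := by
  let W : ℕ → Set X := fun k => {x | ∀ i < k, h^[i] x ∈ R}
  have hWm : ∀ k, MeasurableSet (W k) := by
    intro k
    have : W k = ⋂ i, ⋂ (_ : i < k), h^[i] ⁻¹' R := by ext x; simp [W]
    rw [this]
    exact MeasurableSet.iInter fun i => MeasurableSet.iInter fun _ => hhm.iterate i hR
  have hFm := FI_meas g D hgm hD
  have himg : ∀ k, g '' (FI g D ∩ W k) = FI g D ∩ W (k + 1) := by
    intro k
    ext y
    constructor
    · rintro ⟨x, ⟨hx, hw⟩, rfl⟩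
      have hxD : x ∈ D := hx 0
      refine ⟨(FI_step g D x hxD).2 hx, fun i hi => ?_⟩
      cases i with
      | zero => exact (hg x hxD).1
      | succ i => rw [Function.iterate_succ_apply, (hg x hxD).2]; exact hw i (by omega)
    · rintro ⟨hy, hw⟩
      have hyR : y ∈ R := hw 0 (by omega)
      refine ⟨h y, ⟨?_, ?_⟩, (hh y hyR).2⟩
      · rw [← FI_step g D _ (hh y hyR).1, (hh y hyR).2]; exact hy
      · intro i hi
        rw [← Function.iterate_succ_apply]; exact hw (i + 1) (by omega)
  have hmeas : ∀ k, μ (FI g D ∩ W k) = μ (FI g D) := by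
    intro k
    induction k with
    | zero => congr 1; ext x; simp [W]
    | succ k ih =>
      rw [← himg, hgp _ (fun x hx => hx.1 0) (hFm.inter (hWm k)), ih]
  have hsub : FI g D \ FI h R ⊆ ⋃ k, FI g D \ W k := by
    rintro x ⟨hx, hx'⟩
    by_contra hcon
    refine hx' fun k => ?_
    by_contra hk
    exact hcon (Set.mem_iUnion.2 ⟨k + 1, hx, fun hw => hk (hw k (by omega))⟩)
  refine measure_mono_null hsub (measure_iUnion_null fun k => ?_)
  rw [← Set.sdiff_inter_self_eq_sdiff, Set.inter_comm,
    measure_sdiff Set.inter_subset_left (hFm.inter (hWm k)).nullMeasurableSet (measure_ne_top _ _),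
    hmeas k, tsub_self]

lemma extend_partial {X : Type*} [MeasurableSpace X] [StandardBorelSpace X]
    (μ : Measure X) [IsFiniteMeasure μ]
    (E : Set (X × X)) (hE : Equivalence fun x y => (x, y) ∈ E)
    (g : X → X) (D : Set X) (hgm : Measurable g) (hD : MeasurableSet D)
    (hinj : Set.InjOn g D) (hgE : ∀ x ∈ D, (x, g x) ∈ E)
    (hgp : ∀ s ⊆ D, MeasurableSet s → μ (g '' s) = μ s) :
    ∃ θ θinv : X → X, (Measurable θ ∧ Measurable θinv ∧
        (∀ x, θinv (θ x) = x ∧ θ (θinv x) = x) ∧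
        MeasurePreserving θ μ μ ∧
        (∀ᵐ x ∂μ, (x, θ x) ∈ E)) ∧ ∀ᵐ x ∂μ, x ∈ D → θ x = g x := by
  set R := g '' D with hRdef
  have hR : MeasurableSet R := hD.image_of_measurable_injOn hgm hinj
  let h : X → X := fun y => if hy : y ∈ R then hy.choose else y
  have hh : ∀ x ∈ R, h x ∈ D ∧ g (h x) = x := by
    intro x hx
    have : h x = hx.choose := dif_pos hx
    rw [this]
    exact hx.choose_spec
  have hg : ∀ x ∈ D, g x ∈ R ∧ h (g x) = x := by
    intro x hx
    have h1 : g x ∈ R := ⟨x, hx, rfl⟩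
    exact ⟨h1, hinj (hh _ h1).1 hx (hh _ h1).2⟩
  have himg : ∀ S, h ⁻¹' S ∩ R = g '' (D ∩ S) := by
    intro S
    ext y
    constructor
    · rintro ⟨h1, h2⟩
      exact ⟨h y, ⟨(hh y h2).1, h1⟩, (hh y h2).2⟩
    · rintro ⟨x, ⟨h1, h2⟩, rfl⟩
      refine ⟨?_, (hg x h1).1⟩
      show h (g x) ∈ S
      rw [(hg x h1).2]; exact h2
  have hhm : Measurable h := by
    intro S hS
    have : h ⁻¹' S = g '' (D ∩ S) ∪ (S \ R) := by
      rw [← himg]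
      ext y
      by_cases hy : y ∈ R
      · simp [hy]
      · simp [hy, h]
    rw [this]
    exact ((hD.inter hS).image_of_measurable_injOn hgm (hinj.mono Set.inter_subset_left)).union
      (hS.diff hR)
  have hhinj : Set.InjOn h R := fun x hx y hy e => by
    rw [← (hh x hx).2, ← (hh y hy).2, e]
  have hhp : ∀ s ⊆ R, MeasurableSet s → μ (h '' s) = μ s := by
    intro s hs hsm
    have h1 : h '' s ⊆ D := by
      rintro _ ⟨x, hx, rfl⟩
      exact (hh x (hs hx)).1
    rw [← hgp _ h1 (hsm.image_of_measurable_injOn hhm (hhinj.mono hs)), Set.image_image,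
      Set.image_congr fun x hx => (hh x (hs hx)).2, Set.image_id']
  refine ⟨closeUp g h D R, closeUp h g R D, ⟨closeUp_meas g h D R hgm hhm hD hR,
    closeUp_meas h g R D hhm hgm hR hD,
    fun x => ⟨closeUp_inv g h D R hg hh x, closeUp_inv h g R D hh hg x⟩,
    closeUp_mp μ g h D R hgm hhm hD hR hg hh hgp hhp,
    Filter.Eventually.of_forall (closeUp_E E hE g h D R hgE ?_)⟩, ?_⟩
  · intro y hy
    have := hgE _ (hh y hy).1
    rw [(hh y hy).2] at this
    exact hE.symm this
  · have hB : μ (Bad g h D R) = 0 := by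
      refine measure_mono_null (t := (FI g D \ FI h R) ∪ (FI h R \ FI g D)) ?_
        (measure_union_null (half_null μ g h D R hgm hhm hD hR hg hh hgp)
          (half_null μ h g R D hhm hgm hR hD hh hg hhp))
      intro x hx
      have hx' : ¬ (x ∈ FI g D ↔ x ∈ FI h R) := hx
      simp only [Set.mem_union, Set.mem_sdiff]
      tauto
    filter_upwards [measure_eq_zero_iff_ae_notMem.1 hB] with x hx hxD
    simp [closeUp, hx, hxD]

lemma color_partial {X : Type*} [MeasurableSpace X] [StandardBorelSpace X]
    (μ : Measure X) (E : Set (X × X)) {m n : ℕ} (A : Fin m → Set X) (f : Fin m → X → X)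
    (hiso : ∀ i, IsPartialIso μ E (A i) (f i))
    (C : Fin m → Fin n → Set X) (hC : GoodCol A f C) (j : Fin n) :
    ∃ g : X → X, Measurable g ∧ MeasurableSet (⋃ i, C i j) ∧ Set.InjOn g (⋃ i, C i j) ∧
      (∀ x ∈ ⋃ i, C i j, (x, g x) ∈ E) ∧
      (∀ s ⊆ ⋃ i, C i j, MeasurableSet s → μ (g '' s) = μ s) ∧
      ∀ i, ∀ x ∈ C i j, g x = f i x := by
  obtain ⟨hm, hsub, hd1, hd2, hd3⟩ := hC
  let g : X → X := fun x => if hx : ∃ i, x ∈ C i j then f hx.choose x else x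
  have hgf : ∀ i, ∀ x ∈ C i j, g x = f i x := by
    intro i x hx
    have h : ∃ i, x ∈ C i j := ⟨i, hx⟩
    have h1 : g x = f h.choose x := dif_pos h
    rw [h1, hd2 _ _ _ _ h.choose_spec hx]
  have hDm : MeasurableSet (⋃ i, C i j) := MeasurableSet.iUnion fun i => hm i j
  have hgm : Measurable g := by
    intro S hS
    have : g ⁻¹' S = (⋃ i, C i j ∩ f i ⁻¹' S) ∪ (S \ ⋃ i, C i j) := by
      ext x
      by_cases hx : ∃ i, x ∈ C i j
      · obtain ⟨i, hi⟩ := hx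
        have h1 : x ∈ ⋃ i, C i j := Set.mem_iUnion.2 ⟨i, hi⟩
        constructor
        · intro h
          refine Or.inl (Set.mem_iUnion.2 ⟨i, hi, ?_⟩)
          show f i x ∈ S
          rw [← hgf i x hi]; exact h
        · rintro (h | h)
          · obtain ⟨i', h2, h3⟩ := Set.mem_iUnion.1 h
            show g x ∈ S
            rw [hgf i' x h2]; exact h3
          · exact absurd h1 h.2
      · have h1 : x ∉ ⋃ i, C i j := fun h => hx (Set.mem_iUnion.1 h)
        have h2 : g x = x := dif_neg hx
        constructor
        · intro h
          refine Or.inr ⟨?_, h1⟩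
          rw [← h2]; exact h
        · rintro (h | h)
          · obtain ⟨i', h2, h3⟩ := Set.mem_iUnion.1 h
            exact absurd ⟨i', h2⟩ hx
          · show g x ∈ S
            rw [h2]; exact h.1
    rw [this]
    exact (MeasurableSet.iUnion fun i => (hm i j).inter ((hiso i).2.1 hS)).union (hS.diff hDm)
  have hginj : Set.InjOn g (⋃ i, C i j) := by
    intro x hx y hy e
    obtain ⟨i, hi⟩ := Set.mem_iUnion.1 hx
    obtain ⟨i', hi'⟩ := Set.mem_iUnion.1 hy
    rw [hgf i x hi, hgf i' y hi'] at e
    exact (hd3 _ _ _ _ _ hi hi' e).2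
  refine ⟨g, hgm, hDm, hginj, ?_, ?_, hgf⟩
  · intro x hx
    obtain ⟨i, hi⟩ := Set.mem_iUnion.1 hx
    rw [hgf i x hi]
    exact (hiso i).2.2.2.2.1 x (hsub _ _ hi)
  · intro s hs hsm
    have e1 : s = ⋃ i, s ∩ C i j := by
      rw [← Set.inter_iUnion]; exact (Set.inter_eq_left.2 hs).symm
    have hmm : ∀ i, MeasurableSet (s ∩ C i j) := fun i => hsm.inter (hm i j)
    have hdis : Pairwise (Function.onFun Disjoint fun i => s ∩ C i j) := by
      intro i i' hii
      refine Set.disjoint_left.2 fun x hx hx' => hii ?_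
      exact hd2 _ _ _ _ hx.2 hx'.2
    have hsubD : ∀ i, s ∩ C i j ⊆ ⋃ i, C i j := fun i => Set.inter_subset_left.trans hs
    conv_lhs => rw [e1]
    conv_rhs => rw [e1]
    rw [Set.image_iUnion, measure_iUnion hdis hmm, measure_iUnion]
    · refine tsum_congr fun i => ?_
      rw [Set.image_congr fun x (hx : x ∈ s ∩ C i j) => hgf i x hx.2]
      exact (hiso i).2.2.2.2.2 _ (Set.inter_subset_right.trans (hsub i j)) (hmm i)
    · intro i i' hii
      refine Set.disjoint_left.2 ?_
      rintro _ ⟨x, hx, rfl⟩ ⟨y, hy, e⟩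
      have := hginj (hsubD i' hy) (hsubD i hx) e
      subst this
      exact Set.disjoint_left.1 (hdis hii) hx hy
    · exact fun i => (hmm i).image_of_measurable_injOn hgm (hginj.mono (hsubD i))

lemma pointwise_bound {X : Type*} [MeasurableSpace X] {m n : ℕ} (A : Fin m → Set X)
    (f : Fin m → X → X) (C : Fin m → Fin n → Set X) (hC : GoodCol A f C) (θ : Fin n → X → X)
    (x : X) (hrow : ∑ i : Fin m, (A i).indicator (fun _ => (1 : ℝ≥0∞)) x = (n : ℝ≥0∞))
    (hθ : ∀ i j, x ∈ C i j → θ j x = f i x) :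
    ∑' y : X, ((((∑ i : Fin m, if x ∈ A i ∧ f i x = y then 1 else 0 : ℕ) : ℤ) -
            ((∑ j : Fin n, if θ j x = y then 1 else 0 : ℕ) : ℤ)).natAbs : ℝ≥0∞) ≤
      2 * ∑ i, (A i \ ⋃ j, C i j).indicator (fun _ => (1 : ℝ≥0∞)) x := by
  obtain ⟨hm, hsub, hd1, hd2, hd3⟩ := hC
  have hA : ∀ i, (if x ∈ A i then 1 else 0 : ℕ) =
      (if x ∈ A i \ ⋃ j, C i j then 1 else 0) + ∑ j, if x ∈ C i j then 1 else 0 := by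
    intro i
    by_cases h : ∃ j, x ∈ C i j
    · obtain ⟨j, hj⟩ := h
      rw [if_pos (hsub i j hj), if_neg (fun h => h.2 (Set.mem_iUnion.2 ⟨j, hj⟩)),
        Finset.sum_eq_single j, if_pos hj]
      · intro j' _ hne
        exact if_neg fun h => hne (hd1 _ _ _ _ h hj)
      · simp
    · push Not at h
      simp [h]
  have hD : ∀ j, (1 : ℕ) =
      (if ∀ i, x ∉ C i j then 1 else 0) + ∑ i, if x ∈ C i j then 1 else 0 := by
    intro j
    by_cases h : ∃ i, x ∈ C i j
    · obtain ⟨i, hi⟩ := h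
      rw [if_neg (fun h => h i hi), Finset.sum_eq_single i, if_pos hi]
      · intro i' _ hne
        exact if_neg fun h => hne (hd2 _ _ _ _ h hi)
      · simp
    · push Not at h
      simp [h]
  have hcard := card_of_ind A x hrow
  rw [Finset.card_filter] at hcard
  have hcount : (∑ i, if x ∈ A i \ ⋃ j, C i j then 1 else 0 : ℕ) =
      ∑ j, if ∀ i, x ∉ C i j then 1 else 0 := by
    have h1 : n = ∑ j : Fin n, 1 := by simp
    rw [Finset.sum_congr rfl fun i _ => hA i, Finset.sum_add_distrib] at hcard
    rw [Finset.sum_congr rfl fun j _ => hD j, Finset.sum_add_distrib, Finset.sum_comm] at h1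
    omega
  have hy : ∀ y, (((∑ i : Fin m, if x ∈ A i ∧ f i x = y then 1 else 0 : ℕ) : ℤ) -
            ((∑ j : Fin n, if θ j x = y then 1 else 0 : ℕ) : ℤ)).natAbs ≤
      (∑ i, if f i x = y then (if x ∈ A i \ ⋃ j, C i j then 1 else 0) else 0) +
      ∑ j, if θ j x = y then (if ∀ i, x ∉ C i j then 1 else 0) else 0 := by
    intro y
    have e1 : (∑ i : Fin m, if x ∈ A i ∧ f i x = y then 1 else 0 : ℕ) =
        (∑ i, if f i x = y then (if x ∈ A i \ ⋃ j, C i j then 1 else 0) else 0) +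
        ∑ i, ∑ j, if x ∈ C i j ∧ f i x = y then 1 else 0 := by
      rw [← Finset.sum_add_distrib]
      refine Finset.sum_congr rfl fun i _ => ?_
      by_cases h : f i x = y
      · simpa only [h, and_true, if_true] using hA i
      · simp [h]
    have e2 : (∑ j : Fin n, if θ j x = y then 1 else 0 : ℕ) =
        (∑ j, if θ j x = y then (if ∀ i, x ∉ C i j then 1 else 0) else 0) +
        ∑ i, ∑ j, if x ∈ C i j ∧ f i x = y then 1 else 0 := by
      rw [Finset.sum_comm, ← Finset.sum_add_distrib]
      refine Finset.sum_congr rfl fun j _ => ?_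
      have e3 : ∀ i, (if x ∈ C i j ∧ f i x = y then 1 else 0 : ℕ) =
          if x ∈ C i j ∧ θ j x = y then 1 else 0 := by
        intro i
        by_cases h : x ∈ C i j
        · rw [hθ i j h]
        · simp [h]
      rw [Finset.sum_congr rfl fun i _ => e3 i]
      by_cases h : θ j x = y
      · simpa only [h, and_true, if_true] using hD j
      · simp [h]
    rw [e1, e2]
    omega
  calc _ ≤ ∑' y : X, ((∑ i, if f i x = y then
            (if x ∈ A i \ ⋃ j, C i j then (1 : ℝ≥0∞) else 0) else 0) +
          ∑ j, if θ j x = y then (if ∀ i, x ∉ C i j then (1 : ℝ≥0∞) else 0) else 0) := by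
        refine ENNReal.tsum_le_tsum fun y => ?_
        refine (Nat.cast_le (α := ℝ≥0∞).2 (hy y)).trans (le_of_eq ?_)
        push_cast
        rfl
    _ = (∑ i, if x ∈ A i \ ⋃ j, C i j then (1 : ℝ≥0∞) else 0) +
          ∑ j, if ∀ i, x ∉ C i j then (1 : ℝ≥0∞) else 0 := by
        rw [ENNReal.tsum_add, Summable.tsum_finsetSum fun _ _ => ENNReal.summable,
          Summable.tsum_finsetSum fun _ _ => ENNReal.summable]
        simp only [tsum_ite_eq']
    _ = _ := by
        have h2 : (∑ j, if ∀ i, x ∉ C i j then (1 : ℝ≥0∞) else 0) =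
            ∑ i, if x ∈ A i \ ⋃ j, C i j then (1 : ℝ≥0∞) else 0 := by
          have := congrArg (Nat.cast : ℕ → ℝ≥0∞) hcount
          push_cast at this
          exact this.symm
        rw [h2, two_mul]
        simp only [Set.indicator_apply]

/-- every doubly stochastic element is almost decomposable: for any DSE
`Φ = {φ_i : A_i → B_i}` of multiplicity `n` and any `ε > 0` there exist `n` full-group
elements `θ_1, …, θ_n ∈ [E]` such that
`d(Φ, Ψ) = ∫_E |M(Φ) − ∑_j χ(graph θ_j)| dν < ε`, where `ν` is the counting measure. -/
theorem DSE_almost_decomposable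
    {X : Type*} [MeasurableSpace X] [StandardBorelSpace X]
    (μ : Measure X) [IsProbabilityMeasure μ]
    (E : Set (X × X)) (hE : Equivalence fun x y => (x, y) ∈ E)
    (hcnt : ∀ x, {y | (x, y) ∈ E}.Countable)
    (m n : ℕ) (hn : 1 ≤ n) (A : Fin m → Set X) (f : Fin m → X → X)
    (hiso : ∀ i, IsPartialIso μ E (A i) (f i))
    (hrow : ∀ᵐ x ∂μ, ∑ i : Fin m, (A i).indicator (fun _ => (1 : ℝ≥0∞)) x = (n : ℝ≥0∞))
    (hcol : ∀ᵐ y ∂μ, ∑ i : Fin m,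
      (f i '' A i).indicator (fun _ => (1 : ℝ≥0∞)) y = (n : ℝ≥0∞))
    (ε : ℝ≥0∞) (hε : 0 < ε) :
    ∃ θ θinv : Fin n → X → X,
      (∀ j, Measurable (θ j) ∧ Measurable (θinv j) ∧
        (∀ x, θinv j (θ j x) = x ∧ θ j (θinv j x) = x) ∧
        MeasurePreserving (θ j) μ μ ∧
        (∀ᵐ x ∂μ, (x, θ j x) ∈ E)) ∧
      (∫⁻ x, ∑' y : X,
          ((((∑ i : Fin m, if x ∈ A i ∧ f i x = y then 1 else 0 : ℕ) : ℤ) -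
            ((∑ j : Fin n, if θ j x = y then 1 else 0 : ℕ) : ℤ)).natAbs : ℝ≥0∞) ∂μ) < ε := by

  have hA : ∀ i, MeasurableSet (A i) := fun i => (hiso i).1
  have hf : ∀ i, Measurable (f i) := fun i => (hiso i).2.1
  have hinj : ∀ i, Set.InjOn (f i) (A i) := fun i => (hiso i).2.2.1
  have hpres : ∀ i, ∀ s ⊆ A i, MeasurableSet s → μ (f i '' s) = μ s :=
    fun i => (hiso i).2.2.2.2.2
  obtain ⟨C, hC, hCε⟩ := exists_coloring (n := n) μ A f hA hf hinj hpres hrow hcol (ε / 2)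
    (ENNReal.half_pos hε.ne')
  choose g hgm hDm hginj hgE hgp hgf using fun j => color_partial μ E A f hiso C hC j
  choose θ θinv hθ hθg using fun j =>
    extend_partial μ E hE (g j) (⋃ i, C i j) (hgm j) (hDm j) (hginj j) (hgE j) (hgp j)
  refine ⟨θ, θinv, hθ, ?_⟩
  have hm : ∀ i, MeasurableSet (A i \ ⋃ j, C i j) := fun i =>
    (hA i).diff (MeasurableSet.iUnion fun j => hC.1 i j)
  have hae : ∀ᵐ x ∂μ, ∀ j, x ∈ (⋃ i, C i j) → θ j x = g j x := ae_all_iff.2 hθg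
  calc _ ≤ ∫⁻ x, 2 * ∑ i, (A i \ ⋃ j, C i j).indicator (fun _ => (1 : ℝ≥0∞)) x ∂μ := by
        refine lintegral_mono_ae ?_
        filter_upwards [hrow, hae] with x h1 h2
        refine pointwise_bound A f C hC θ x h1 fun i j hx => ?_
        rw [h2 j (Set.mem_iUnion.2 ⟨i, hx⟩), hgf j i x hx]
    _ = 2 * uncov μ A C := by
        rw [lintegral_const_mul' _ _ (by simp), lintegral_finsetSum]
        · simp only [uncov]
          congr 1
          refine Finset.sum_congr rfl fun i _ => ?_
          rw [lintegral_indicator (hm i)]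
          simp
        · exact fun i _ => measurable_const.indicator (hm i)
    _ < ε := by
        rw [mul_comm]
        exact (ENNReal.lt_div_iff_mul_lt (Or.inl (by simp)) (Or.inl (by simp))).1 hCε
end

section
/- Let G be a measure-preserving 2n-regular countable Borel graph on a standard probability space (X,μ) and ε > 0. Then there exists a measure-preserving partial isomorphism θ : A → B with graph(θ) ⊆ G and μ(A) > 1 − ε. -/
open MeasureTheory
open scoped ENNReal

open ProbabilityTheory in
theorem null_of_image_null {X : Type*} [MeasurableSpace X] [StandardBorelSpace X]
    (μ : Measure X) [IsProbabilityMeasure μ]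
    (f : X → X) (hf : Measurable f) (S : Set X) (hS : MeasurableSet S)
    (hcnt : ∀ y, {x | x ∈ S ∧ f x = y}.Countable)
    (h : ∀ B ⊆ S, MeasurableSet B → Set.InjOn f B → μ B = 0) : μ S = 0 := by
  classical
  have : Nonempty X := nonempty_of_isProbabilityMeasure μ
  set ν := μ.restrict S with hν
  set κ := ProbabilityTheory.condDistrib (fun x : X => x) f ν with hκ
  have hdis : (ν.map f) ⊗ₘ κ = ν.map (fun x => (f x, x)) :=
    ProbabilityTheory.compProd_map_condDistrib aemeasurable_id'
  have hgm : Measurable (fun x : X => (f x, x)) := hf.prodMk measurable_id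
  have ham : Measurable (fun p : X × X => κ p.1 {p.2}) := by
    have hdiag : MeasurableSet {q : (X × X) × X | q.2 = q.1.2} :=
      measurableSet_eq_fun measurable_snd (measurable_snd.comp measurable_fst)
    have := ProbabilityTheory.Kernel.measurable_kernel_prodMk_left
      (κ := κ.comap (Prod.fst : X × X → X) measurable_fst) hdiag
    convert this using 2
    rw [Kernel.comap_apply]
    congr 1
  -- concentration
  have hconc : ∀ᵐ y ∂(ν.map f), κ y {x | x ∈ S ∧ f x = y}ᶜ = 0 := by
    have hm : MeasurableSet {p : X × X | ¬ (p.2 ∈ S ∧ f p.2 = p.1)} :=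
      ((measurable_snd hS).inter (measurableSet_eq_fun (hf.comp measurable_snd) measurable_fst)).compl
    have h0 : ((ν.map f) ⊗ₘ κ) {p : X × X | ¬ (p.2 ∈ S ∧ f p.2 = p.1)} = 0 := by
      rw [hdis, Measure.map_apply hgm hm]
      have : (fun x => (f x, x)) ⁻¹' {p : X × X | ¬ (p.2 ∈ S ∧ f p.2 = p.1)} = Sᶜ := by
        ext x; simp
      rw [this, hν, Measure.restrict_apply hS.compl]; simp
    rw [Measure.compProd_apply hm,
      lintegral_eq_zero_iff (ProbabilityTheory.Kernel.measurable_kernel_prodMk_left hm)] at h0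
    exact h0
  have hpos : ∀ᵐ x ∂ν, κ (f x) {x} ≠ 0 := by
    have hm : MeasurableSet {p : X × X | κ p.1 {p.2} = 0} := ham (measurableSet_singleton 0)
    have h0 : ((ν.map f) ⊗ₘ κ) {p : X × X | κ p.1 {p.2} = 0} = 0 := by
      rw [Measure.compProd_apply hm,
        lintegral_eq_zero_iff (ProbabilityTheory.Kernel.measurable_kernel_prodMk_left hm)]
      filter_upwards [hconc] with y hy
      have h1 : κ y ({x | x ∈ S ∧ f x = y} ∩ {x | κ y {x} = 0}) = 0 := by
        rw [← Set.biUnion_of_singleton ({x | x ∈ S ∧ f x = y} ∩ {x | κ y {x} = 0})]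
        rw [measure_biUnion_null_iff ((hcnt y).mono Set.inter_subset_left)]
        intro x hx; exact hx.2
      refine measure_mono_null ?_ (measure_union_null hy h1)
      intro x hx
      by_cases hxs : x ∈ S ∧ f x = y
      · exact Or.inr ⟨hxs, hx⟩
      · exact Or.inl hxs
    rw [hdis, Measure.map_apply hgm hm] at h0
    rw [ae_iff]
    simpa using h0
  let e := embeddingReal X
  have he : MeasurableEmbedding e := measurableEmbedding_embeddingReal X
  let B : Set ℝ → Set X := fun U => {x | x ∈ S ∧ e x ∈ U ∧ κ (f x) (e ⁻¹' U) < 2 * κ (f x) {x}}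
  have hcover : ∀ᵐ x ∂ν, x ∈ ⋃ U ∈ TopologicalSpace.countableBasis ℝ, B U := by
    filter_upwards [hpos, ae_restrict_mem hS] with x hx hxS
    have hlt : ((κ (f x)).map e) {e x} < 2 * κ (f x) {x} := by
      rw [he.map_apply, ← Set.image_singleton, he.injective.preimage_image]
      have := measure_ne_top (κ (f x)) {x}
      rw [two_mul]
      exact ENNReal.lt_add_right this hx
    obtain ⟨V, hV, hVo, hVl⟩ := Set.exists_isOpen_lt_of_lt _ _ hlt
    obtain ⟨U, hU, hxU, hUV⟩ := (TopologicalSpace.isBasis_countableBasis ℝ).exists_subset_of_mem_open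
      (hV rfl) hVo
    simp only [Set.mem_iUnion]
    refine ⟨U, hU, hxS, hxU, lt_of_le_of_lt ?_ hVl⟩
    rw [he.map_apply]
    exact measure_mono (Set.preimage_mono hUV)
  have hB0 : ∀ U ∈ TopologicalSpace.countableBasis ℝ, μ (B U) = 0 := by
    intro U hU
    have hUm : MeasurableSet (e ⁻¹' U) :=
      he.measurable (TopologicalSpace.isOpen_of_mem_countableBasis hU).measurableSet
    refine h _ (fun x hx => hx.1) ?_ ?_
    · have h1 : Measurable (fun x => κ (f x) (e ⁻¹' U)) := (κ.measurable_coe hUm).comp hf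
      have h2 : Measurable (fun x => 2 * κ (f x) {x}) := (ham.comp hgm).const_mul 2
      exact hS.inter (hUm.inter (measurableSet_lt h1 h2))
    · rintro x ⟨hxS, hxU, hx⟩ x' ⟨hxS', hxU', hx'⟩ hxx
      by_contra hne
      have h1 : κ (f x) {x} + κ (f x) {x'} ≤ κ (f x) (e ⁻¹' U) := by
        rw [← measure_union (by simpa using hne) (measurableSet_singleton _)]
        apply measure_mono
        rintro z (rfl | rfl)
        · exact hxU
        · exact hxU'
      rw [← hxx] at hx'
      have h2 := ENNReal.add_lt_add hx hx'
      rw [← mul_add, two_mul] at h2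
      exact absurd h2 (not_lt.2 (add_le_add h1 h1))
  have h1 : μ (⋃ U ∈ TopologicalSpace.countableBasis ℝ, B U) = 0 :=
    (measure_biUnion_null_iff (TopologicalSpace.countable_countableBasis ℝ)).2 hB0
  rw [hν, ae_restrict_iff' hS] at hcover
  refine measure_mono_null (t := _ ∪ {x | ¬ (x ∈ S → x ∈ ⋃ U ∈ TopologicalSpace.countableBasis ℝ, B U)})
    ?_ (measure_union_null h1 hcover)
  intro x hx
  by_cases hh : x ∈ ⋃ U ∈ TopologicalSpace.countableBasis ℝ, B U
  · exact Or.inl hh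
  · exact Or.inr (fun h => hh (h hx))

/-- the set of points of `X0` with at least `k` neighbours in `U` is analytic, hence (by regularity) Borel -/
theorem measurableSet_count {X : Type*} [MeasurableSpace X] [StandardBorelSpace X]
    (G : Set (X × X)) (hG : MeasurableSet G) (d : ℕ) (X0 : Set X) (hX0 : MeasurableSet X0)
    (hreg : ∀ x ∈ X0, ({y | (x, y) ∈ G}).encard = d) (U : Set X) (hU : MeasurableSet U) (k : ℕ) :
    MeasurableSet {x | x ∈ X0 ∧ (k : ℕ∞) ≤ ({y | (x, y) ∈ G} ∩ U).encard} := by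
  classical
  let := upgradeStandardBorel X
  have key : ∀ (V : Set X) (l : ℕ), MeasurableSet V →
      AnalyticSet {x | x ∈ X0 ∧ (l : ℕ∞) ≤ ({y | (x, y) ∈ G} ∩ V).encard} := by
    intro V l hV
    let T : Set (X × (Fin l → X)) := {p | p.1 ∈ X0 ∧ (∀ i, (p.1, p.2 i) ∈ G) ∧ (∀ i, p.2 i ∈ V) ∧
      ∀ i j, i ≠ j → p.2 i ≠ p.2 j}
    have hT : MeasurableSet T := by
      have hev : ∀ i : Fin l, Measurable (fun p : X × (Fin l → X) => p.2 i) := fun i =>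
        (measurable_pi_apply i).comp measurable_snd
      refine (measurable_fst hX0).inter (MeasurableSet.inter ?_ (MeasurableSet.inter ?_ ?_))
      · change MeasurableSet {p : X × (Fin l → X) | ∀ i, (p.1, p.2 i) ∈ G}
        rw [Set.ofPred_forall]
        exact MeasurableSet.iInter fun i => (measurable_fst.prodMk (hev i)) hG
      · change MeasurableSet {p : X × (Fin l → X) | ∀ i, p.2 i ∈ V}
        rw [Set.ofPred_forall]
        exact MeasurableSet.iInter fun i => (hev i) hV
      · change MeasurableSet {p : X × (Fin l → X) | ∀ i j, i ≠ j → p.2 i ≠ p.2 j}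
        simp only [Set.ofPred_forall]
        refine MeasurableSet.iInter fun i => MeasurableSet.iInter fun j => MeasurableSet.iInter fun _ => ?_
        exact (measurableSet_eq_fun (hev i) (hev j)).compl
    have : {x | x ∈ X0 ∧ (l : ℕ∞) ≤ ({y | (x, y) ∈ G} ∩ V).encard} = Prod.fst '' T := by
      ext x
      constructor
      · rintro ⟨hx, hl⟩
        obtain ⟨t, ht, htc⟩ := Set.exists_subset_encard_eq hl
        have hfin : t.Finite := Set.finite_of_encard_eq_coe htc
        have hcard : hfin.toFinset.card = l := by
          rw [hfin.encard_eq_coe_toFinset_card] at htc; exact_mod_cast htc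
        let g := hfin.toFinset.equivFinOfCardEq hcard
        have hg : ∀ i, (g.symm i : X) ∈ t := fun i => hfin.mem_toFinset.1 (g.symm i).2
        refine ⟨(x, fun i => (g.symm i : X)), ⟨hx, fun i => (ht (hg i)).1, fun i => (ht (hg i)).2, ?_⟩, rfl⟩
        intro i j hij h
        exact hij (g.symm.injective (Subtype.ext h))
      · rintro ⟨⟨x', v⟩, ⟨h1, h2, h3, h4⟩, rfl⟩
        refine ⟨h1, ?_⟩
        have hinj : Function.Injective v := fun i j hij => by
          by_contra hne; exact h4 i j hne hij
        calc (l : ℕ∞) = (Set.range v).encard := by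
              rw [← Set.image_univ, hinj.encard_image]; simp
          _ ≤ _ := Set.encard_le_encard (by rintro _ ⟨i, rfl⟩; exact ⟨h2 i, h3 i⟩)
    rw [this]
    exact hT.analyticSet_image measurable_fst
  by_cases hk : k ≤ d
  · refine AnalyticSet.measurableSet_of_compl (key U k hU) ?_
    have : {x | x ∈ X0 ∧ (k : ℕ∞) ≤ ({y | (x, y) ∈ G} ∩ U).encard}ᶜ =
        X0ᶜ ∪ {x | x ∈ X0 ∧ ((d - k + 1 : ℕ) : ℕ∞) ≤ ({y | (x, y) ∈ G} ∩ Uᶜ).encard} := by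
      ext x
      by_cases hx : x ∈ X0
      · have h1 := Set.encard_sdiff_add_encard_inter {y | (x, y) ∈ G} U
        rw [hreg x hx, Set.sdiff_eq] at h1
        have hf : ({y | (x, y) ∈ G}).Finite := Set.finite_of_encard_eq_coe (hreg x hx)
        have hf1 := hf.subset (Set.inter_subset_left (t := U))
        have hf2 := hf.subset (Set.inter_subset_left (t := Uᶜ))
        rw [hf1.encard_eq_coe_toFinset_card, hf2.encard_eq_coe_toFinset_card] at h1
        simp only [Set.mem_compl_iff, Set.mem_ofPred_eq, hx, true_and, Set.mem_union, not_true, false_or]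
        rw [hf1.encard_eq_coe_toFinset_card, hf2.encard_eq_coe_toFinset_card]
        norm_cast at h1 ⊢
        omega
      · simp [hx]
    rw [this]
    have h2 := hX0.compl.analyticSet
    rw [Set.union_eq_iUnion]
    apply AnalyticSet.iUnion
    rintro (_ | _)
    · exact key _ _ hU.compl
    · exact h2
  · convert MeasurableSet.empty
    ext x
    simp only [Set.mem_ofPred_eq, Set.mem_empty_iff_false, iff_false, not_and]
    intro hx h
    have := h.trans (Set.encard_le_encard Set.inter_subset_left)
    rw [hreg x hx] at this
    exact hk (by exact_mod_cast this)

theorem exists_enum {X : Type*} [MeasurableSpace X] [StandardBorelSpace X]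
    (G : Set (X × X)) (hG : MeasurableSet G) (d : ℕ) (X0 : Set X) (hX0 : MeasurableSet X0)
    (hreg : ∀ x ∈ X0, ({y | (x, y) ∈ G}).encard = d) :
    ∃ f : Fin d → X → X, (∀ i, Measurable (f i)) ∧
      (∀ x ∈ X0, Function.Injective (fun i => f i x)) ∧
      (∀ x ∈ X0, ∀ y, (x, y) ∈ G ↔ ∃ i, f i x = y) := by
  classical
  let e := embeddingReal X
  have he : MeasurableEmbedding e := measurableEmbedding_embeddingReal X
  have hpt : ∀ x ∈ X0, ∃ g : Fin d → X, StrictMono (fun i => e (g i)) ∧ Set.range g = {y | (x, y) ∈ G} := by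
    intro x hx
    have hfin : ({y | (x, y) ∈ G}).Finite := Set.finite_of_encard_eq_coe (hreg x hx)
    have hcard : (hfin.toFinset.map ⟨e, he.injective⟩).card = d := by
      rw [Finset.card_map]
      have := hreg x hx
      rw [hfin.encard_eq_coe_toFinset_card] at this; exact_mod_cast this
    let o := Finset.orderEmbOfFin _ hcard
    have ho : ∀ i, ∃ y, (x, y) ∈ G ∧ e y = o i := by
      intro i
      have := Finset.orderEmbOfFin_mem _ hcard i
      rw [Finset.mem_map] at this
      obtain ⟨y, hy, h⟩ := this
      exact ⟨y, by simpa using hy, h⟩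
    choose g hg hge using ho
    refine ⟨g, fun i j hij => by simpa only [hge] using o.strictMono hij, ?_⟩
    ext y
    constructor
    · rintro ⟨i, rfl⟩; exact hg i
    · intro hy
      have : e y ∈ Set.range o := by
        rw [Finset.range_orderEmbOfFin]; simpa using ⟨y, hy, rfl⟩
      obtain ⟨i, hi⟩ := this
      exact ⟨i, he.injective ((hge i).trans hi)⟩
  choose! g hg hgr using hpt
  refine ⟨fun i x => if x ∈ X0 then g x i else x, ?_, ?_, ?_⟩
  · intro i
    rw [← he.measurable_comp_iff]
    refine measurable_of_Iic fun r => ?_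
    have : (e ∘ fun x => if x ∈ X0 then g x i else x) ⁻¹' Set.Iic r =
      {x | x ∈ X0 ∧ ((i + 1 : ℕ) : ℕ∞) ≤ ({y | (x, y) ∈ G} ∩ e ⁻¹' Set.Iic r).encard} ∪
        (X0ᶜ ∩ e ⁻¹' Set.Iic r) := by
      ext x
      by_cases hx : x ∈ X0
      · simp only [Set.mem_preimage, Function.comp, hx, if_true, Set.mem_Iic, Set.mem_union,
          Set.mem_ofPred_eq, true_and, Set.mem_inter_iff, Set.mem_compl_iff, not_true, false_and, or_false]
        have hgi : Function.Injective (g x) := fun a b hab => (hg x hx).injective (by simp [hab])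
        have hset : {y | (x, y) ∈ G} ∩ e ⁻¹' Set.Iic r = g x '' {j | e (g x j) ≤ r} := by
          rw [← hgr x hx]; ext y; constructor
          · rintro ⟨⟨j, rfl⟩, h⟩; exact ⟨j, h, rfl⟩
          · rintro ⟨j, h, rfl⟩; exact ⟨⟨j, rfl⟩, h⟩
        rw [hset, hgi.encard_image]
        constructor
        · intro h
          calc ((i + 1 : ℕ) : ℕ∞) = (Set.Iic i).encard := by
                rw [← Finset.coe_Iic, Set.encard_coe_eq_coe_finsetCard, Fin.card_Iic]
            _ ≤ _ := Set.encard_le_encard fun j hj => ((hg x hx).monotone hj).trans h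
        · intro h
          by_contra hlt
          have : ({j | e (g x j) ≤ r} : Set (Fin d)).encard ≤ (Set.Iio i).encard := by
            refine Set.encard_le_encard fun j hj => ?_
            by_contra hij
            exact hlt (((hg x hx).monotone (not_lt.1 hij)).trans hj)
          rw [← Finset.coe_Iio, Set.encard_coe_eq_coe_finsetCard, Fin.card_Iio] at this
          have h' := h.trans this
          norm_cast at h'
          omega
      · simp [hx]
    rw [this]
    exact (measurableSet_count G hG d X0 hX0 hreg _ (he.measurable measurableSet_Iic) _).union
      (hX0.compl.inter (he.measurable measurableSet_Iic))
  · intro x hx i j hij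
    simp only [hx, if_true] at hij
    exact (hg x hx).injective (by simp [hij])
  · intro x hx y
    simp only [hx, if_true]
    exact (Set.ext_iff.1 (hgr x hx) y).symm

theorem measurable_of_eventually_const {X Y : Type*} [MeasurableSpace X] [MeasurableSpace Y]
    (g : ℕ → X → Y) (hg : ∀ t, Measurable (g t)) (h : X → Y)
    (hev : ∀ x, ∃ T, ∀ t ≥ T, g t x = h x) : Measurable h := by
  intro S hS
  have : h ⁻¹' S = ⋃ N : ℕ, ⋂ t : ℕ, ⋂ (_ : N ≤ t), g t ⁻¹' S := by
    ext x
    obtain ⟨T, hT⟩ := hev x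
    simp only [Set.mem_preimage, Set.mem_iUnion, Set.mem_iInter]
    constructor
    · intro hx
      exact ⟨T, fun t ht => by rw [hT t ht]; exact hx⟩
    · rintro ⟨N, hN⟩
      rw [← hT (max N T) (le_max_right _ _)]
      exact hN _ (le_max_left _ _)
  rw [this]
  exact MeasurableSet.iUnion fun N => MeasurableSet.iInter fun t => MeasurableSet.iInter fun _ => hg t hS

/-- State of the auction: prices `p` and owners `o`. -/
structure AuctionState {X : Type*} [MeasurableSpace X] (d : ℕ) (f : Fin d → X → X) (X0 : Set X) (K : ℕ)
    (p : X → ℕ) (o : X → X) : Prop where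
  mp : Measurable p
  mo : Measurable o
  le : ∀ y, p y ≤ K
  mem : ∀ y, 1 ≤ p y → o y ∈ X0 ∧ ∃ l, f l (o y) = y
  inj : ∀ y y', 1 ≤ p y → 1 ≤ p y' → o y = o y' → y = y'
  cs : ∀ y, 1 ≤ p y → ∀ l, p y ≤ p (f l (o y)) + 1

/-- `y` receives a bid from `f j y`. -/
def AuctionBid {X : Type*} {d : ℕ} (f : Fin d → X → X) (X0 : Set X) (K : ℕ)
    (c : Fin d × Fin d) (p : X → ℕ) (o : X → X) (y : X) : Prop :=
  f c.2 y ∈ X0 ∧ f c.1 (f c.2 y) = y ∧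
    (∀ l, ¬ (1 ≤ p (f l (f c.2 y)) ∧ o (f l (f c.2 y)) = f c.2 y)) ∧
    (∀ l, p y ≤ p (f l (f c.2 y))) ∧ p y < K

open Classical in
theorem AuctionState.step {X : Type*} [MeasurableSpace X] [StandardBorelSpace X] {d : ℕ}
    {f : Fin d → X → X} {X0 : Set X} {K : ℕ} (hf : ∀ i, Measurable (f i)) (hX0 : MeasurableSet X0)
    (c : Fin d × Fin d) {p : X → ℕ} {o : X → X} (h : AuctionState d f X0 K p o) :
    AuctionState d f X0 K (fun y => if AuctionBid f X0 K c p o y then p y + 1 else p y)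
      (fun y => if AuctionBid f X0 K c p o y then f c.2 y else o y) := by
  have hm : MeasurableSet {y | AuctionBid f X0 K c p o y} := by
    have hl : ∀ l, Measurable fun y => f l (f c.2 y) := fun l => (hf l).comp (hf _)
    refine (hf _ hX0).inter (MeasurableSet.inter ?_ (MeasurableSet.inter ?_ (MeasurableSet.inter ?_ ?_)))
    · exact measurableSet_eq_fun (hl _) measurable_id
    · change MeasurableSet {y | ∀ l, ¬ (1 ≤ p (f l (f c.2 y)) ∧ o (f l (f c.2 y)) = f c.2 y)}
      rw [Set.ofPred_forall]
      refine MeasurableSet.iInter fun l => MeasurableSet.compl (MeasurableSet.inter ?_ ?_)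
      · exact measurableSet_le measurable_const (h.mp.comp (hl l))
      · exact measurableSet_eq_fun (h.mo.comp (hl l)) (hf _)
    · change MeasurableSet {y | ∀ l, p y ≤ p (f l (f c.2 y))}
      rw [Set.ofPred_forall]
      exact MeasurableSet.iInter fun l => measurableSet_le h.mp (h.mp.comp (hl l))
    · exact measurableSet_lt h.mp measurable_const
  have hmono : ∀ y, p y ≤ if AuctionBid f X0 K c p o y then p y + 1 else p y := by
    intro y; split_ifs <;> omega
  refine ⟨Measurable.ite hm (h.mp.add_const 1) h.mp, Measurable.ite hm (hf _) h.mo, ?_, ?_, ?_, ?_⟩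
  · intro y
    split_ifs with hb
    · exact hb.2.2.2.2
    · exact h.le y
  · intro y hy
    split_ifs at hy ⊢ with hb
    · exact ⟨hb.1, _, hb.2.1⟩
    · exact h.mem y hy
  · have aux : ∀ y y', AuctionBid f X0 K c p o y → 1 ≤ p y' → f c.2 y = o y' → False := by
      intro y y' hb hy' ho
      obtain ⟨-, l, hl⟩ := h.mem y' hy'
      refine hb.2.2.1 l ?_
      rw [ho, hl]
      exact ⟨hy', rfl⟩
    intro y y' hy hy' ho
    split_ifs at hy hy' ho with hb hb' hb'
    · rw [← hb.2.1, ho, hb'.2.1]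
    · exact (aux _ _ hb hy' ho).elim
    · exact (aux _ _ hb' hy ho.symm).elim
    · exact h.inj _ _ hy hy' ho
  · intro y hy l
    by_cases hb : AuctionBid f X0 K c p o y
    · simp only [hb, if_true] at hy ⊢
      have := hb.2.2.2.1 l
      have := hmono (f l (f c.2 y))
      omega
    · simp only [hb, if_false] at hy ⊢
      have := h.cs y hy l
      have := hmono (f l (o y))
      omega

open Classical in
theorem auction {X : Type*} [MeasurableSpace X] [StandardBorelSpace X] {d : ℕ}
    (f : Fin d → X → X) (X0 : Set X) (K : ℕ) (hf : ∀ i, Measurable (f i)) (hX0 : MeasurableSet X0)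
    (hinv : ∀ x ∈ X0, ∀ i, f i x ∈ X0 → ∃ j, f j (f i x) = x) (hd : 0 < d) :
    ∃ p o, AuctionState d f X0 K p o ∧ ∀ x ∈ X0, (∀ l, f l x ∈ X0) →
      (∃ l, 1 ≤ p (f l x) ∧ o (f l x) = x) ∨ (∀ l, K ≤ p (f l x)) := by
  have : Nonempty (Fin d) := ⟨⟨0, hd⟩⟩
  obtain ⟨m, hm⟩ : ∃ m : ℕ → Fin d × Fin d, ∀ c N, ∃ t, N ≤ t ∧ m t = c := by
    obtain ⟨u, hu⟩ := exists_surjective_nat (Fin d × Fin d)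
    refine ⟨fun t => u (Nat.unpair t).1, fun c N => ?_⟩
    obtain ⟨a, rfl⟩ := hu c
    exact ⟨Nat.pair a N, Nat.right_le_pair _ _, by simp⟩
  let S : ℕ → (X → ℕ) × (X → X) := fun t => Nat.rec (fun _ => 0, id)
    (fun t s => (fun y => if AuctionBid f X0 K (m t) s.1 s.2 y then s.1 y + 1 else s.1 y,
      fun y => if AuctionBid f X0 K (m t) s.1 s.2 y then f (m t).2 y else s.2 y)) t
  have hS1 : ∀ t y, (S (t+1)).1 y =
    if AuctionBid f X0 K (m t) (S t).1 (S t).2 y then (S t).1 y + 1 else (S t).1 y := fun t y => rfl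
  have hS2 : ∀ t y, (S (t+1)).2 y =
    if AuctionBid f X0 K (m t) (S t).1 (S t).2 y then f (m t).2 y else (S t).2 y := fun t y => rfl
  have hst : ∀ t, AuctionState d f X0 K (S t).1 (S t).2 := by
    intro t
    induction t with
    | zero =>
      refine ⟨measurable_const, measurable_id, fun y => Nat.zero_le _, ?_, ?_, ?_⟩
      · intro y hy; exact absurd hy (by simp [S])
      · intro y y' hy; exact absurd hy (by simp [S])
      · intro y hy; exact absurd hy (by simp [S])
    | succ t ih => exact ih.step hf hX0 (m t)
  have hmono : ∀ y, Monotone fun t => (S t).1 y := by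
    intro y
    refine monotone_nat_of_le_succ fun t => ?_
    rw [hS1]; split_ifs <;> omega
  have hev : ∀ y, ∃ T, ∀ t ≥ T, (S t).1 y = (S T).1 y := by
    intro y
    by_contra hcon
    push Not at hcon
    have : ∀ k, ∃ t, k ≤ (S t).1 y := by
      intro k
      induction k with
      | zero => exact ⟨0, Nat.zero_le _⟩
      | succ k ih =>
        obtain ⟨T, hT⟩ := ih
        obtain ⟨t, ht, hne⟩ := hcon T
        have := hmono y ht
        dsimp only at this
        exact ⟨t, by omega⟩
    obtain ⟨t, ht⟩ := this (K + 1)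
    have := (hst t).le y
    omega
  choose T hT using hev
  have hTo : ∀ y, ∀ t ≥ T y, (S t).2 y = (S (T y)).2 y := by
    intro y t ht
    induction t, ht using Nat.le_induction with
    | base => rfl
    | succ t ht ih =>
      rw [hS2, if_neg, ih]
      intro hb
      have h1 := hS1 t y
      rw [if_pos hb, hT y t ht, hT y (t+1) (by omega)] at h1
      omega
  have hcommon : ∀ s : Finset X, ∃ N, ∀ t ≥ N, ∀ y ∈ s, (S t).1 y = (S (T y)).1 y ∧ (S t).2 y = (S (T y)).2 y := by
    intro s
    refine ⟨s.sup T, fun t ht y hy => ?_⟩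
    have : T y ≤ t := (Finset.le_sup hy).trans ht
    exact ⟨hT y t this, hTo y t this⟩
  refine ⟨fun y => (S (T y)).1 y, fun y => (S (T y)).2 y, ⟨?_, ?_, ?_, ?_, ?_, ?_⟩, ?_⟩
  · exact measurable_of_eventually_const _ (fun t => (hst t).mp) _ fun y => ⟨T y, hT y⟩
  · exact measurable_of_eventually_const _ (fun t => (hst t).mo) _ fun y => ⟨T y, hTo y⟩
  · exact fun y => (hst _).le y
  · exact fun y hy => (hst _).mem y hy
  · intro y y' hy hy' ho
    obtain ⟨N, hN⟩ := hcommon {y, y'}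
    obtain ⟨h1, h2⟩ := hN N le_rfl y (by simp)
    obtain ⟨h3, h4⟩ := hN N le_rfl y' (by simp)
    rw [← h1] at hy
    rw [← h3] at hy'
    rw [← h2, ← h4] at ho
    exact (hst N).inj y y' hy hy' ho
  · intro y hy l
    obtain ⟨N, hN⟩ := hcommon {y, f l ((S (T y)).2 y)}
    obtain ⟨h1, h2⟩ := hN N le_rfl y (by simp)
    obtain ⟨h3, h4⟩ := hN N le_rfl (f l ((S (T y)).2 y)) (by simp)
    rw [← h1] at hy ⊢
    rw [← h3, ← h2]
    exact (hst N).cs y hy l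
  · intro x hx hxl
    by_contra hcon
    push Not at hcon
    obtain ⟨hun, l0, hl0⟩ := hcon
    obtain ⟨i, hi⟩ := Finite.exists_min (fun l => (S (T (f l x))).1 (f l x))
    obtain ⟨j, hj⟩ := hinv x hx i (hxl i)
    obtain ⟨N, hN⟩ := hcommon (Finset.univ.image fun l => f l x)
    obtain ⟨t, ht, hmt⟩ := hm (i, j) N
    have hN' : ∀ l, _ := fun l => hN t ht (f l x) (Finset.mem_image_of_mem _ (Finset.mem_univ l))
    have hb : AuctionBid f X0 K (m t) (S t).1 (S t).2 (f i x) := by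
      rw [hmt]
      refine ⟨?_, ?_, ?_, ?_, ?_⟩
      · simpa only [hj] using hx
      · simp only [hj]
      · intro l
        simp only [hj]
        rw [(hN' l).1, (hN' l).2]
        rintro ⟨h1, h2⟩
        exact hun l h1 h2
      · intro l
        simp only [hj]
        rw [(hN' l).1, (hN' i).1]
        exact hi l
      · rw [(hN' i).1]
        exact (hi l0).trans_lt hl0
    have h1 := hS1 t (f i x)
    rw [if_pos hb, (hN (t+1) (by omega) (f i x) (Finset.mem_image_of_mem _ (Finset.mem_univ i))).1,
      (hN' i).1] at h1
    omega

theorem transport {X : Type*} [MeasurableSpace X] [StandardBorelSpace X] (μ : Measure X) {d : ℕ}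
    (f : Fin d → X → X) (X0 : Set X) (hf : ∀ i, Measurable (f i)) (hX0 : MeasurableSet X0)
    (hinj : ∀ x ∈ X0, Function.Injective (fun i => f i x))
    (hinv : ∀ x ∈ X0, ∀ i, f i x ∈ X0 → ∃ j, f j (f i x) = x) (hd : 0 < d)
    (hmp : ∀ i, ∀ B ⊆ X0, MeasurableSet B → Set.InjOn (f i) B → μ (f i '' B) = μ B)
    (A R : Set X) (hA : MeasurableSet A) (hR : MeasurableSet R) (hA0 : A ⊆ X0)
    (hA1 : ∀ x ∈ A, ∀ l, f l x ∈ X0) (hAR : ∀ x ∈ A, ∀ l, f l x ∈ R) : μ A ≤ μ R := by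
  let P : Fin d → Fin d → Set X := fun i j => A ∩ {x | f j (f i x) = x}
  let Q : Fin d → Fin d → Set X := fun i j => R ∩ {y | f j y ∈ X0 ∧ f i (f j y) = y}
  have hPm : ∀ i j, MeasurableSet (P i j) := fun i j =>
    hA.inter (measurableSet_eq_fun ((hf j).comp (hf i)) measurable_id)
  have hQm : ∀ i j, MeasurableSet (Q i j) := fun i j =>
    hR.inter ((hf j hX0).inter (measurableSet_eq_fun ((hf i).comp (hf j)) measurable_id))
  have h1 : ∀ i, μ A ≤ ∑ j, μ (P i j) := by
    intro i
    refine (measure_mono ?_).trans (measure_iUnion_fintype_le μ (P i))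
    intro x hx
    obtain ⟨j, hj⟩ := hinv x (hA0 hx) i (hA1 x hx i)
    exact Set.mem_iUnion.2 ⟨j, hx, hj⟩
  have h2 : ∀ i j, μ (P i j) ≤ μ (Q i j) := by
    intro i j
    have hin : Set.InjOn (f i) (P i j) := by
      intro x hx x' hx' h
      rw [← hx.2, h, hx'.2]
    rw [← hmp i (P i j) (fun x hx => hA0 hx.1) (hPm i j) hin]
    apply measure_mono
    rintro _ ⟨x, hx, rfl⟩
    refine ⟨hAR x hx.1 i, ?_, ?_⟩
    · change f j (f i x) ∈ X0
      rw [hx.2]; exact hA0 hx.1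
    · change f i (f j (f i x)) = f i x
      rw [hx.2]
  have h3 : ∀ j, ∑ i, μ (Q i j) ≤ μ R := by
    intro j
    rw [← tsum_fintype (L := .unconditional _), ← measure_iUnion ?_ (fun i => hQm i j)]
    · exact measure_mono (Set.iUnion_subset fun i => Set.inter_subset_left)
    · intro a b hab
      refine Set.disjoint_left.2 fun y hy hy' => hab ?_
      exact hinj _ hy.2.1 (hy.2.2.trans hy'.2.2.symm)
  have h4 : (d : ℝ≥0∞) * μ A ≤ d * μ R := by
    calc (d : ℝ≥0∞) * μ A = ∑ _i : Fin d, μ A := by simp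
      _ ≤ ∑ i, ∑ j, μ (P i j) := Finset.sum_le_sum fun i _ => h1 i
      _ ≤ ∑ i, ∑ j, μ (Q i j) := Finset.sum_le_sum fun i _ => Finset.sum_le_sum fun j _ => h2 i j
      _ = ∑ j, ∑ i, μ (Q i j) := Finset.sum_comm
      _ ≤ ∑ _j : Fin d, μ R := Finset.sum_le_sum fun j _ => h3 j
      _ = d * μ R := by simp
  exact (ENNReal.mul_le_mul_iff_right (by exact_mod_cast hd.ne') (ENNReal.natCast_ne_top d)).1 h4

/-- let `G` be a measure-preserving `2n`-regular countable Borel graph on a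
standard probability space `(X,μ)` and `ε > 0`. Then there exists a measure-preserving
partial isomorphism `θ : A → B` with `graph(θ) ⊆ G` and `μ(A) > 1 − ε`. -/
theorem regular_graph_contains_large_partial_iso
    {X : Type*} [MeasurableSpace X] [StandardBorelSpace X]
    (μ : Measure X) [IsProbabilityMeasure μ]
    (n : ℕ) (hn : 1 ≤ n) (G : Set (X × X)) (hGBorel : MeasurableSet G)
    (hGsym : ∀ p : X × X, p ∈ G ↔ (p.2, p.1) ∈ G)
    (hGreg : ∀ᵐ x ∂μ, ({y | (x, y) ∈ G}).encard = (2 * n : ℕ))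
    -- `G` is contained in a countable measure-preserving equivalence relation `E`:
    (E : Set (X × X)) (hE : Equivalence fun x y => (x, y) ∈ E)
    (hcnt : ∀ x, {y | (x, y) ∈ E}.Countable)
    (hGE : G ⊆ E)
    (hmp : ∀ (g : X → X) (A : Set X), MeasurableSet A → Measurable g →
      Set.InjOn g A → (∀ x ∈ A, (x, g x) ∈ E) → μ (g '' A) = μ A)
    (ε : ℝ≥0∞) (hε : 0 < ε) :
    ∃ (A : Set X) (θ : X → X),
      MeasurableSet A ∧ Measurable θ ∧ Set.InjOn θ A ∧ MeasurableSet (θ '' A) ∧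
      (∀ x ∈ A, (x, θ x) ∈ G) ∧
      (∀ s ⊆ A, MeasurableSet s → μ (θ '' s) = μ s) ∧
      1 - ε < μ A := by
  obtain ⟨N, hsub, hNm, hN0⟩ := exists_measurable_superset_of_null (ae_iff.1 hGreg)
  set X0 : Set X := Nᶜ with hX0def
  have hX0 : MeasurableSet X0 := hNm.compl
  have hX0c : μ X0ᶜ = 0 := by rw [hX0def, compl_compl]; exact hN0
  have hreg : ∀ x ∈ X0, ({y | (x, y) ∈ G}).encard = (2 * n : ℕ) := by
    intro x hx
    by_contra h
    exact hx (hsub h)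
  obtain ⟨f, hf, hinj, hfG⟩ := exists_enum G hGBorel (2 * n) X0 hX0 hreg
  have hd : 0 < 2 * n := by omega
  have hfE : ∀ i, ∀ x ∈ X0, (x, f i x) ∈ E := fun i x hx => hGE ((hfG x hx _).2 ⟨i, rfl⟩)
  have hinv : ∀ x ∈ X0, ∀ i, f i x ∈ X0 → ∃ j, f j (f i x) = x := by
    intro x hx i hi
    exact (hfG _ hi x).1 ((hGsym (x, f i x)).1 ((hfG x hx _).2 ⟨i, rfl⟩))
  have hmpf : ∀ i, ∀ B ⊆ X0, MeasurableSet B → Set.InjOn (f i) B → μ (f i '' B) = μ B :=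
    fun i B hB hBm hBi => hmp (f i) B hBm (hf i) hBi fun x hx => hfE i x (hB hx)
  set X1 : Set X := X0 ∩ ⋂ l, f l ⁻¹' X0 with hX1def
  have hX1 : MeasurableSet X1 := hX0.inter (MeasurableSet.iInter fun l => hf l hX0)
  have hX1c : μ X1ᶜ = 0 := by
    have hS : ∀ l, μ (X0 ∩ f l ⁻¹' X0ᶜ) = 0 := by
      intro l
      refine null_of_image_null μ (f l) (hf l) _ (hX0.inter (hf l hX0.compl)) ?_ ?_
      · intro y
        refine (hcnt y).mono ?_
        rintro x ⟨hx, rfl⟩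
        exact hE.symm (hfE l x hx.1)
      · intro B hB hBm hBi
        rw [← hmpf l B (fun x hx => (hB hx).1) hBm hBi]
        refine measure_mono_null ?_ hX0c
        rintro _ ⟨x, hx, rfl⟩
        exact (hB hx).2
    refine measure_mono_null ?_ (measure_union_null hX0c (measure_iUnion_null hS))
    intro x hx
    by_cases hx0 : x ∈ X0
    · right
      by_contra hcon
      apply hx
      refine ⟨hx0, Set.mem_iInter.2 fun l => ?_⟩
      by_contra hl
      exact hcon (Set.mem_iUnion.2 ⟨l, hx0, hl⟩)
    · exact Or.inl hx0
  have hX1l : ∀ x ∈ X1, ∀ l, f l x ∈ X0 := fun x hx l => Set.mem_iInter.1 hx.2 l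
  set ε' := min ε 1 with hε'
  obtain ⟨K, hK⟩ := ENNReal.exists_inv_nat_lt (a := ε') (lt_min hε one_pos).ne'
  obtain ⟨p, o, hst, hend⟩ := auction f X0 K hf hX0 hinv hd
  set U : Set X := X1 ∩ {x | ∀ l, ¬ (1 ≤ p (f l x) ∧ o (f l x) = x)} with hU
  have hUm : MeasurableSet U := by
    refine hX1.inter ?_
    rw [Set.ofPred_forall]
    refine MeasurableSet.iInter fun l => MeasurableSet.compl (MeasurableSet.inter ?_ ?_)
    · exact measurableSet_le measurable_const (hst.mp.comp (hf l))
    · exact measurableSet_eq_fun (hst.mo.comp (hf l)) measurable_id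
  let R : ℕ → Set X := fun k => {y | k ≤ p y}
  have hRm : ∀ k, MeasurableSet (R k) := fun k => measurableSet_le measurable_const hst.mp
  have hoinj : ∀ k, Set.InjOn o (R (k + 1)) := fun k y hy y' hy' h =>
    hst.inj y y' (le_trans (Nat.le_add_left 1 k) hy) (le_trans (Nat.le_add_left 1 k) hy') h
  have hoG : ∀ y, 1 ≤ p y → (y, o y) ∈ G := by
    intro y hy
    obtain ⟨h0, l, hl⟩ := hst.mem y hy
    exact (hGsym (o y, y)).1 ((hfG _ h0 y).2 ⟨l, hl⟩)
  have homp : ∀ s ⊆ R 1, MeasurableSet s → μ (o '' s) = μ s := fun s hs hsm =>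
    hmp o s hsm hst.mo ((hoinj 0).mono hs) fun y hy => hGE (hoG y (hs hy))
  have hR1 : ∀ k, R (k + 1) ⊆ R 1 := fun k y hy => le_trans (Nat.le_add_left 1 k) hy
  have hstep : ∀ k < K, μ (R (k + 1)) + μ U ≤ μ (R k) := by
    intro k hk
    have him : MeasurableSet (o '' R (k + 1)) := (hRm _).image_of_measurable_injOn hst.mo (hoinj k)
    have hdisj : Disjoint (o '' R (k + 1) ∩ X1) U := by
      refine Set.disjoint_left.2 ?_
      rintro _ ⟨⟨y, hy, rfl⟩, -⟩ hyU
      obtain ⟨-, l, hl⟩ := hst.mem y (hR1 k hy)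
      refine hyU.2 l ?_
      rw [hl]
      exact ⟨hR1 k hy, rfl⟩
    have h1 : μ (R (k + 1)) = μ (o '' R (k + 1) ∩ X1) := by
      rw [measure_inter_conull hX1c, homp _ (hR1 k) (hRm _)]
    rw [h1, ← measure_union hdisj hUm]
    refine transport μ f X0 hf hX0 hinj hinv hd hmpf _ _ ((him.inter hX1).union hUm) (hRm k) ?_ ?_ ?_
    · rintro x (hx | hx)
      · exact hx.2.1
      · exact hx.1.1
    · rintro x (hx | hx)
      · exact hX1l x hx.2
      · exact hX1l x hx.1
    · rintro x (⟨⟨y, hy, rfl⟩, -⟩ | hx) l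
      · have h2 := hst.cs y (hR1 k hy) l
        have h3 : k + 1 ≤ p y := hy
        change k ≤ p (f l (o y))
        omega
      · rcases hend x hx.1.1 (hX1l x hx.1) with ⟨l', hl'⟩ | h
        · exact (hx.2 l' hl').elim
        · exact hk.le.trans (h l)
  have hsum : ∀ k ≤ K, μ (R k) + k * μ U ≤ 1 := by
    intro k hk
    induction k with
    | zero => simpa using prob_le_one
    | succ k ih =>
      calc μ (R (k + 1)) + ((k + 1 : ℕ) : ℝ≥0∞) * μ U = μ (R (k + 1)) + μ U + k * μ U := by
            push_cast; ring
        _ ≤ μ (R k) + k * μ U := by gcongr; exact hstep k hk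
        _ ≤ 1 := ih (by omega)
  have hUK : μ U < ε' := by
    refine lt_of_le_of_lt ?_ hK
    rw [ENNReal.le_inv_iff_mul_le, mul_comm]
    exact le_trans le_add_self (hsum K le_rfl)
  have hone : 1 ≤ μ U + μ (R 1) := by
    calc (1 : ℝ≥0∞) = μ X1 := ((prob_compl_eq_zero_iff hX1).1 hX1c).symm
      _ ≤ μ (U ∪ o '' R 1) := by
        refine measure_mono fun x hx => ?_
        by_cases hxU : x ∈ U
        · exact Or.inl hxU
        · right
          have : ∃ l, 1 ≤ p (f l x) ∧ o (f l x) = x := by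
            by_contra hcon
            push Not at hcon
            exact hxU ⟨hx, fun l h => hcon l h.1 h.2⟩
          obtain ⟨l, h1, h2⟩ := this
          exact ⟨f l x, h1, h2⟩
      _ ≤ μ U + μ (o '' R 1) := measure_union_le _ _
      _ = μ U + μ (R 1) := by rw [homp _ le_rfl (hRm 1)]
  refine ⟨R 1, o, hRm 1, hst.mo, hoinj 0, (hRm 1).image_of_measurable_injOn hst.mo (hoinj 0),
    fun y hy => hoG y hy, homp, ?_⟩
  by_contra hcon
  have h1 : μ (R 1) ≤ 1 - ε' := (not_lt.1 hcon).trans (tsub_le_tsub_left (min_le_left _ _) _)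
  have h2 : μ U + μ (R 1) < ε' + (1 - ε') :=
    ENNReal.add_lt_add_of_lt_of_le (ne_top_of_le_ne_top (by simp) h1) hUK h1
  rw [add_tsub_cancel_of_le (min_le_right _ _)] at h2
  exact absurd hone (not_le.2 h2)
end
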